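/- arXiv:2107.06974 — 12 statements merged into one kernel-verified Lean document; each statement's English description precedes it below -/
import Mathlib

section
/- For every integer r ≥ 2, setting R = C(2r−1, r) (the binomial coefficient), there exist a constant c > 0 and n₀ such that for all n ≥ n₀, every permutation of [n] contains r-twins of length at least c · n^{R/(2R−1)}; that is, t^(r)(n) ≥ c · n^{R/(2R−1)}. -/
/-- `r`-twins of length `k` in a permutation `π` of `[n]` (modeled as `Fin n`):
`r` subsequences of `π`, given by their strictly increasing position maps `p j`,
occupying pairwise disjoint sets of positions, whose value sequences are pairwise
similar (i.e., have the same relative order). -/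
def HasTwins (r k n : ℕ) (π : Equiv.Perm (Fin n)) : Prop :=
  ∃ p : Fin r → Fin k → Fin n,
    (∀ j, StrictMono (p j)) ∧
    (∀ j j', j ≠ j' → ∀ i i', p j i ≠ p j' i') ∧
    (∀ j j' i i', π (p j i) < π (p j i') ↔ π (p j' i) < π (p j' i'))

/-- If every two distinct elements of `I` are comparable in one of finitely many strict orders,
then one of these orders has a chain `C ⊆ I` with `|I| ≤ |C| ^ κ`, `κ` the number of orders. -/
theorem exists_isChain_card_le_pow {α κ : Type*} [Fintype κ] [Nonempty κ]
    (lt : κ → α → α → Prop) (irrefl : ∀ k a, ¬ lt k a a)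
    (trans : ∀ k a b c, lt k a b → lt k b c → lt k a c) (I : Finset α)
    (compar : ∀ a ∈ I, ∀ b ∈ I, a ≠ b → ∃ k, lt k a b ∨ lt k b a) :
    ∃ k, ∃ C ⊆ I, IsChain (lt k) (C : Set α) ∧ I.card ≤ C.card ^ Fintype.card κ := by
  classical
  obtain ⟨⟨k₀, C₀⟩, hmem, hmax⟩ := Finset.exists_max_image
    (((Finset.univ : Finset κ) ×ˢ I.powerset).filter fun x => IsChain (lt x.1) (x.2 : Set α))
    (fun x => x.2.card) ⟨(Classical.arbitrary κ, ∅), by simp⟩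
  simp only [Finset.mem_filter, Finset.mem_product, Finset.mem_univ, Finset.mem_powerset,
    true_and] at hmem hmax
  refine ⟨k₀, C₀, hmem.1, hmem.2, ?_⟩
  let topped : κ → α → Finset (Finset α) := fun k i => I.powerset.filter fun C =>
    IsChain (lt k) (C : Set α) ∧ i ∈ C ∧ ∀ c ∈ C, c ≠ i → lt k c i
  let label : κ → α → ℕ := fun k i => (topped k i).sup Finset.card
  have mem_topped : ∀ k i C, C ∈ topped k i ↔
      C ⊆ I ∧ IsChain (lt k) (C : Set α) ∧ i ∈ C ∧ ∀ c ∈ C, c ≠ i → lt k c i := by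
    intro k i C
    simp [topped]
  have singleton_mem : ∀ k, ∀ i ∈ I, {i} ∈ topped k i := by
    intro k i hi
    rw [mem_topped]
    simp [hi]
  have label_lt : ∀ k, ∀ a ∈ I, ∀ b ∈ I, lt k a b → label k a < label k b := by
    intro k a ha b hb hab
    obtain ⟨C, hC, hCa⟩ := Finset.exists_mem_eq_sup (topped k a) ⟨_, singleton_mem k a ha⟩
      Finset.card
    rw [mem_topped] at hC
    obtain ⟨hCI, hch, haC, hlt⟩ := hC
    have below : ∀ c ∈ C, lt k c b := by
      intro c hc
      by_cases h : c = a
      · exact h ▸ hab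
      · exact trans k c a b (hlt c hc h) hab
    have hbC : b ∉ C := fun h => irrefl k b (below b h)
    have hins : insert b C ∈ topped k b := by
      rw [mem_topped]
      refine ⟨Finset.insert_subset hb hCI, ?_, Finset.mem_insert_self _ _, ?_⟩
      · rw [Finset.coe_insert]
        exact hch.insert fun c hc _ => Or.inr (below c hc)
      · intro c hc hcb
        exact below c ((Finset.mem_insert.1 hc).resolve_left hcb)
    have hle := Finset.le_sup (f := Finset.card) hins
    rw [Finset.card_insert_of_notMem hbC] at hle
    change (topped k a).sup Finset.card < (topped k b).sup Finset.card
    omega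
  have label_mem : ∀ k, ∀ i ∈ I, label k i ∈ Finset.Icc 1 C₀.card := by
    intro k i hi
    rw [Finset.mem_Icc]
    constructor
    · exact Finset.le_sup (f := Finset.card) (singleton_mem k i hi)
    · refine Finset.sup_le fun C hC => ?_
      rw [mem_topped] at hC
      exact hmax (k, C) ⟨hC.1, hC.2.1⟩
  have hcard : I.card ≤ (Fintype.piFinset fun _ : κ => Finset.Icc 1 C₀.card).card := by
    refine Finset.card_le_card_of_injOn (fun i k => label k i) ?_ ?_
    · intro i hi
      simp only [Finset.mem_coe, Fintype.mem_piFinset]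
      exact fun k => label_mem k i hi
    · intro a ha b hb hab
      by_contra hne
      obtain ⟨k, h | h⟩ := compar a ha b hb hne
      · exact (label_lt k a ha b hb h).ne (congrFun hab k)
      · exact (label_lt k b hb a ha h).ne (congrFun hab k).symm
  simpa [Fintype.card_piFinset] using hcard

/-- Among `2r - 1` injective maps, `r` of them order some set `C` identically, where
`|I| ≤ |C| ^ (2r-1 choose r)`. -/
theorem exists_common_order {α β : Type*} [LinearOrder β] (r : ℕ) (I : Finset α)
    (σ : Fin (2 * r - 1) → α → β) (inj : ∀ j, Set.InjOn (σ j) I) :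
    ∃ S : Fin r ↪o Fin (2 * r - 1), ∃ C ⊆ I,
      (∀ a ∈ C, ∀ b ∈ C, a ≠ b →
        (∀ j, σ (S j) a < σ (S j) b) ∨ (∀ j, σ (S j) b < σ (S j) a)) ∧
      I.card ≤ C.card ^ (2 * r - 1).choose r := by
  classical
  rcases Nat.eq_zero_or_pos r with rfl | hr
  · refine ⟨(Fin.castLEOrderEmb (by simp)), I, subset_rfl, ?_, by simp⟩
    exact fun a _ b _ _ => Or.inl fun j => j.elim0
  let κ := {S : Finset (Fin (2 * r - 1)) // S ∈ Finset.powersetCard r Finset.univ}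
  have hne : (Finset.powersetCard r (Finset.univ : Finset (Fin (2 * r - 1)))).Nonempty := by
    rw [Finset.powersetCard_nonempty, Finset.card_univ, Fintype.card_fin]
    omega
  have : Nonempty κ := hne.to_subtype
  have card_κ : Fintype.card κ = (2 * r - 1).choose r := by
    simp [κ]
  have card_mem : ∀ S : κ, S.1.card = r := fun S => (Finset.mem_powersetCard.1 S.2).2
  obtain ⟨S, C, hCI, hch, hcard⟩ := exists_isChain_card_le_pow
    (fun (S : κ) a b => ∀ j ∈ S.1, σ j a < σ j b)
    (fun S a h => by
      obtain ⟨j, hj⟩ : S.1.Nonempty := Finset.card_pos.1 (by rw [card_mem S]; exact hr)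
      exact lt_irrefl _ (h j hj))
    (fun S a b c hab hbc j hj => (hab j hj).trans (hbc j hj)) I
    (by
      intro a ha b hb hab
      have hsum := Finset.card_filter_add_card_filter_not (s := Finset.univ)
        (fun j : Fin (2 * r - 1) => σ j a < σ j b)
      rw [Finset.card_univ, Fintype.card_fin] at hsum
      rcases le_or_gt r (Finset.univ.filter fun j => σ j a < σ j b).card with h | h
      · obtain ⟨S, hS, hSr⟩ := Finset.exists_subset_card_eq h
        refine ⟨⟨S, Finset.mem_powersetCard.2 ⟨Finset.subset_univ _, hSr⟩⟩, Or.inl ?_⟩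
        exact fun j hj => (Finset.mem_filter.1 (hS hj)).2
      · have h' : r ≤ (Finset.univ.filter fun j => ¬ σ j a < σ j b).card := by omega
        obtain ⟨S, hS, hSr⟩ := Finset.exists_subset_card_eq h'
        refine ⟨⟨S, Finset.mem_powersetCard.2 ⟨Finset.subset_univ _, hSr⟩⟩, Or.inr ?_⟩
        intro j hj
        exact lt_of_le_of_ne (not_lt.1 (Finset.mem_filter.1 (hS hj)).2)
          fun h => hab (inj j ha hb h.symm))
  refine ⟨S.1.orderEmbOfFin (card_mem S), C, hCI, ?_, card_κ ▸ hcard⟩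
  intro a ha b hb hab
  have hmem := S.1.orderEmbOfFin_mem (card_mem S)
  rcases hch ha hb hab with h | h
  · exact Or.inl fun j => h _ (hmem j)
  · exact Or.inr fun j => h _ (hmem j)

/-- The tuples of `A` are the columns of `r`-twins of length `|A|` in `π`, and within each tuple
the values lie in a single interval `[t * i, t * (i + 1))`. -/
structure IsTwinFamily_s0 {r n : ℕ} (π : Equiv.Perm (Fin n)) (t : ℕ)
    (A : Finset (Fin r → Fin n)) : Prop where
  lt_or_lt : ∀ q ∈ A, ∀ q' ∈ A, q ≠ q' → (∀ j, q j < q' j) ∨ (∀ j, q' j < q j)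
  similar : ∀ q ∈ A, ∀ q' ∈ A, ∀ j j', π (q j) < π (q' j) → π (q j') < π (q' j')
  disjoint : ∀ q ∈ A, ∀ q' ∈ A, ∀ j j', j ≠ j' → q j ≠ q' j'
  div_eq : ∀ q ∈ A, ∀ j j', (π (q j) : ℕ) / t = (π (q j') : ℕ) / t

theorem IsTwinFamily_s0.hasTwins {r n t : ℕ} (hr : 0 < r) {π : Equiv.Perm (Fin n)}
    {A : Finset (Fin r → Fin n)} (hA : IsTwinFamily_s0 π t A) : HasTwins r A.card n π := by
  classical
  let j₀ : Fin r := ⟨0, hr⟩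
  have hinj : Set.InjOn (fun q : Fin r → Fin n => q j₀) A := by
    intro q hq q' hq' h
    by_contra hne
    rcases hA.lt_or_lt q hq q' hq' hne with h' | h'
    · exact (h' j₀).ne h
    · exact (h' j₀).ne h.symm
  have hcard : (A.image fun q => q j₀).card = A.card := Finset.card_image_of_injOn hinj
  let e := (A.image fun q => q j₀).orderEmbOfFin hcard
  have hex : ∀ i, ∃ q ∈ A, q j₀ = e i := fun i =>
    Finset.mem_image.1 (Finset.orderEmbOfFin_mem _ hcard i)
  choose q hqA hq using hex
  refine ⟨fun j i => q i j, ?_, ?_, ?_⟩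
  · intro j i i' hii'
    have hlt : q i j₀ < q i' j₀ := by
      rw [hq, hq]
      exact e.strictMono hii'
    have hne : q i ≠ q i' := fun h => hlt.ne (congrFun h j₀)
    rcases hA.lt_or_lt _ (hqA i) _ (hqA i') hne with h | h
    · exact h j
    · exact absurd (h j₀) hlt.asymm
  · exact fun j j' hjj' i i' => hA.disjoint _ (hqA i) _ (hqA i') j j' hjj'
  · exact fun j j' i i' => ⟨hA.similar _ (hqA i) _ (hqA i') j j',
      hA.similar _ (hqA i) _ (hqA i') j' j⟩

theorem IsTwinFamily_s0.union {r n t : ℕ} [DecidableEq (Fin r → Fin n)] {π : Equiv.Perm (Fin n)}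
    {A B : Finset (Fin r → Fin n)} (hA : IsTwinFamily_s0 π t A) (hB : IsTwinFamily_s0 π t B)
    (hlt : ∀ q ∈ A, ∀ q' ∈ B, ∀ j j', q j < q' j')
    (hdiv : ∀ q ∈ A, ∀ q' ∈ B, ∀ j j', (π (q j) : ℕ) / t ≠ (π (q' j') : ℕ) / t) :
    IsTwinFamily_s0 π t (A ∪ B) := by
  have lt_of_div : ∀ x y x' y' : Fin n, (x : ℕ) / t = (x' : ℕ) / t → (y : ℕ) / t = (y' : ℕ) / t →
      (x : ℕ) / t ≠ (y : ℕ) / t → x < y → x' < y' := by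
    intro x y x' y' hx hy hne h
    by_contra hn
    have h₁ : (x : ℕ) / t ≤ (y : ℕ) / t := Nat.div_le_div_right (Fin.le_def.1 h.le)
    have h₂ : (y' : ℕ) / t ≤ (x' : ℕ) / t := Nat.div_le_div_right (Fin.le_def.1 (not_lt.1 hn))
    omega
  refine ⟨?_, ?_, ?_, ?_⟩
  · intro q hq q' hq' hne
    rcases Finset.mem_union.1 hq with h | h <;> rcases Finset.mem_union.1 hq' with h' | h'
    · exact hA.lt_or_lt q h q' h' hne
    · exact Or.inl fun j => hlt q h q' h' j j
    · exact Or.inr fun j => hlt q' h' q h j j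
    · exact hB.lt_or_lt q h q' h' hne
  · intro q hq q' hq' j j'
    rcases Finset.mem_union.1 hq with h | h <;> rcases Finset.mem_union.1 hq' with h' | h'
    · exact hA.similar q h q' h' j j'
    · exact lt_of_div _ _ _ _ (hA.div_eq q h j j') (hB.div_eq q' h' j j') (hdiv q h q' h' j j)
    · exact lt_of_div _ _ _ _ (hB.div_eq q h j j') (hA.div_eq q' h' j j')
        (hdiv q' h' q h j j).symm
    · exact hB.similar q h q' h' j j'
  · intro q hq q' hq' j j' hjj'
    rcases Finset.mem_union.1 hq with h | h <;> rcases Finset.mem_union.1 hq' with h' | h'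
    · exact hA.disjoint q h q' h' j j' hjj'
    · exact (hlt q h q' h' j j').ne
    · exact (hlt q' h' q h j' j).ne'
    · exact hB.disjoint q h q' h' j j' hjj'
  · intro q hq
    rcases Finset.mem_union.1 hq with h | h
    · exact hA.div_eq q h
    · exact hB.div_eq q h

/-- Cut the values into consecutive groups of size `m`. All but at most one group for each of the
`n / t + 1` value intervals of length `t`, and one incomplete group, are contained in such an
interval. -/
theorem exists_value_groups {n m : ℕ} (hm : 0 < m) (t : ℕ) (V : Finset (Fin n))
    (hV : V.Nonempty) :
    ∃ I : Finset ℕ, ∃ g : Fin m → ℕ → Fin n,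
      V.card ≤ m * (I.card + (n / t + 2)) ∧ I.card ≤ V.card ∧
      (∀ i ∈ I, ∀ j, g j i ∈ V) ∧
      (∀ i ∈ I, ∀ j j', (g j i : ℕ) / t = (g j' i : ℕ) / t) ∧
      (∀ i ∈ I, ∀ i' ∈ I, ∀ j j', i < i' → g j i < g j' i') ∧
      (∀ i ∈ I, ∀ j j', j ≠ j' → g j i ≠ g j' i) := by
  have hpos := hV.card_pos
  let f : ℕ → Fin n := fun k => V.orderEmbOfFin rfl ⟨min k (V.card - 1), by omega⟩
  have f_mem : ∀ k, f k ∈ V := fun k => V.orderEmbOfFin_mem rfl _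
  have f_lt : ∀ a b, a < b → b < V.card → f a < f b := by
    intro a b hab hb
    refine (V.orderEmbOfFin rfl).strictMono (Fin.lt_def.2 ?_)
    simp only
    omega
  have f_div : ∀ a b, a ≤ b → (f a : ℕ) / t ≤ (f b : ℕ) / t := by
    intro a b hab
    refine Nat.div_le_div_right (Fin.le_def.1 ((V.orderEmbOfFin rfl).monotone (Fin.le_def.2 ?_)))
    simp only
    omega
  have end_le : ∀ i i', i < i' → m * i + m ≤ m * i' := by
    intro i i' h
    calc m * i + m = m * (i + 1) := by ring
      _ ≤ m * i' := Nat.mul_le_mul_left m h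
  have end_card : ∀ i, i < V.card / m → m * i + m ≤ V.card := by
    intro i h
    exact (end_le i _ h).trans (Nat.mul_div_le _ _)
  let P : ℕ → Prop := fun i => (f (m * i) : ℕ) / t = (f (m * i + (m - 1)) : ℕ) / t
  have hbad : ((Finset.range (V.card / m)).filter fun i => ¬ P i).card ≤ n / t + 1 := by
    rw [← Finset.card_range (n / t + 1)]
    refine Finset.card_le_card_of_injOn (fun i => (f (m * i) : ℕ) / t) ?_ ?_
    · intro i _
      simp only [Finset.coe_range, Set.mem_Iio]
      exact Nat.lt_succ_of_le (Nat.div_le_div_right (f (m * i)).isLt.le)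
    · have key : ∀ i i', ¬ P i → (f (m * i) : ℕ) / t = (f (m * i') : ℕ) / t → ¬ i < i' := by
        intro i i' hP h hlt
        refine hP (le_antisymm (f_div _ _ (by omega)) ?_)
        rw [h]
        exact f_div _ _ (by have := end_le i i' hlt; omega)
      intro i hi i' hi' h
      have hi := (Finset.mem_filter.1 hi).2
      have hi' := (Finset.mem_filter.1 hi').2
      have h₁ := key i i' hi h
      have h₂ := key i' i hi' h.symm
      omega
  have hsum := Finset.card_filter_add_card_filter_not (s := Finset.range (V.card / m)) P
  rw [Finset.card_range] at hsum
  refine ⟨(Finset.range (V.card / m)).filter P, fun j i => f (m * i + j), ?_, ?_,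
    fun i _ j => f_mem _, ?_, ?_, ?_⟩
  · have hlt : V.card < m * (V.card / m + 1) := Nat.lt_mul_div_succ _ hm
    exact hlt.le.trans (Nat.mul_le_mul_left m (by omega))
  · exact (show _ ≤ V.card / m by omega).trans (Nat.div_le_self _ _)
  · intro i hi j j'
    have hP : P i := (Finset.mem_filter.1 hi).2
    have hconst : ∀ j : Fin m, (f (m * i + j) : ℕ) / t = (f (m * i) : ℕ) / t := by
      intro j
      refine le_antisymm ?_ (f_div _ _ (by omega))
      rw [show (f (m * i) : ℕ) / t = _ from hP]
      exact f_div _ _ (by omega)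
    exact (hconst j).trans (hconst j').symm
  · intro i _ i' hi' j j' hii'
    have h₁ := end_le i i' hii'
    have h₂ := end_card i' (Finset.mem_range.1 (Finset.mem_filter.1 hi').1)
    exact f_lt _ _ (by omega) (by omega)
  · intro i hi j j' hjj'
    have h := end_card i (Finset.mem_range.1 (Finset.mem_filter.1 hi).1)
    rcases lt_or_gt_of_ne hjj' with h' | h'
    · exact (f_lt _ _ (by omega) (by omega)).ne
    · exact (f_lt _ _ (by omega) (by omega)).ne'

/-- A set `X` of at most `y ^ (2r-1 choose r)` positions contains a large twin family. -/
theorem exists_isTwinFamily_subset {r n : ℕ} (hr : 2 ≤ r) (π : Equiv.Perm (Fin n)) (t y : ℕ)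
    (X : Finset (Fin n)) (hX : X.card ≤ y ^ (2 * r - 1).choose r) :
    ∃ B : Finset (Fin r → Fin n), IsTwinFamily_s0 π t B ∧ (∀ q ∈ B, ∀ j, q j ∈ X) ∧
      X.card ≤ (2 * r - 1) * (B.card * y ^ ((2 * r - 1).choose r - 1) + (n / t + 2)) := by
  classical
  rcases X.eq_empty_or_nonempty with rfl | hne
  · exact ⟨∅, ⟨by simp, by simp, by simp, by simp⟩, by simp, by simp⟩
  obtain ⟨I, g, hcard, hIV, hgV, hdiv, hlt, hdisj⟩ :=
    exists_value_groups (m := 2 * r - 1) (by omega) t (X.map π.toEmbedding) (hne.map)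
  rw [Finset.card_map] at hcard hIV
  have hg_ne : ∀ i ∈ I, ∀ i' ∈ I, ∀ j j', (i, j) ≠ (i', j') → g j i ≠ g j' i' := by
    intro i hi i' hi' j j' h
    rcases lt_trichotomy i i' with h' | rfl | h'
    · exact (hlt i hi i' hi' j j' h').ne
    · exact hdisj i hi j j' fun hj => h (by rw [hj])
    · exact (hlt i' hi' i hi j' j h').ne'
  obtain ⟨S, C, hCI, hC, hIC⟩ := exists_common_order r I (fun j i => π.symm (g j i)) (by
    intro j i hi i' hi' h
    by_contra hne'
    exact hg_ne i hi i' hi' j j (fun h' => hne' (congrArg Prod.fst h')) (π.symm.injective h))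
  let τ : ℕ → Fin r → Fin n := fun i j => π.symm (g (S j) i)
  have hτ : ∀ i j, π (τ i j) = g (S j) i := fun i j => π.apply_symm_apply _
  have hinj : Set.InjOn τ C := by
    intro i hi i' hi' h
    by_contra hne'
    have h₀ := congrArg π (congrFun h ⟨0, by omega⟩)
    rw [hτ, hτ] at h₀
    exact hg_ne i (hCI hi) i' (hCI hi') _ _ (fun h' => hne' (congrArg Prod.fst h')) h₀
  refine ⟨C.image τ, ⟨?_, ?_, ?_, ?_⟩, ?_, ?_⟩
  · simp only [Finset.forall_mem_image]
    intro i hi i' hi' hne'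
    exact hC i hi i' hi' fun h => hne' (h ▸ rfl)
  · simp only [Finset.forall_mem_image, hτ]
    intro i hi i' hi' j j' h
    rcases lt_trichotomy i i' with h' | rfl | h'
    · exact hlt i (hCI hi) i' (hCI hi') _ _ h'
    · exact absurd h (lt_irrefl _)
    · exact absurd (hlt i' (hCI hi') i (hCI hi) _ _ h') h.asymm
  · simp only [Finset.forall_mem_image]
    intro i hi i' hi' j j' hjj' h
    refine hg_ne i (hCI hi) i' (hCI hi') (S j) (S j') ?_ (π.symm.injective h)
    exact fun h' => hjj' (S.injective (congrArg Prod.snd h'))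
  · simp only [Finset.forall_mem_image, hτ]
    exact fun i hi j j' => hdiv i (hCI hi) _ _
  · simp only [Finset.forall_mem_image]
    intro i hi j
    obtain ⟨x, hx, hxg⟩ := Finset.mem_map.1 (hgV i (hCI hi) (S j))
    have : τ i j = x := by
      rw [← π.injective.eq_iff, hτ]
      exact hxg.symm
    rwa [this]
  · rw [Finset.card_image_of_injOn hinj]
    refine hcard.trans (Nat.mul_le_mul_left _ (Nat.add_le_add_right ?_ _))
    obtain ⟨R, hR⟩ : ∃ R, (2 * r - 1).choose r = R + 1 :=
      ⟨_, (Nat.succ_pred_eq_of_pos (Nat.choose_pos (by omega))).symm⟩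
    rw [hR] at hX hIC ⊢
    rw [Nat.add_sub_cancel]
    rcases le_total y C.card with h | h
    · calc I.card ≤ y ^ (R + 1) := hIV.trans hX
        _ = y * y ^ R := by ring
        _ ≤ C.card * y ^ R := Nat.mul_le_mul_right _ h
    · calc I.card ≤ C.card ^ (R + 1) := hIC
        _ = C.card * C.card ^ R := by ring
        _ ≤ C.card * y ^ R := Nat.mul_le_mul_left _ (Nat.pow_le_pow_left h R)

/-- The points whose value interval of length `t` is not occupied by a tuple of `A`. -/
def unusedPoints {r n : ℕ} (π : Equiv.Perm (Fin n)) (t : ℕ) (A : Finset (Fin r → Fin n)) :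
    Finset (Fin n) :=
  open Classical in Finset.univ.filter fun x => ∀ q ∈ A, ∀ j, (π (q j) : ℕ) / t ≠ (π x : ℕ) / t

theorem mem_unusedPoints {r n : ℕ} {π : Equiv.Perm (Fin n)} {t : ℕ}
    {A : Finset (Fin r → Fin n)} {x : Fin n} :
    x ∈ unusedPoints π t A ↔ ∀ q ∈ A, ∀ j, (π (q j) : ℕ) / t ≠ (π x : ℕ) / t := by
  simp [unusedPoints]

/-- Processing blocks of `y ^ (2r-1 choose r)` consecutive positions one after another yields a
twin family outside of whose value intervals there are few points. -/
theorem exists_isTwinFamily_blocks {r n : ℕ} (hr : 2 ≤ r) (π : Equiv.Perm (Fin n)) (t y b : ℕ) :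
    ∃ A : Finset (Fin r → Fin n), IsTwinFamily_s0 π t A ∧
      (∀ q ∈ A, ∀ j, (q j : ℕ) < b * y ^ (2 * r - 1).choose r) ∧
      ((unusedPoints π t A).filter fun x : Fin n => (x : ℕ) < b * y ^ (2 * r - 1).choose r).card ≤
        (2 * r - 1) * (A.card * y ^ ((2 * r - 1).choose r - 1) + b * (n / t + 2)) := by
  classical
  induction b with
  | zero => exact ⟨∅, ⟨by simp, by simp, by simp, by simp⟩, by simp, by simp⟩
  | succ b ih =>
    obtain ⟨A, hA, hAlt, hAcard⟩ := ih
    set s := y ^ (2 * r - 1).choose r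
    let X := (unusedPoints π t A).filter fun x : Fin n => b * s ≤ (x : ℕ) ∧ (x : ℕ) < (b + 1) * s
    have hXcard : X.card ≤ s := by
      have h : X.card ≤ (Finset.Ico (b * s) ((b + 1) * s)).card := by
        refine Finset.card_le_card_of_injOn (fun x : Fin n => (x : ℕ)) ?_ Fin.val_injective.injOn
        intro x hx
        simpa using (Finset.mem_filter.1 hx).2
      rw [Nat.card_Ico, Nat.succ_mul] at h
      omega
    obtain ⟨B, hB, hBX, hBcard⟩ := exists_isTwinFamily_subset hr π t y X hXcard
    have hBX' : ∀ q ∈ B, ∀ j, q j ∈ unusedPoints π t A ∧ b * s ≤ (q j : ℕ) ∧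
        (q j : ℕ) < (b + 1) * s := fun q hq j => Finset.mem_filter.1 (hBX q hq j)
    have hdiv : ∀ q ∈ A, ∀ q' ∈ B, ∀ j j', (π (q j) : ℕ) / t ≠ (π (q' j') : ℕ) / t :=
      fun q hq q' hq' j j' => mem_unusedPoints.1 (hBX' q' hq' j').1 q hq j
    have hAB : Disjoint A B := by
      rw [Finset.disjoint_left]
      exact fun q hq hq' => hdiv q hq q hq' ⟨0, by omega⟩ ⟨0, by omega⟩ rfl
    refine ⟨A ∪ B, hA.union hB ?_ hdiv, ?_, ?_⟩
    · exact fun q hq q' hq' j j' => Fin.lt_def.2 ((hAlt q hq j).trans_le (hBX' q' hq' j').2.1)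
    · intro q hq j
      rcases Finset.mem_union.1 hq with h | h
      · exact (hAlt q h j).trans_le (Nat.mul_le_mul_right _ b.le_succ)
      · exact (hBX' q h j).2.2
    · have hsub : ((unusedPoints π t (A ∪ B)).filter fun x : Fin n => (x : ℕ) < (b + 1) * s) ⊆
          ((unusedPoints π t A).filter fun x : Fin n => (x : ℕ) < b * s) ∪ X := by
        intro x hx
        rw [Finset.mem_filter, mem_unusedPoints] at hx
        have hxA : x ∈ unusedPoints π t A :=
          mem_unusedPoints.2 fun q hq => hx.1 q (Finset.mem_union_left _ hq)
        rw [Finset.mem_union, Finset.mem_filter, Finset.mem_filter]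
        rcases lt_or_ge (x : ℕ) (b * s) with h | h
        · exact Or.inl ⟨hxA, h⟩
        · exact Or.inr ⟨hxA, h, hx.2⟩
      calc _ ≤ _ := Finset.card_le_card hsub
        _ ≤ _ := Finset.card_union_le _ _
        _ ≤ _ := Nat.add_le_add hAcard hBcard
        _ = _ := by rw [Finset.card_union_of_disjoint hAB]; ring

theorem IsTwinFamily_s0.card_le {r n t : ℕ} (hr : 0 < r) (ht : 0 < t) {π : Equiv.Perm (Fin n)}
    {A : Finset (Fin r → Fin n)} (hA : IsTwinFamily_s0 π t A) :
    n ≤ A.card * t + (unusedPoints π t A).card := by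
  classical
  let used : (Fin r → Fin n) → Finset (Fin n) := fun q =>
    Finset.univ.filter fun x => (π x : ℕ) / t = (π (q ⟨0, hr⟩) : ℕ) / t
  have hused : ∀ q ∈ A, (used q).card ≤ t := by
    intro q _
    set i := (π (q ⟨0, hr⟩) : ℕ) / t
    have h : (used q).card ≤ (Finset.Ico (t * i) (t * i + t)).card := by
      refine Finset.card_le_card_of_injOn (fun x => (π x : ℕ)) ?_
        (Fin.val_injective.comp π.injective).injOn
      intro x hx
      have hx' : (π x : ℕ) / t = i := (Finset.mem_filter.1 hx).2
      have h₁ := Nat.div_add_mod (π x : ℕ) t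
      have h₂ := Nat.mod_lt (π x : ℕ) ht
      rw [hx'] at h₁
      simp only [Finset.coe_Ico, Set.mem_Ico]
      omega
    simpa using h
  have hcover : (Finset.univ : Finset (Fin n)) ⊆ A.biUnion used ∪ unusedPoints π t A := by
    intro x _
    by_contra hx
    rw [Finset.mem_union, not_or, Finset.mem_biUnion, mem_unusedPoints] at hx
    refine hx.2 fun q hq j h => hx.1 ⟨q, hq, Finset.mem_filter.2 ⟨Finset.mem_univ _, ?_⟩⟩
    rw [← h]
    exact hA.div_eq q hq _ _
  calc n = (Finset.univ : Finset (Fin n)).card := by simp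
    _ ≤ _ := Finset.card_le_card hcover
    _ ≤ _ := Finset.card_union_le _ _
    _ ≤ _ := Nat.add_le_add_right (Finset.card_biUnion_le_card_mul _ _ _ hused) _

theorem exists_hasTwins_le {r : ℕ} (hr : 2 ≤ r) (n : ℕ) (π : Equiv.Perm (Fin n)) {y : ℕ}
    (hy : 0 < y) :
    ∃ k, HasTwins r k n π ∧
      n ≤ 2 * r * (k * y ^ ((2 * r - 1).choose r - 1) +
        (n / y ^ (2 * r - 1).choose r + 1) * (n / y ^ ((2 * r - 1).choose r - 1) + 2)) := by
  set s := y ^ (2 * r - 1).choose r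
  set t := y ^ ((2 * r - 1).choose r - 1)
  have hs : 0 < s := Nat.pow_pos hy
  have ht : 0 < t := Nat.pow_pos hy
  obtain ⟨A, hA, -, hcard⟩ := exists_isTwinFamily_blocks hr π t y (n / s + 1)
  refine ⟨A.card, hA.hasTwins (by omega), ?_⟩
  have hn : n < (n / s + 1) * s := by
    rw [mul_comm]
    exact Nat.lt_mul_div_succ n hs
  rw [Finset.filter_true_of_mem fun x _ => x.isLt.trans hn] at hcard
  have hle := hA.card_le (by omega) ht
  calc n ≤ A.card * t + (2 * r - 1) * (A.card * t + (n / s + 1) * (n / t + 2)) :=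
        hle.trans (Nat.add_le_add_left hcard _)
    _ ≤ (2 * r - 1) * (A.card * t + (n / s + 1) * (n / t + 2)) +
        (A.card * t + (n / s + 1) * (n / t + 2)) := by
          rw [add_comm]
          exact Nat.add_le_add_left (Nat.le_add_right _ _) _
    _ = (2 * r - 1 + 1) * (A.card * t + (n / s + 1) * (n / t + 2)) := (Nat.succ_mul _ _).symm
    _ = _ := by rw [Nat.sub_add_cancel (by omega)]

theorem mul_pow_succ_le_of_le {r Q k n y : ℕ} (hr : 0 < r) (hQ : 0 < Q) (hn : 48 * r ≤ n) {u : ℝ}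
    (hu : 1 ≤ u) (hun : u ^ (2 * Q + 1) = n) (hyl : 48 * r * u ≤ y) (hyu : y ≤ 2 * (48 * r * u))
    (h : n ≤ 2 * r * (k * y ^ Q + (n / y ^ (Q + 1) + 1) * (n / y ^ Q + 2))) :
    1 / (4 * r * (96 * r) ^ Q) * u ^ (Q + 1) ≤ (k : ℝ) := by
  have hr' : (1 : ℝ) ≤ r := by exact_mod_cast hr
  have hn' : (48 : ℝ) * r ≤ n := by exact_mod_cast hn
  have hn0 : (0 : ℝ) < n := by linarith
  have hy48 : (48 : ℝ) * r ≤ y := by nlinarith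
  have hy1 : (1 : ℝ) ≤ y := by linarith
  have hypos : (0 : ℝ) < y := by linarith
  have hyt : (y : ℝ) ≤ (y : ℝ) ^ Q := le_self_pow₀ hy1 hQ.ne'
  have hys : (y : ℝ) ≤ (y : ℝ) ^ (Q + 1) := le_self_pow₀ hy1 Q.succ_ne_zero
  have hst : 48 * r * (n : ℝ) ≤ (y : ℝ) ^ (Q + 1) * (y : ℝ) ^ Q := by
    calc 48 * r * (n : ℝ) ≤ (48 * r) ^ (2 * Q + 1) * (n : ℝ) := by
          gcongr
          exact le_self_pow₀ (by linarith) (by omega)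
      _ = (48 * r * u) ^ (2 * Q + 1) := by rw [mul_pow _ u, hun]
      _ ≤ (y : ℝ) ^ (2 * Q + 1) := by gcongr
      _ = _ := by ring
  have hns : 48 * r * ((n : ℝ) / (y : ℝ) ^ (Q + 1)) ≤ n := by
    rw [mul_div_assoc', div_le_iff₀ (by positivity)]
    nlinarith
  have hnt : 48 * r * ((n : ℝ) / (y : ℝ) ^ Q) ≤ n := by
    rw [mul_div_assoc', div_le_iff₀ (by positivity)]
    nlinarith
  have hnst : 48 * r * ((n : ℝ) / (y : ℝ) ^ (Q + 1) * ((n : ℝ) / (y : ℝ) ^ Q)) ≤ n := by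
    rw [div_mul_div_comm, mul_div_assoc', div_le_iff₀ (by positivity)]
    nlinarith
  have hreal : (n : ℝ) ≤ 2 * r * (k * (y : ℝ) ^ Q +
      ((n : ℝ) / (y : ℝ) ^ (Q + 1) + 1) * ((n : ℝ) / (y : ℝ) ^ Q + 2)) := by
    calc (n : ℝ) ≤ ((2 * r * (k * y ^ Q + (n / y ^ (Q + 1) + 1) * (n / y ^ Q + 2)) : ℕ) : ℝ) := by
          exact_mod_cast h
      _ ≤ _ := by
          push_cast
          gcongr
          · exact_mod_cast Nat.cast_div_le (α := ℝ) (m := n) (n := y ^ (Q + 1))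
          · exact_mod_cast Nat.cast_div_le (α := ℝ) (m := n) (n := y ^ Q)
  have hk : (n : ℝ) ≤ 4 * r * (k * (y : ℝ) ^ Q) := by nlinarith
  have hpow : u ^ Q * u ^ (Q + 1) ≤ u ^ Q * (k * (4 * r * (96 * r) ^ Q)) := by
    calc u ^ Q * u ^ (Q + 1) = n := by rw [← hun]; ring
      _ ≤ 4 * r * (k * (y : ℝ) ^ Q) := hk
      _ ≤ 4 * r * (k * (2 * (48 * r * u)) ^ Q) := by gcongr
      _ = 4 * r * (k * (u * (96 * r)) ^ Q) := by ring
      _ = _ := by rw [mul_pow]; ring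
  rw [one_div_mul_eq_div, div_le_iff₀ (by positivity)]
  exact le_of_mul_le_mul_left hpow (by positivity)

/-- Lower bound of Theorem 1: for every `r ≥ 2`, with `R = C(2r-1, r)`, there are
`c > 0` and `n₀` such that for all `n ≥ n₀` every permutation of `[n]` contains
`r`-twins of length at least `c · n^(R/(2R-1))`. -/
theorem twins_lower_bound (r : ℕ) (hr : 2 ≤ r) :
    ∃ c : ℝ, 0 < c ∧ ∃ n₀ : ℕ, ∀ n : ℕ, n₀ ≤ n → ∀ π : Equiv.Perm (Fin n),
      ∃ k : ℕ,
        c * (n : ℝ) ^ ((((2 * r - 1).choose r : ℕ) : ℝ) /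
            (2 * (((2 * r - 1).choose r : ℕ) : ℝ) - 1)) ≤ (k : ℝ) ∧
        HasTwins r k n π := by
  obtain ⟨Q, hQ⟩ : ∃ Q, (2 * r - 1).choose r = Q + 1 :=
    ⟨_, (Nat.succ_pred_eq_of_pos (Nat.choose_pos (by omega))).symm⟩
  have hQ0 : 0 < Q := by
    have h := Nat.choose_le_choose r (show r + 1 ≤ 2 * r - 1 by omega)
    rw [Nat.choose_succ_self_right, hQ] at h
    omega
  refine ⟨1 / (4 * r * (96 * r) ^ Q), by positivity, 48 * r, fun n hn π => ?_⟩
  set u : ℝ := (n : ℝ) ^ (1 / ((2 * Q + 1 : ℕ) : ℝ)) with hu_def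
  have hn1 : (1 : ℝ) ≤ n := by
    exact_mod_cast (show 1 ≤ n by omega)
  have hu : 1 ≤ u := Real.one_le_rpow hn1 (by positivity)
  have hun : u ^ (2 * Q + 1) = n := by
    rw [hu_def, one_div]
    exact Real.rpow_inv_natCast_pow (by positivity) (by omega)
  have hr1 : (2 : ℝ) ≤ r := by exact_mod_cast hr
  have hpos : 1 ≤ 48 * r * u := by nlinarith
  have hyl := Nat.le_ceil (48 * r * u)
  have hyu := Nat.ceil_lt_add_one (show 0 ≤ 48 * r * u by linarith)
  obtain ⟨k, hk, hnk⟩ := exists_hasTwins_le hr n π (Nat.ceil_pos.2 (by linarith : 0 < 48 * r * u))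
  rw [hQ, Nat.add_sub_cancel] at hnk
  refine ⟨k, ?_, hk⟩
  have hexp : (n : ℝ) ^ ((((2 * r - 1).choose r : ℕ) : ℝ) /
      (2 * (((2 * r - 1).choose r : ℕ) : ℝ) - 1)) = u ^ (Q + 1) := by
    rw [hQ, hu_def, ← Real.rpow_mul_natCast (by positivity)]
    congr 1
    push_cast
    rw [show 2 * ((Q : ℝ) + 1) - 1 = 2 * Q + 1 by ring]
    ring
  rw [hexp]
  exact mul_pow_succ_le_of_le (by omega) hQ0 hn hu hun hyl (by linarith) hnk
end

section
/- For every integer r ≥ 2 there exist a constant C > 0 and n₀ such that for all n ≥ n₀ there is a permutation π of [n] containing no r-twins of length ⌈C · n^{r/(2r−1)}⌉; that is, t^(r)(n) ≤ C · n^{r/(2r−1)}. (In fact one may take C = 2e.) -/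
/-- A permutation of a finite set that preserves the order pulled back along an injection
is the identity. -/
theorem perm_eq_one_of_lt_iff_lt {α β : Type*} [Finite α] [LinearOrder β] (g : α → β)
    (hg : Function.Injective g) (f : Equiv.Perm α)
    (h : ∀ a b, g (f a) < g (f b) ↔ g a < g b) : f = 1 := by
  let : LinearOrder α := LinearOrder.lift' g hg
  let e : α ≃o α :=
    { f with map_rel_iff' := fun {a b} => le_iff_le_iff_lt_iff_lt.2 (h b a) }
  have he : e = OrderIso.refl α := Subsingleton.elim _ _
  ext a
  exact congrArg (fun u : α ≃o α => u a) he

/-- For a fixed system of pairwise disjoint position maps `p`, at most a `1 / (k!)^s` fraction of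
the permutations have pairwise similar values along the `s + 1` maps. -/
theorem card_similar_mul_factorial_pow_le {s k n : ℕ} (p : Fin (s + 1) → Fin k → Fin n)
    (hp : Function.Injective fun x : Fin (s + 1) × Fin k => p x.1 x.2) :
    Nat.card {π : Equiv.Perm (Fin n) // ∀ j j' i i',
      π (p j i) < π (p j i') ↔ π (p j' i) < π (p j' i')} * k.factorial ^ s ≤ n.factorial := by
  let ι : Fin (s + 1) × Fin k ↪ Fin n := ⟨_, hp⟩
  let τ : (Fin s → Equiv.Perm (Fin k)) → Equiv.Perm (Fin n) := fun σ =>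
    Equiv.Perm.viaEmbedding
      (Equiv.prodCongrRight (Fin.cons 1 σ : Fin (s + 1) → Equiv.Perm (Fin k))) ι
  have hτ0 (σ : Fin s → Equiv.Perm (Fin k)) (i : Fin k) : τ σ (p 0 i) = p 0 i :=
    Equiv.Perm.viaEmbedding_apply _ ι (0, i)
  have hτ (σ : Fin s → Equiv.Perm (Fin k)) (j : Fin s) (i : Fin k) :
      τ σ (p j.succ i) = p j.succ (σ j i) :=
    Equiv.Perm.viaEmbedding_apply _ ι (j.succ, i)
  let F : {π : Equiv.Perm (Fin n) // ∀ j j' i i',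
      π (p j i) < π (p j i') ↔ π (p j' i) < π (p j' i')} × (Fin s → Equiv.Perm (Fin k)) →
      Equiv.Perm (Fin n) := fun x => x.1.1 * τ x.2
  have hF : Function.Injective F := by
    rintro ⟨⟨π, hπ⟩, σ⟩ ⟨⟨ρ, hρ⟩, σ'⟩ h
    have h' (x : Fin n) : π (τ σ x) = ρ (τ σ' x) := congrArg (fun u => u x) h
    have h0 (i : Fin k) : π (p 0 i) = ρ (p 0 i) := by
      simpa only [hτ0] using h' (p 0 i)
    have hj (j : Fin s) (i : Fin k) : π (p j.succ (σ j i)) = ρ (p j.succ (σ' j i)) := by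
      simpa only [hτ] using h' (p j.succ i)
    have hσ : σ = σ' := by
      funext j
      have hinj : Function.Injective fun i => π (p 0 i) := fun a b hab =>
        congrArg Prod.snd (hp (a₁ := (0, a)) (a₂ := (0, b)) (π.injective hab))
      have key := perm_eq_one_of_lt_iff_lt _ hinj (σ' j * (σ j)⁻¹) fun a b => by
        have ha := hj j ((σ j)⁻¹ a)
        have hb := hj j ((σ j)⁻¹ b)
        rw [← Equiv.Perm.mul_apply (σ j), mul_inv_cancel, Equiv.Perm.one_apply] at ha hb
        rw [Equiv.Perm.mul_apply, Equiv.Perm.mul_apply, h0, h0, hρ 0 j.succ, ← ha, ← hb,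
          hπ j.succ 0]
      exact (mul_inv_eq_one.1 key).symm
    subst hσ
    have hπρ : π = ρ := mul_right_cancel h
    subst hπρ
    rfl
  have := Nat.card_le_card_of_injective F hF
  rwa [Nat.card_prod, Nat.card_fun, Nat.card_perm, Nat.card_perm, Nat.card_fin, Nat.card_fin,
    Nat.card_fin] at this

theorem card_strictMono_le_choose (k n : ℕ) :
    Nat.card {f : Fin k → Fin n // StrictMono f} ≤ n.choose k := by
  let F : {f : Fin k → Fin n // StrictMono f} → (Finset.univ : Finset (Fin n)).powersetCard k := fun f =>
    ⟨Finset.univ.map ⟨f.1, f.2.injective⟩, by simp⟩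
  have hF : Function.Injective F := by
    intro f g h
    have h' := congrArg (fun x => ((x.1 : Finset (Fin n)) : Set (Fin n))) h
    simp only [F, Finset.coe_map, Finset.coe_univ, Set.image_univ,
      Function.Embedding.coeFn_mk] at h'
    exact Subtype.ext ((StrictMono.range_inj f.2 g.2).1 h')
  simpa using Nat.card_le_card_of_injective F hF

/-- The union bound over all systems of position maps. -/
theorem factorial_pow_le_choose_pow_of_forall_hasTwins {s k n : ℕ}
    (h : ∀ π : Equiv.Perm (Fin n), HasTwins (s + 1) k n π) :
    k.factorial ^ s ≤ n.choose k ^ (s + 1) := by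
  classical
  let P := {p : Fin (s + 1) → {f : Fin k → Fin n // StrictMono f} //
    Function.Injective fun x : Fin (s + 1) × Fin k => (p x.1).1 x.2}
  let S : P → Type := fun p => {π : Equiv.Perm (Fin n) // ∀ j j' i i',
    π ((p.1 j).1 i) < π ((p.1 j).1 i') ↔ π ((p.1 j').1 i) < π ((p.1 j').1 i')}
  have hsurj : Function.Surjective fun x : Σ p, S p => x.2.1 := by
    intro π
    obtain ⟨p, hmono, hdisj, hsim⟩ := h π
    refine ⟨⟨⟨fun j => ⟨p j, hmono j⟩, ?_⟩, ⟨π, hsim⟩⟩, rfl⟩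
    rintro ⟨j, i⟩ ⟨j', i'⟩ hx
    by_cases hjj : j = j'
    · subst hjj
      exact congrArg (Prod.mk j) ((hmono j).injective hx)
    · exact absurd hx (hdisj j j' hjj i i')
  have hP : Nat.card P ≤ n.choose k ^ (s + 1) := by
    refine (Nat.card_le_card_of_injective _ Subtype.val_injective).trans ?_
    rw [Nat.card_fun, Nat.card_fin]
    exact Nat.pow_le_pow_left (card_strictMono_le_choose k n) _
  have hcard := Nat.card_le_card_of_surjective _ hsurj
  rw [Nat.card_perm, Nat.card_fin, Nat.card_sigma] at hcard
  have hle : n.factorial * k.factorial ^ s ≤ n.factorial * n.choose k ^ (s + 1) :=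
    calc n.factorial * k.factorial ^ s
        ≤ (∑ p, Nat.card (S p)) * k.factorial ^ s := Nat.mul_le_mul_right _ hcard
      _ = ∑ p, Nat.card (S p) * k.factorial ^ s := Finset.sum_mul ..
      _ ≤ ∑ _p : P, n.factorial :=
          Finset.sum_le_sum fun p _ => card_similar_mul_factorial_pow_le _ p.2
      _ = Nat.card P * n.factorial := by simp [Nat.card_eq_fintype_card]
      _ ≤ n.factorial * n.choose k ^ (s + 1) := by
          rw [mul_comm]
          exact Nat.mul_le_mul_left _ hP
  exact Nat.le_of_mul_le_mul_left hle n.factorial_pos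

theorem factorial_pow_le_pow_of_forall_hasTwins {s k n : ℕ}
    (h : ∀ π : Equiv.Perm (Fin n), HasTwins (s + 1) k n π) :
    k.factorial ^ (2 * s + 1) ≤ (n ^ (s + 1)) ^ k :=
  calc k.factorial ^ (2 * s + 1)
      = k.factorial ^ s * k.factorial ^ (s + 1) := by ring
    _ ≤ n.choose k ^ (s + 1) * k.factorial ^ (s + 1) :=
        Nat.mul_le_mul_right _ (factorial_pow_le_choose_pow_of_forall_hasTwins h)
    _ = n.descFactorial k ^ (s + 1) := by
        rw [Nat.descFactorial_eq_factorial_mul_choose, mul_pow, mul_comm]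
    _ ≤ (n ^ k) ^ (s + 1) := Nat.pow_le_pow_left (Nat.descFactorial_le_pow n k) _
    _ = (n ^ (s + 1)) ^ k := by rw [← pow_mul, ← pow_mul, mul_comm]

theorem div_three_pow_lt_factorial {k : ℕ} (hk : k ≠ 0) :
    ((k : ℝ) / 3) ^ k < k.factorial := by
  have h1 : (k : ℝ) ^ k / k.factorial ≤ Real.exp k :=
    Real.pow_div_factorial_le_exp k k.cast_nonneg k
  have h2 : Real.exp k < 3 ^ k := by
    rw [← Real.exp_one_pow]
    exact pow_lt_pow_left₀ Real.exp_one_lt_three (Real.exp_pos 1).le hk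
  have hf : (0 : ℝ) < k.factorial := by exact_mod_cast k.factorial_pos
  rw [div_pow, div_lt_iff₀ (by positivity), mul_comm]
  exact (div_lt_iff₀ hf).1 (h1.trans_lt h2)

/-- Upper bound of Theorem 1: for every `r ≥ 2` there are `C > 0` and `n₀` such that
for all `n ≥ n₀` some permutation of `[n]` contains no `r`-twins of length
`⌈C · n^(r/(2r-1))⌉`. -/
theorem twins_upper_bound (r : ℕ) (hr : 2 ≤ r) :
    ∃ C : ℝ, 0 < C ∧ ∃ n₀ : ℕ, ∀ n : ℕ, n₀ ≤ n →
      ∃ π : Equiv.Perm (Fin n),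
        ¬ HasTwins r (⌈C * (n : ℝ) ^ ((r : ℝ) / (2 * (r : ℝ) - 1))⌉₊) n π := by
  obtain ⟨s, rfl⟩ : ∃ s, r = s + 1 := ⟨r - 1, by omega⟩
  refine ⟨3, by norm_num, 1, fun n hn => ?_⟩
  set x : ℝ := (n : ℝ) ^ (((s + 1 : ℕ) : ℝ) / (2 * ((s + 1 : ℕ) : ℝ) - 1)) with hx
  set k := ⌈3 * x⌉₊ with hk
  have hn0 : (0 : ℝ) < n := by exact_mod_cast hn
  have hxpos : 0 < x := Real.rpow_pos_of_pos hn0 _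
  have hk0 : k ≠ 0 := (Nat.ceil_pos.2 (by positivity)).ne'
  have hxk : x ≤ k / 3 := by
    have := Nat.le_ceil (3 * x)
    rw [← hk] at this
    linarith
  have hxpow : x ^ (2 * s + 1) = (n : ℝ) ^ (s + 1) := by
    have he : 2 * ((s + 1 : ℕ) : ℝ) - 1 = ((2 * s + 1 : ℕ) : ℝ) := by
      push_cast
      ring
    rw [hx, he, ← Real.rpow_mul_natCast hn0.le,
      div_mul_cancel₀ _ (by positivity), Real.rpow_natCast]
  by_contra! h
  have hle : (k.factorial : ℝ) ^ (2 * s + 1) ≤ ((n : ℝ) ^ (s + 1)) ^ k := by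
    exact_mod_cast factorial_pow_le_pow_of_forall_hasTwins h
  have hlt : ((n : ℝ) ^ (s + 1)) ^ k < (k.factorial : ℝ) ^ (2 * s + 1) :=
    calc ((n : ℝ) ^ (s + 1)) ^ k = (x ^ k) ^ (2 * s + 1) := by
          rw [← hxpow, ← pow_mul, ← pow_mul, mul_comm]
      _ ≤ (((k : ℝ) / 3) ^ k) ^ (2 * s + 1) := by gcongr
      _ < (k.factorial : ℝ) ^ (2 * s + 1) :=
          pow_lt_pow_left₀ (div_three_pow_lt_factorial hk0) (by positivity) (by omega)
  exact hlt.not_ge hle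
end

section
/- For every integer r ≥ 2 there exists a constant c > 0 such that the probability that a uniformly random permutation Π_n of [n] contains r-twins of length at least c · n^{r/(2r−1)} tends to 1 as n → ∞; in other words, asymptotically almost surely t^(r)(Π_n) ≥ c · n^{r/(2r−1)}. -/
open Finset

theorem card_perm_extending_embedding {A ι : Type*} [Fintype A] [DecidableEq A] [Fintype ι]
    (x y : ι ↪ A) :
    #{ρ : Equiv.Perm A | ∀ i, ρ (x i) = y i} = (Fintype.card A - Fintype.card ι).factorial := by
  classical
  obtain ⟨τ, hτ⟩ : ∃ τ : Equiv.Perm A, ∀ i, τ (x i) = y i := by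
    let e : {a // a ∈ Set.range x} ≃ {a // a ∈ Set.range y} :=
      (Equiv.ofInjective x x.injective).symm.trans (Equiv.ofInjective y y.injective)
    refine ⟨e.extendSubtype, fun i => ?_⟩
    rw [Equiv.extendSubtype_apply_of_mem e _ ⟨i, rfl⟩]
    simp [e]
  have h1 : #{ρ : Equiv.Perm A | ∀ i, ρ (x i) = y i}
      = Fintype.card {ρ : Equiv.Perm A // ∀ a, ¬ a ∉ Set.range x → ρ a = a} := by
    rw [← Fintype.card_subtype]
    refine Fintype.card_congr ((Equiv.mulLeft τ⁻¹).subtypeEquiv fun ρ => ?_)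
    simp [Equiv.symm_apply_eq, hτ]
  rw [h1, ← Fintype.card_congr (Equiv.Perm.subtypeEquivSubtypePerm (fun a => a ∉ Set.range x)),
    Fintype.card_perm, Fintype.card_subtype_compl]
  congr 2
  exact (Fintype.card_congr (Equiv.ofInjective x x.injective)).symm

theorem card_embedding_mem {A ι : Type*} [Fintype A] [DecidableEq A] [Fintype ι]
    (Q : Finset A) :
    #{x : ι ↪ A | ∀ i, x i ∈ Q} = (#Q).descFactorial (Fintype.card ι) := by
  classical
  rw [← Fintype.card_coe Q, ← Fintype.card_embedding_eq, ← Fintype.card_subtype]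
  exact Fintype.card_congr
    { toFun := fun x => x.1.codRestrict (Q : Set A) x.2
      invFun := fun x => ⟨x.trans (Function.Embedding.subtype _), fun i => (x i).2⟩
      left_inv := fun x => by ext; rfl
      right_inv := fun x => by ext; rfl }

theorem card_embedding_mem_le {A ι : Type*} [Fintype A] [DecidableEq A] [Fintype ι]
    [DecidableEq ι] (W : ι → Finset A) :
    #{x : ι ↪ A | ∀ i, x i ∈ W i} ≤ ∏ i, #(W i) := by
  rw [← Fintype.card_piFinset]
  refine card_le_card_of_injOn (fun x => ⇑x) (fun x hx => ?_) (fun x _ y _ h => ?_)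
  · simpa using hx
  · exact DFunLike.coe_injective h

theorem sum_perm_card_embedding {A ι : Type*} [Fintype A] [DecidableEq A] [Fintype ι]
    (Q : Finset A) (W : ι → Finset A) :
    ∑ ρ : Equiv.Perm A, #{x : ι ↪ A | ∀ i, x i ∈ Q ∧ ρ (x i) ∈ W i}
      = (#Q).descFactorial (Fintype.card ι) * #{y : ι ↪ A | ∀ i, y i ∈ W i}
        * (Fintype.card A - Fintype.card ι).factorial := by
  classical
  have key : ∀ x : ι ↪ A, #{ρ : Equiv.Perm A | ∀ i, ρ (x i) ∈ W i}
      = #{y : ι ↪ A | ∀ i, y i ∈ W i} * (Fintype.card A - Fintype.card ι).factorial := by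
    intro x
    rw [card_eq_sum_card_fiberwise (f := fun ρ : Equiv.Perm A => x.trans ρ.toEmbedding)
      (t := ({y : ι ↪ A | ∀ i, y i ∈ W i} : Finset (ι ↪ A)))]
    · rw [sum_const_nat]
      intro y hy
      rw [← card_perm_extending_embedding x y]
      congr 1
      ext ρ
      simp only [mem_filter, mem_univ, true_and] at hy ⊢
      constructor
      · rintro ⟨-, rfl⟩ i
        rfl
      · intro h
        exact ⟨fun i => by rw [h i]; exact hy i, by ext i; exact h i⟩
    · intro ρ hρ
      simpa using hρ
  simp_rw [card_filter]
  rw [sum_comm, ← card_embedding_mem (ι := ι) Q, card_filter, mul_assoc, sum_mul]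
  refine sum_congr rfl fun x _ => ?_
  rw [← card_filter, ← card_filter, ← key x]
  split_ifs with h
  · simp [h]
  · rw [zero_mul, card_eq_zero, filter_eq_empty_iff]
    exact fun ρ _ h' => h fun i => (h' i).1

theorem sum_perm_descFactorial_hits {A : Type*} [Fintype A] [DecidableEq A]
    (Q W : Finset A) (s : ℕ) :
    ∑ ρ : Equiv.Perm A, (#{x ∈ Q | ρ x ∈ W}).descFactorial s
      = (#Q).descFactorial s * (#W).descFactorial s * (Fintype.card A - s).factorial := by
  have h := sum_perm_card_embedding (ι := Fin s) Q (fun _ => W)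
  rw [card_embedding_mem, Fintype.card_fin] at h
  rw [← h]
  refine sum_congr rfl fun ρ _ => ?_
  have h' := card_embedding_mem (ι := Fin s) {x ∈ Q | ρ x ∈ W}
  rw [Fintype.card_fin] at h'
  rw [← h']
  congr! 3
  simp only [mem_filter]

theorem card_perm_exists_embedding_le {A ι : Type*} [Fintype A] [DecidableEq A] [Fintype ι]
    (Q : Finset A) (W : ι → Finset A) (L : ℕ) (hQ : #Q ≤ L) (hW : ∀ i, #(W i) ≤ L)
    (hN : 2 * Fintype.card ι ≤ Fintype.card A)
    (p : Equiv.Perm A → Prop) [DecidablePred p]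
    (hp : ∀ ρ, p ρ → ∃ x : ι ↪ A, ∀ i, x i ∈ Q ∧ ρ (x i) ∈ W i) :
    Fintype.card A ^ Fintype.card ι * #{ρ : Equiv.Perm A | p ρ}
      ≤ 2 ^ Fintype.card ι * (L ^ 2) ^ Fintype.card ι * (Fintype.card A).factorial := by
  classical
  set N := Fintype.card A
  set s := Fintype.card ι
  have h1 : #{ρ : Equiv.Perm A | p ρ} ≤ L ^ s * L ^ s * (N - s).factorial := by
    calc #{ρ : Equiv.Perm A | p ρ}
        ≤ ∑ ρ : Equiv.Perm A, #{x : ι ↪ A | ∀ i, x i ∈ Q ∧ ρ (x i) ∈ W i} := by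
          rw [card_filter]
          refine sum_le_sum fun ρ _ => ?_
          split_ifs with h
          · obtain ⟨x, hx⟩ := hp ρ h
            exact card_pos.2 ⟨x, by simpa using hx⟩
          · exact Nat.zero_le _
      _ = _ := sum_perm_card_embedding Q W
      _ ≤ _ := by
          gcongr
          · exact (Nat.descFactorial_le_pow _ _).trans (Nat.pow_le_pow_left hQ _)
          · refine (card_embedding_mem_le W).trans ?_
            exact (prod_le_prod' fun i _ => hW i).trans (by simp [s])
  have h2 : N ^ s ≤ 2 ^ s * N.descFactorial s := by
    calc N ^ s ≤ (2 * (N + 1 - s)) ^ s := Nat.pow_le_pow_left (by omega) _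
      _ = 2 ^ s * (N + 1 - s) ^ s := mul_pow _ _ _
      _ ≤ _ := by gcongr; exact Nat.pow_sub_le_descFactorial _ _
  calc N ^ s * #{ρ : Equiv.Perm A | p ρ}
      ≤ (2 ^ s * N.descFactorial s) * (L ^ s * L ^ s * (N - s).factorial) := by gcongr
    _ = 2 ^ s * (L ^ 2) ^ s * ((N - s).factorial * N.descFactorial s) := by ring
    _ = _ := by rw [Nat.factorial_mul_descFactorial (by omega)]

theorem descFactorial_le_ite_add_descFactorial_succ (h r : ℕ) :
    h.descFactorial r ≤ r.factorial * (if r ≤ h then 1 else 0) + h.descFactorial (r + 1) := by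
  rcases lt_trichotomy h r with hlt | rfl | hgt
  · simp [Nat.descFactorial_of_lt hlt]
  · simp [Nat.descFactorial_self]
  · rw [Nat.descFactorial_succ]
    exact le_add_left (Nat.le_mul_of_pos_left _ (by omega))

theorem le_card_perm_le_hits {A : Type*} [Fintype A] [DecidableEq A] (r L : ℕ)
    (Q W : Finset A) (hQ : #Q = L) (hW : #W ≤ L) (hW' : L ≤ 8 * #W) (hr : 1 ≤ r)
    (hL : 16 * r ≤ L) (hN : 4 * L ^ 2 ≤ Fintype.card A) :
    (Fintype.card A).factorial * (L ^ 2) ^ r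
      ≤ 2 * r.factorial * 32 ^ r * Fintype.card A ^ r
        * #{ρ : Equiv.Perm A | r ≤ #{x ∈ Q | ρ x ∈ W}} := by
  set N := Fintype.card A
  set w := #W
  have hLL : L ≤ L ^ 2 := Nat.le_self_pow (by norm_num) L
  have hS := sum_perm_descFactorial_hits Q W r
  have hS' := sum_perm_descFactorial_hits Q W (r + 1)
  rw [hQ] at hS hS'
  set S := ∑ ρ : Equiv.Perm A, (#{x ∈ Q | ρ x ∈ W}).descFactorial r
  set S' := ∑ ρ : Equiv.Perm A, (#{x ∈ Q | ρ x ∈ W}).descFactorial (r + 1)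
  have h1 : S ≤ r.factorial * #{ρ : Equiv.Perm A | r ≤ #{x ∈ Q | ρ x ∈ W}} + S' := by
    rw [card_filter, mul_sum, ← sum_add_distrib]
    exact sum_le_sum fun ρ _ => descFactorial_le_ite_add_descFactorial_succ _ _
  have h2 : 2 * S' ≤ S := by
    have hf : (N - r).factorial = (N - r) * (N - (r + 1)).factorial := by
      rw [show N - (r + 1) = N - r - 1 by omega, Nat.mul_factorial_pred (by omega)]
    rw [hS, hS', Nat.descFactorial_succ, Nat.descFactorial_succ, hf]
    have : 2 * ((L - r) * (w - r)) ≤ N - r := by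
      have : (L - r) * (w - r) ≤ L * L := Nat.mul_le_mul (by omega) (by omega)
      have : L * L = L ^ 2 := (sq L).symm
      omega
    calc _ = (L.descFactorial r * w.descFactorial r * (N - (r + 1)).factorial)
          * (2 * ((L - r) * (w - r))) := by ring
      _ ≤ (L.descFactorial r * w.descFactorial r * (N - (r + 1)).factorial) * (N - r) := by
          gcongr
      _ = _ := by ring
  have h3 : (L ^ 2) ^ r ≤ 32 ^ r * (L.descFactorial r * w.descFactorial r) := by
    calc (L ^ 2) ^ r = L ^ r * L ^ r := by ring
      _ ≤ (2 * (L + 1 - r)) ^ r * (16 * (w + 1 - r)) ^ r := by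
          gcongr <;> omega
      _ = 32 ^ r * ((L + 1 - r) ^ r * (w + 1 - r) ^ r) := by
          rw [show 32 = 2 * 16 by rfl]; simp only [mul_pow]; ring
      _ ≤ _ := by gcongr <;> exact Nat.pow_sub_le_descFactorial _ _
  have h4 : N.factorial ≤ (N - r).factorial * N ^ r := by
    rw [← Nat.factorial_mul_descFactorial (n := N) (k := r) (by omega)]
    gcongr
    exact Nat.descFactorial_le_pow _ _
  calc N.factorial * (L ^ 2) ^ r
      ≤ ((N - r).factorial * N ^ r) * (32 ^ r * (L.descFactorial r * w.descFactorial r)) := by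
        gcongr
    _ = 32 ^ r * N ^ r * S := by rw [hS]; ring
    _ ≤ 32 ^ r * N ^ r
        * (2 * (r.factorial * #{ρ : Equiv.Perm A | r ≤ #{x ∈ Q | ρ x ∈ W}})) := by
        gcongr; omega
    _ = _ := by ring

theorem exists_embedding_mem_of_le_card {A : Type*} {r : ℕ} {S : Finset A} (h : r ≤ #S) :
    ∃ e : Fin r ↪ A, ∀ i, e i ∈ S := by
  obtain ⟨e⟩ := Function.Embedding.nonempty_of_card_le (α := Fin r) (β := S) (by simpa using h)
  exact ⟨e.trans (Function.Embedding.subtype _), fun i => (e i).2⟩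

theorem exists_collision_probability (r : ℕ) (hr : 1 ≤ r) (c C : ℝ) (hc : 0 < c) (hC : 0 < C) :
    ∃ p : ℝ, 0 < p ∧ p ≤ 1 ∧
      ∀ (A : Type) [Fintype A] [DecidableEq A] (L : ℕ) (Q : Finset A) (B : Finset ℕ)
        (W : ℕ → Finset A), #Q = L → (∀ b ∈ B, #(W b) ≤ L) → (∀ b ∈ B, L ≤ 8 * #(W b)) →
        (∀ b ∈ B, ∀ b' ∈ B, b ≠ b' → Disjoint (W b) (W b')) →
        16 * r ≤ L → 4 * L ^ 2 ≤ Fintype.card A →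
        c * (Fintype.card A : ℝ) ^ r ≤ (#B : ℝ) * ((L : ℝ) ^ 2) ^ r →
        (#B : ℝ) * ((L : ℝ) ^ 2) ^ r ≤ C * (Fintype.card A : ℝ) ^ r →
        p * ((Fintype.card A).factorial : ℝ)
          ≤ (#{ρ : Equiv.Perm A | ∃ b ∈ B, r ≤ #{x ∈ Q | ρ x ∈ W b}} : ℝ) := by
  set K : ℝ := 2 * r.factorial * 32 ^ r with hK
  have hK0 : 0 < K := by positivity
  set H : ℝ := 2 ^ r + 4 ^ r * C with hH
  have hH0 : 0 < H := by positivity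
  refine ⟨min 1 (c / (K ^ 2 * H)), by positivity, min_le_left _ _, ?_⟩
  intro A _ _ L Q B W hQ hW hW' hdisj hL hN hlow hupp
  have hLL : L ≤ L ^ 2 := Nat.le_self_pow (by norm_num) L
  set N := Fintype.card A
  have hNpos : (0 : ℝ) < N := by
    have : 0 < N := by omega
    exact_mod_cast this
  set u : ℝ := ((L : ℝ) ^ 2) ^ r
  set v : ℝ := (N : ℝ) ^ r
  have hv : 0 < v := by positivity
  set F : ℝ := (N.factorial : ℝ)
  have hF : 0 < F := by positivity
  set hit : Equiv.Perm A → ℕ → Prop := fun ρ b => r ≤ #{x ∈ Q | ρ x ∈ W b}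
  set X : Equiv.Perm A → ℝ := fun ρ => ∑ b ∈ B, if hit ρ b then 1 else 0 with hX
  have hfirst : ∀ b ∈ B, F * u ≤ K * v * (#{ρ : Equiv.Perm A | hit ρ b} : ℝ) := by
    intro b hb
    have := le_card_perm_le_hits r L Q (W b) hQ (hW b hb) (hW' b hb) hr hL hN
    have := (Nat.cast_le (α := ℝ)).2 this
    push_cast at this
    exact this
  have hsingle : ∀ b ∈ B, v * (#{ρ : Equiv.Perm A | hit ρ b} : ℝ) ≤ 2 ^ r * u * F := by
    intro b hb
    have := card_perm_exists_embedding_le (ι := Fin r) Q (fun _ => W b) L hQ.le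
      (fun _ => hW b hb) (by rw [Fintype.card_fin]; omega) (fun ρ => hit ρ b) (fun ρ h => by
        obtain ⟨e, he⟩ := exists_embedding_mem_of_le_card h
        exact ⟨e, fun i => mem_filter.1 (he i)⟩)
    have := (Nat.cast_le (α := ℝ)).2 this
    rw [Fintype.card_fin] at this
    push_cast at this
    exact this
  have hpair : ∀ b ∈ B, ∀ b' ∈ B, b ≠ b' →
      v ^ 2 * (#{ρ : Equiv.Perm A | hit ρ b ∧ hit ρ b'} : ℝ) ≤ 4 ^ r * u ^ 2 * F := by
    intro b hb b' hb' hne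
    have := card_perm_exists_embedding_le (ι := Fin r ⊕ Fin r) Q
      (Sum.elim (fun _ => W b) (fun _ => W b')) L hQ.le
      (by rintro (i | i); exacts [hW b hb, hW b' hb'])
      (by rw [Fintype.card_sum, Fintype.card_fin]; omega)
      (fun ρ => hit ρ b ∧ hit ρ b') (fun ρ h => by
        obtain ⟨e, he⟩ := exists_embedding_mem_of_le_card h.1
        obtain ⟨e', he'⟩ := exists_embedding_mem_of_le_card h.2
        simp only [mem_filter] at he he'
        refine ⟨⟨Sum.elim e e', ?_⟩, ?_⟩
        · refine Function.Injective.sumElim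
            e.injective e'.injective ?_
          intro i j hij
          refine Finset.disjoint_left.1 (hdisj b hb b' hb' hne) (he i).2 ?_
          rw [hij]
          exact (he' j).2
        · rintro (i | i)
          exacts [he i, he' i])
    have := (Nat.cast_le (α := ℝ)).2 this
    rw [Fintype.card_sum, Fintype.card_fin, ← two_mul] at this
    push_cast at this
    calc v ^ 2 * (#{ρ : Equiv.Perm A | hit ρ b ∧ hit ρ b'} : ℝ)
        = (N : ℝ) ^ (2 * r) * (#{ρ : Equiv.Perm A | hit ρ b ∧ hit ρ b'} : ℝ) := by
          simp only [v]; ring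
      _ ≤ _ := this
      _ = _ := by
          rw [pow_mul (2 : ℝ), show (2 : ℝ) ^ 2 = 4 by norm_num]; simp only [u, F, N]; ring
  have hsum1 : ∑ ρ, X ρ = ∑ b ∈ B, (#{ρ : Equiv.Perm A | hit ρ b} : ℝ) := by
    rw [hX, sum_comm]
    refine sum_congr rfl fun b _ => ?_
    rw [card_filter]; push_cast; rfl
  have hsum2 : ∑ ρ, X ρ ^ 2
      = ∑ b ∈ B, ∑ b' ∈ B, (#{ρ : Equiv.Perm A | hit ρ b ∧ hit ρ b'} : ℝ) := by
    simp_rw [hX, sq, sum_mul_sum]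
    rw [sum_comm]
    refine sum_congr rfl fun b _ => ?_
    rw [sum_comm]
    refine sum_congr rfl fun b' _ => ?_
    rw [card_filter]; push_cast
    refine sum_congr rfl fun ρ _ => ?_
    rw [ite_zero_mul_ite_zero, one_mul]
  clear_value K H F u v
  set q : ℝ := #B * u / v with hq
  have hqv : q * v = #B * u := by rw [hq]; field_simp
  have hqc : c ≤ q := by rw [hq, le_div_iff₀ hv]; exact hlow
  have hqC : q ≤ C := by rw [hq, div_le_iff₀ hv]; exact hupp
  have hq0 : 0 < q := hc.trans_le hqc
  have hE1 : q * F / K ≤ ∑ ρ, X ρ := by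
    rw [hsum1, div_le_iff₀ hK0]
    refine le_of_mul_le_mul_left ?_ hv
    calc v * (q * F) = ∑ _b ∈ B, F * u := by
          rw [sum_const, nsmul_eq_mul]; linear_combination F * hqv
      _ ≤ ∑ b ∈ B, K * v * (#{ρ : Equiv.Perm A | hit ρ b} : ℝ) := sum_le_sum hfirst
      _ = _ := by rw [← mul_sum]; ring
  have hE2 : ∑ ρ, X ρ ^ 2 ≤ q * F * H := by
    rw [hsum2]
    have hterm : ∀ b ∈ B, ∀ b' ∈ B, (#{ρ : Equiv.Perm A | hit ρ b ∧ hit ρ b'} : ℝ)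
        ≤ (if b = b' then 2 ^ r * u * F / v else 0) + 4 ^ r * u ^ 2 * F / v ^ 2 := by
      intro b hb b' hb'
      split_ifs with h
      · subst h
        have : (#{ρ : Equiv.Perm A | hit ρ b} : ℝ) ≤ 2 ^ r * u * F / v := by
          rw [le_div_iff₀ hv, mul_comm]; exact hsingle b hb
        simp only [and_self]
        have : 0 ≤ 4 ^ r * u ^ 2 * F / v ^ 2 := by positivity
        linarith
      · rw [zero_add, le_div_iff₀ (by positivity), mul_comm]
        exact hpair b hb b' hb' h
    calc _ ≤ ∑ b ∈ B, ∑ b' ∈ B,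
          ((if b = b' then 2 ^ r * u * F / v else 0) + 4 ^ r * u ^ 2 * F / v ^ 2) :=
          sum_le_sum fun b hb => sum_le_sum fun b' hb' => hterm b hb b' hb'
      _ = #B * (2 ^ r * u * F / v) + #B * (#B * (4 ^ r * u ^ 2 * F / v ^ 2)) := by
          simp only [sum_add_distrib, sum_ite_eq, sum_const, nsmul_eq_mul]
          rw [sum_congr rfl fun b hb => if_pos hb, sum_const, nsmul_eq_mul]
      _ = q * F * (2 ^ r + 4 ^ r * q) := by rw [hq]; ring
      _ ≤ _ := by rw [hH]; gcongr
  set t : ℝ := 1 / (K * H) with ht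
  have hpoint : ∀ ρ, 2 * t * X ρ - t ^ 2 * X ρ ^ 2 ≤ if ∃ b ∈ B, hit ρ b then 1 else 0 := by
    intro ρ
    split_ifs with h
    · nlinarith [sq_nonneg (1 - t * X ρ)]
    · have : X ρ = 0 := sum_eq_zero fun b hb => if_neg fun hb' => h ⟨b, hb, hb'⟩
      simp [this]
  have hfin : 2 * t * (q * F / K) - t ^ 2 * (q * F * H)
      ≤ (#{ρ : Equiv.Perm A | ∃ b ∈ B, hit ρ b} : ℝ) := by
    calc _ ≤ 2 * t * ∑ ρ, X ρ - t ^ 2 * ∑ ρ, X ρ ^ 2 := by gcongr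
      _ = ∑ ρ, (2 * t * X ρ - t ^ 2 * X ρ ^ 2) := by
          rw [sum_sub_distrib, mul_sum, mul_sum]
      _ ≤ ∑ ρ : Equiv.Perm A, if ∃ b ∈ B, hit ρ b then (1 : ℝ) else 0 :=
          sum_le_sum fun ρ _ => hpoint ρ
      _ = _ := by rw [card_filter]; push_cast; rfl
  refine le_trans ?_ hfin
  calc min 1 (c / (K ^ 2 * H)) * F ≤ (q / (K ^ 2 * H)) * F := by
        gcongr
        exact (min_le_right _ _).trans (by gcongr)
    _ = _ := by rw [ht]; field_simp; ring

/-- The number of points of the graph of `π` lying in the box formed by the `a`-th block of `L`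
consecutive positions and the `b`-th block of `L` consecutive values. -/
def boxCount {n : ℕ} (L : ℕ) (π : Equiv.Perm (Fin n)) (a b : ℕ) : ℕ :=
  #{x : Fin n | x.val / L = a ∧ (π x).val / L = b}

theorem exists_new_row_probability (r : ℕ) (hr : 1 ≤ r) :
    ∃ p : ℝ, 0 < p ∧ p ≤ 1 ∧ ∀ (n L a : ℕ) (π : Equiv.Perm (Fin n)) (U : Finset ℕ),
      16 * r ≤ L → 8 * L ^ 2 ≤ n →
      (n : ℝ) ^ r ≤ 4 ^ r * (((n / L : ℕ) : ℝ) * ((L : ℝ) ^ 2) ^ r) →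
      ((n / L : ℕ) : ℝ) * ((L : ℝ) ^ 2) ^ r ≤ (n : ℝ) ^ r →
      2 * (a * L) ≤ n → 8 * #U ≤ n / L →
      p * ((Fintype.card {x : Fin n // ¬ x.val < a * L}).factorial : ℝ)
        ≤ (#{ρ : Equiv.Perm {x : Fin n // ¬ x.val < a * L} | ∃ b < n / L, b ∉ U ∧
            r ≤ boxCount L (π * Equiv.Perm.ofSubtype ρ) a b} : ℝ) := by
  obtain ⟨p, hp0, hp1, hp⟩ := exists_collision_probability r hr (1 / (8 * 4 ^ r)) (2 ^ r)
    (by positivity) (by positivity)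
  refine ⟨p, hp0, hp1, ?_⟩
  intro n L a π U hL hn hlow hupp ha hU
  set m := n / L with hm
  set A := {x : Fin n // ¬ x.val < a * L} with hA
  have hL0 : 0 < L := by omega
  have hL16 : 16 ≤ L := by omega
  have hLL : L * L = L ^ 2 := (sq L).symm
  have hLle : 16 * L ≤ L ^ 2 := by nlinarith
  have hmL : m * L ≤ n := Nat.div_mul_le_self n L
  have hm8 : 8 ≤ m := (Nat.le_div_iff_mul_le hL0).2 (by omega)
  set N := Fintype.card A with hN
  have hNn : N ≤ n := (Fintype.card_subtype_le _).trans (by simp)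
  have hN2 : n ≤ 2 * N := by
    have h1 : Fintype.card {x : Fin n // x.val < a * L} ≤ a * L := by
      rw [Fintype.card_subtype, ← card_range (a * L)]
      exact card_le_card_of_injOn (fun x => x.val) (fun x hx => by simpa using hx)
        (fun x _ y _ h => Fin.ext h)
    have h2 : N = n - Fintype.card {x : Fin n // x.val < a * L} := by
      rw [hN]
      convert Fintype.card_subtype_compl (fun x : Fin n => x.val < a * L)
      exact (Fintype.card_fin n).symm
    omega
  set Q : Finset A := {x | x.1.val / L = a} with hQ
  set W : ℕ → Finset A := fun b => {x | (π x.1).val / L = b} with hW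
  have hQcard : #Q = L := by
    rw [← card_range L]
    have hlt : ∀ k ∈ range L, a * L + k < n := fun k hk => by
      have := mem_range.1 hk
      omega
    refine card_bij' (fun x _ => x.1.val - a * L)
      (fun k hk => ⟨⟨a * L + k, hlt k hk⟩, by simp⟩) ?_ ?_ ?_ ?_
    · intro x hx
      have h1 : x.1.val / L = a := (mem_filter.1 hx).2
      have h2 := x.2
      rw [Nat.div_eq_iff hL0] at h1
      rw [mem_range]
      omega
    · intro k hk
      have := mem_range.1 hk
      simp only [hQ, mem_filter, mem_univ, true_and]
      rw [Nat.div_eq_iff hL0]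
      omega
    · intro x hx
      have h2 := x.2
      ext
      simp only
      omega
    · intro k hk
      simp
  have hWcard : ∀ b, #(W b) ≤ L := by
    intro b
    have : #(Ico (b * L) (b * L + L)) = L := by simp
    rw [← this]
    refine card_le_card_of_injOn (fun x => (π x.1).val) (fun x hx => ?_) (fun x _ y _ h => ?_)
    · have h1 : (π x.1).val / L = b := (mem_filter.1 hx).2
      rw [Nat.div_eq_iff hL0] at h1
      simp only [coe_Ico, Set.mem_Ico]
      omega
    · exact Subtype.ext (π.injective (Fin.ext h))
  set B : Finset ℕ := {b ∈ range m | b ∉ U ∧ L ≤ 8 * #(W b)} with hB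
  have hBle : #B ≤ m := (card_filter_le _ _).trans (by simp)
  have hBge : m ≤ 8 * #B := by
    have hsum : N = ∑ b ∈ range (m + 1), #(W b) := by
      rw [hN, ← card_univ]
      refine card_eq_sum_card_fiberwise (f := fun x : A => (π x.1).val / L) fun x _ => ?_
      simp only [coe_range, Set.mem_Iio]
      exact Nat.lt_succ_of_le (Nat.div_le_div_right (π x.1).2.le)
    rw [sum_range_succ] at hsum
    have hWm := hWcard m
    have hb : ∑ b ∈ range m, 8 * #(W b) ≤ ∑ b ∈ range m,
        (L + 8 * L * (if b ∈ U then 1 else 0)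
          + 8 * L * (if b ∉ U ∧ L ≤ 8 * #(W b) then 1 else 0)) := by
      refine sum_le_sum fun b _ => ?_
      have := hWcard b
      split_ifs with h1 h2 h2
      all_goals first
        | omega
        | simp only [h1, not_false_eq_true, true_and] at h2
          omega
    rw [← mul_sum, sum_add_distrib, sum_add_distrib, ← mul_sum, ← mul_sum, ← card_filter,
      ← card_filter, sum_const, card_range, smul_eq_mul] at hb
    have hUm : #{b ∈ range m | b ∈ U} ≤ #U :=
      card_le_card fun b hb => (mem_filter.1 hb).2
    have h3 : 8 * L * #{b ∈ range m | b ∈ U} ≤ L * m := by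
      calc _ ≤ 8 * L * #U := by gcongr
        _ = L * (8 * #U) := by ring
        _ ≤ _ := by gcongr
    have h4 : (2 * m) * L ≤ (8 * #B + 8) * L := by
      have : 8 * L * #B = 8 * #B * L := by ring
      rw [← hB] at hb
      rw [mul_comm L m] at h3
      rw [mul_assoc 2, add_mul]
      omega
    have := Nat.le_of_mul_le_mul_right h4 hL0
    omega
  have hBgeR : (m : ℝ) ≤ 8 * #B := by exact_mod_cast hBge
  have hBleR : (#B : ℝ) ≤ m := by exact_mod_cast hBle
  have hNnR : (N : ℝ) ≤ n := by exact_mod_cast hNn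
  have hN2R : (n : ℝ) ≤ 2 * N := by exact_mod_cast hN2
  refine (hp A L Q B W hQcard (fun b _ => hWcard b) (fun b hb => (mem_filter.1 hb).2.2)
    ?_ hL (by omega) ?_ ?_).trans ?_
  · intro b _ b' _ hne
    rw [Finset.disjoint_left]
    intro x hx hx'
    exact hne ((mem_filter.1 hx).2.symm.trans (mem_filter.1 hx').2)
  · rw [one_div, inv_mul_le_iff₀ (by positivity)]
    calc (N : ℝ) ^ r ≤ (n : ℝ) ^ r := by gcongr
      _ ≤ _ := hlow
      _ ≤ 4 ^ r * ((8 * #B) * ((L : ℝ) ^ 2) ^ r) := by gcongr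
      _ = _ := by ring
  · calc (#B : ℝ) * ((L : ℝ) ^ 2) ^ r ≤ m * ((L : ℝ) ^ 2) ^ r := by gcongr
      _ ≤ (n : ℝ) ^ r := hupp
      _ ≤ (2 * N : ℝ) ^ r := by gcongr
      _ = _ := mul_pow _ _ _
  · rw [Nat.cast_le]
    refine card_le_card fun ρ hρ => ?_
    simp only [mem_filter, mem_univ, true_and] at hρ ⊢
    obtain ⟨b, hb, hrb⟩ := hρ
    obtain ⟨hbm, hbU, -⟩ := mem_filter.1 hb
    refine ⟨b, mem_range.1 hbm, hbU, hrb.trans ?_⟩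
    refine card_le_card_of_injOn (fun x => x.1) (fun x hx => ?_)
      (fun x _ y _ h => Subtype.ext h)
    obtain ⟨hx1, hx2⟩ := mem_filter.1 hx
    have hx1 := (mem_filter.1 hx1).2
    have hx2 := (mem_filter.1 hx2).2
    refine mem_filter.2 ⟨mem_univ _, hx1, ?_⟩
    rw [Equiv.Perm.mul_apply, Equiv.Perm.ofSubtype_apply_coe]
    exact hx2

open Classical in
/-- Scan the columns `0, …, a - 1` in order, and for each one select a row `b < m` that is not yet
selected and satisfies `G column b`, if there is one. The result is the set of selected rows. -/
noncomputable def greedyRows (m : ℕ) (G : ℕ → ℕ → Prop) : ℕ → Finset ℕ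
  | 0 => ∅
  | a + 1 =>
    if h : ∃ b < m, b ∉ greedyRows m G a ∧ G a b then
      insert h.choose (greedyRows m G a)
    else greedyRows m G a

theorem greedyRows_congr {m : ℕ} {G G' : ℕ → ℕ → Prop} {a : ℕ}
    (h : ∀ a' < a, ∀ b, G a' b ↔ G' a' b) : greedyRows m G a = greedyRows m G' a := by
  induction a with
  | zero => rfl
  | succ a ih =>
    have h1 := ih fun a' ha' => h a' (by omega)
    have h2 : G a = G' a := funext fun b => propext (h a (by omega) b)
    rw [greedyRows, greedyRows, h2, h1]

theorem card_greedyRows_succ_of_exists {m : ℕ} {G : ℕ → ℕ → Prop} {a : ℕ}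
    (h : ∃ b < m, b ∉ greedyRows m G a ∧ G a b) :
    #(greedyRows m G (a + 1)) = #(greedyRows m G a) + 1 := by
  rw [greedyRows, dif_pos h, card_insert_of_notMem h.choose_spec.2.1]

theorem card_greedyRows_le_succ {m : ℕ} {G : ℕ → ℕ → Prop} {a : ℕ} :
    #(greedyRows m G a) ≤ #(greedyRows m G (a + 1)) := by
  rw [greedyRows]
  split_ifs with h
  · exact card_le_card (subset_insert _ _)
  · rfl

theorem exists_matching_of_greedyRows (m : ℕ) (G : ℕ → ℕ → Prop) (a : ℕ) :
    ∃ f : ℕ → ℕ, Set.InjOn f (greedyRows m G a) ∧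
      ∀ b ∈ greedyRows m G a, f b < a ∧ G (f b) b := by
  classical
  induction a with
  | zero => exact ⟨id, by simp [greedyRows]⟩
  | succ a ih =>
    obtain ⟨f, hf, hG⟩ := ih
    rw [greedyRows]
    split_ifs with h
    · set c := h.choose
      obtain ⟨-, hc, hac⟩ := h.choose_spec
      have hne : ∀ b ∈ greedyRows m G a, b ≠ c := by
        rintro b hb rfl
        exact hc hb
      refine ⟨Function.update f c a, ?_, fun b hb => ?_⟩
      · intro x hx y hy hxy
        simp only [coe_insert, Set.mem_insert_iff, mem_coe] at hx hy
        rcases hx with rfl | hx <;> rcases hy with rfl | hy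
        · rfl
        · rw [Function.update_self, Function.update_of_ne (hne y hy)] at hxy
          exact absurd (hG y hy).1 (by omega)
        · rw [Function.update_self, Function.update_of_ne (hne x hx)] at hxy
          exact absurd (hG x hx).1 (by omega)
        · rw [Function.update_of_ne (hne x hx), Function.update_of_ne (hne y hy)] at hxy
          exact hf hx hy hxy
      · rcases mem_insert.1 hb with rfl | hb
        · rw [Function.update_self]
          exact ⟨by omega, hac⟩
        · rw [Function.update_of_ne (hne b hb)]
          exact ⟨(hG b hb).1.trans (by omega), (hG b hb).2⟩
    · exact ⟨f, hf, fun b hb => ⟨(hG b hb).1.trans (by omega), (hG b hb).2⟩⟩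

theorem hasTwins_of_matching {r n L : ℕ} (π : Equiv.Perm (Fin n)) (S : Finset ℕ) (f : ℕ → ℕ)
    (hf : Set.InjOn f S) (hS : ∀ b ∈ S, r ≤ boxCount L π (f b) b) :
    HasTwins r (#S) n π := by
  classical
  have hcard : #(S.image f) = #S := card_image_of_injOn hf
  have hcol : ∀ i : Fin (#S), ∃ b ∈ S, f b = (S.image f).orderEmbOfFin hcard i := fun i =>
    mem_image.1 (orderEmbOfFin_mem _ hcard i)
  choose row hrow hfrow using hcol
  have hrow_inj : ∀ i i', row i = row i' → i = i' := fun i i' h =>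
    ((S.image f).orderEmbOfFin hcard).injective (by rw [← hfrow, ← hfrow, h])
  choose e he using fun i => exists_embedding_mem_of_le_card (hS (row i) (hrow i))
  simp only [mem_filter, mem_univ, true_and] at he
  have hrowval : ∀ i i' (x y : Fin n), (π x).val / L = row i → (π y).val / L = row i' →
      (π x < π y ↔ row i < row i' ∨ (row i = row i' ∧ π x < π y)) := by
    intro i i' x y hx hy
    constructor
    · intro h
      have := Nat.div_le_div_right (c := L) (Fin.lt_def.1 h).le
      rw [hx, hy] at this
      rcases this.lt_or_eq with h1 | h1
      · exact Or.inl h1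
      · exact Or.inr ⟨h1, h⟩
    · rintro (h | h)
      · rw [← hx, ← hy] at h
        exact Fin.lt_def.2 (Nat.lt_of_div_lt_div h)
      · exact h.2
  refine ⟨fun j i => e i j, fun j i i' hii' => ?_, fun j j' hj i i' h => ?_, fun j j' i i' => ?_⟩
  · have h1 := ((S.image f).orderEmbOfFin hcard).strictMono hii'
    rw [← hfrow, ← hfrow, ← (he i j).1, ← (he i' j).1] at h1
    exact Fin.lt_def.2 (Nat.lt_of_div_lt_div h1)
  · have h1 := (he i j).1
    change e i j = e i' j' at h
    rw [h, (he i' j').1, hfrow, hfrow] at h1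
    obtain rfl := ((S.image f).orderEmbOfFin hcard).injective h1
    exact hj ((e i').injective h)
  · rcases eq_or_ne i i' with rfl | hne
    · simp
    · have hne' : row i ≠ row i' := fun h => hne (hrow_inj _ _ h)
      rw [hrowval i i' _ _ (he i j).2 (he i' j).2, hrowval i i' _ _ (he i j').2 (he i' j').2]
      simp [hne']

/-- The rows selected greedily in the first `a` columns, where a box is admissible if it contains
at least `r` points of the graph of `π`. -/
noncomputable def selectedRows {n : ℕ} (r L a : ℕ) (π : Equiv.Perm (Fin n)) : Finset ℕ :=
  greedyRows (n / L) (fun a b => r ≤ boxCount L π a b) a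

theorem selectedRows_mul_ofSubtype {n : ℕ} (r a : ℕ) {L : ℕ} (hL : 0 < L)
    (π : Equiv.Perm (Fin n))
    (ρ : Equiv.Perm {x : Fin n // ¬ x.val < a * L}) :
    selectedRows r L a (π * Equiv.Perm.ofSubtype ρ) = selectedRows r L a π := by
  refine greedyRows_congr fun a' ha' b => ?_
  suffices boxCount L (π * Equiv.Perm.ofSubtype ρ) a' b = boxCount L π a' b by rw [this]
  refine congrArg card (filter_congr fun x _ => and_congr_right fun hx => ?_)
  have hxa : x.val < a * L := by
    rw [← Nat.div_lt_iff_lt_mul hL]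
    omega
  rw [Equiv.Perm.mul_apply, Equiv.Perm.ofSubtype_apply_of_not_mem _ (by simpa using hxa)]

/-- A potential which halves whenever a new row is selected, and vanishes once `k` rows are. -/
noncomputable def potential (k : ℕ) (S : Finset ℕ) : ℝ :=
  if #S < k then (1 / 2) ^ #S else 0

theorem potential_nonneg (k : ℕ) (S : Finset ℕ) : 0 ≤ potential k S := by
  unfold potential
  split_ifs <;> positivity

theorem potential_le_of_card_le {k : ℕ} {S T : Finset ℕ} (h : #S ≤ #T) :
    potential k T ≤ potential k S := by
  unfold potential
  split_ifs with h1 h2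
  · exact pow_le_pow_of_le_one (by norm_num) (by norm_num) h
  · omega
  · positivity
  · rfl

theorem potential_le_half_of_card_eq {k : ℕ} {S T : Finset ℕ} (h : #T = #S + 1) :
    potential k T ≤ 1 / 2 * potential k S := by
  unfold potential
  split_ifs with h1 h2
  · rw [h, pow_succ, mul_comm]
  · omega
  · positivity
  · simp

theorem exists_card_selectedRows_lt_le (r : ℕ) (hr : 1 ≤ r) :
    ∃ p : ℝ, 0 < p ∧ p ≤ 1 ∧ ∀ n L k M : ℕ,
      16 * r ≤ L → 8 * L ^ 2 ≤ n →
      (n : ℝ) ^ r ≤ 4 ^ r * (((n / L : ℕ) : ℝ) * ((L : ℝ) ^ 2) ^ r) →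
      ((n / L : ℕ) : ℝ) * ((L : ℝ) ^ 2) ^ r ≤ (n : ℝ) ^ r →
      2 * (M * L) ≤ n → 8 * k ≤ n / L → 1 ≤ k →
      (#{π : Equiv.Perm (Fin n) | #(selectedRows r L M π) < k} : ℝ)
        ≤ 2 ^ k * (1 - p / 2) ^ M * (n.factorial : ℝ) := by
  classical
  obtain ⟨p, hp0, hp1, hp⟩ := exists_new_row_probability r hr
  refine ⟨p, hp0, hp1, fun n L k M hL hn hlow hupp hM hk hk1 => ?_⟩
  have step : ∀ a, 2 * (a * L) ≤ n →
      ∑ π : Equiv.Perm (Fin n), potential k (selectedRows r L (a + 1) π)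
        ≤ (1 - p / 2) * ∑ π : Equiv.Perm (Fin n), potential k (selectedRows r L a π) := by
    intro a ha
    set A := {x : Fin n // ¬ x.val < a * L}
    set F : ℝ := ((Fintype.card A).factorial : ℝ) with hF
    have hFpos : 0 < F := by positivity
    have hcard : ((Fintype.card (Equiv.Perm A) : ℕ) : ℝ) = F := by rw [Fintype.card_perm]
    have hmono : ∀ π : Equiv.Perm (Fin n),
        #(selectedRows r L a π) ≤ #(selectedRows r L (a + 1) π) := fun π =>
      card_greedyRows_le_succ
    have hlocal : ∀ π : Equiv.Perm (Fin n),
        ∑ ρ : Equiv.Perm A, potential k (selectedRows r L (a + 1) (π * Equiv.Perm.ofSubtype ρ))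
          ≤ potential k (selectedRows r L a π) * ((1 - p / 2) * F) := by
      intro π
      rcases Nat.lt_or_ge #(selectedRows r L a π) k with hlt | hge
      · set w := potential k (selectedRows r L a π)
        have hw : 0 ≤ w := potential_nonneg _ _
        have hsucc := hp n L a π (selectedRows r L a π) hL hn hlow hupp ha (by omega)
        calc _ ≤ ∑ ρ : Equiv.Perm A, w * (1 - 1 / 2 * (if ∃ b < n / L,
              b ∉ selectedRows r L a π ∧ r ≤ boxCount L (π * Equiv.Perm.ofSubtype ρ) a b
                then 1 else 0)) := by
              refine sum_le_sum fun ρ _ => ?_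
              have heq := selectedRows_mul_ofSubtype r a (by omega) π ρ
              split_ifs with h
              · rw [← heq] at h
                have := potential_le_half_of_card_eq (k := k) (card_greedyRows_succ_of_exists
                  (G := fun a b => r ≤ boxCount L (π * Equiv.Perm.ofSubtype ρ) a b) h)
                change _ ≤ 1 / 2 * potential k (selectedRows r L a _) at this
                rw [heq] at this
                calc _ ≤ 1 / 2 * w := this
                  _ = _ := by ring
              · have := potential_le_of_card_le (k := k) (hmono (π * Equiv.Perm.ofSubtype ρ))
                rw [heq] at this
                simpa using this
          _ = w * (F - 1 / 2 * (#{ρ : Equiv.Perm A | ∃ b < n / L,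
              b ∉ selectedRows r L a π ∧
                r ≤ boxCount L (π * Equiv.Perm.ofSubtype ρ) a b} : ℝ)) := by
              rw [← mul_sum, sum_sub_distrib, ← mul_sum, card_filter]
              push_cast
              rw [sum_const, nsmul_eq_mul, card_univ, hcard, mul_one]
          _ ≤ w * (F - 1 / 2 * (p * F)) := by gcongr
          _ = _ := by ring
      · have h0 : potential k (selectedRows r L a π) = 0 := if_neg (by omega)
        rw [h0, zero_mul]
        refine sum_nonpos fun ρ _ => ?_
        have := potential_le_of_card_le (k := k) (hmono (π * Equiv.Perm.ofSubtype ρ))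
        rwa [selectedRows_mul_ofSubtype r a (by omega), h0] at this
    refine le_of_mul_le_mul_left ?_ hFpos
    calc F * ∑ π : Equiv.Perm (Fin n), potential k (selectedRows r L (a + 1) π)
        = ∑ ρ : Equiv.Perm A, ∑ π : Equiv.Perm (Fin n),
            potential k (selectedRows r L (a + 1) (π * Equiv.Perm.ofSubtype ρ)) := by
          rw [← hcard, ← card_univ, ← nsmul_eq_mul, ← sum_const]
          refine sum_congr rfl fun ρ _ => ?_
          exact (Equiv.sum_comp (Equiv.mulRight (Equiv.Perm.ofSubtype ρ))
            fun π => potential k (selectedRows r L (a + 1) π)).symm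
      _ ≤ ∑ π : Equiv.Perm (Fin n), potential k (selectedRows r L a π) * ((1 - p / 2) * F) := by
          rw [sum_comm]
          exact sum_le_sum fun π _ => hlocal π
      _ = _ := by rw [← sum_mul]; ring
  have iter : ∀ a, a ≤ M → ∑ π : Equiv.Perm (Fin n), potential k (selectedRows r L a π)
      ≤ (1 - p / 2) ^ a * (n.factorial : ℝ) := by
    intro a
    induction a with
    | zero =>
      intro _
      have : ∀ π : Equiv.Perm (Fin n), potential k (selectedRows r L 0 π) = 1 := fun π => by
        have : 0 < k := hk1
        simp [potential, selectedRows, greedyRows, this]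
      simp [this, Fintype.card_perm]
    | succ a ih =>
      intro ha
      have haM : a * L ≤ M * L := Nat.mul_le_mul_right L (by omega)
      have h1 : 0 ≤ 1 - p / 2 := by linarith
      calc _ ≤ _ := step a (by omega)
        _ ≤ (1 - p / 2) * ((1 - p / 2) ^ a * (n.factorial : ℝ)) := by
          gcongr; exact ih (by omega)
        _ = _ := by ring
  have hfin : (#{π : Equiv.Perm (Fin n) | #(selectedRows r L M π) < k} : ℝ) * (1 / 2) ^ k
      ≤ ∑ π : Equiv.Perm (Fin n), potential k (selectedRows r L M π) := by
    rw [card_filter]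
    push_cast
    rw [sum_mul]
    refine sum_le_sum fun π _ => ?_
    unfold potential
    split_ifs with h
    · rw [one_mul]
      exact pow_le_pow_of_le_one (by norm_num) (by norm_num) h.le
    · simp
  have := hfin.trans (iter M le_rfl)
  rw [one_div, inv_pow, ← div_eq_mul_inv, div_le_iff₀ (by positivity)] at this
  linarith

theorem hasTwins_card_selectedRows {n : ℕ} (r L a : ℕ) (π : Equiv.Perm (Fin n)) :
    HasTwins r #(selectedRows r L a π) n π := by
  obtain ⟨f, hf, hG⟩ := exists_matching_of_greedyRows (n / L)
    (fun a b => r ≤ boxCount L π a b) a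
  exact hasTwins_of_matching π _ f hf fun b hb => (hG b hb).2

/-- The side length `L = ⌊n ^ ((r - 1) / (2 r - 1))⌋` of the boxes is such that a grid of boxes has,
up to constants, one box containing `r` points in each column. -/
theorem eventually_exists_block_length (r : ℕ) (hr : 2 ≤ r) :
    ∀ᶠ n : ℕ in Filter.atTop, ∃ L : ℕ, 16 * r ≤ L ∧ 8 * L ^ 2 ≤ n ∧
      (n : ℝ) ^ r ≤ 4 ^ r * (((n / L : ℕ) : ℝ) * ((L : ℝ) ^ 2) ^ r) ∧
      ((n / L : ℕ) : ℝ) * ((L : ℝ) ^ 2) ^ r ≤ (n : ℝ) ^ r ∧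
      (n : ℝ) ^ ((r : ℝ) / (2 * (r : ℝ) - 1)) ≤ ((n / L : ℕ) : ℝ) + 1 := by
  have hr2 : (2 : ℝ) ≤ r := by exact_mod_cast hr
  set d : ℝ := 2 * (r : ℝ) - 1 with hd
  have hd0 : 0 < d := by linarith
  have hy_lim := (tendsto_rpow_atTop (y := ((r : ℝ) - 1) / d)
    (div_pos (by linarith) hd0)).comp tendsto_natCast_atTop_atTop
  have hz_lim := (tendsto_rpow_atTop (y := 1 / d)
    (div_pos one_pos hd0)).comp tendsto_natCast_atTop_atTop
  filter_upwards [hy_lim.eventually_ge_atTop (16 * r + 1 : ℝ), hz_lim.eventually_ge_atTop (8 : ℝ),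
    Filter.eventually_gt_atTop 0] with n hy hz hn
  simp only [Function.comp_apply] at hy hz
  have hn0 : (0 : ℝ) < n := by exact_mod_cast hn
  set y : ℝ := (n : ℝ) ^ (((r : ℝ) - 1) / d) with hydef
  set z : ℝ := (n : ℝ) ^ (1 / d) with hzdef
  set x : ℝ := (n : ℝ) ^ ((r : ℝ) / d) with hxdef
  have hxy : x * y = n := by
    rw [hxdef, hydef, ← Real.rpow_add hn0, ← add_div, hd,
      show ((r : ℝ) + (r - 1)) / (2 * r - 1) = 1 by rw [div_eq_one_iff_eq (by linarith)]; ring,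
      Real.rpow_one]
  have hyz : y ^ 2 * z = n := by
    rw [hzdef, hydef, ← Real.rpow_natCast, ← Real.rpow_mul hn0.le, ← Real.rpow_add hn0, hd,
      show ((r : ℝ) - 1) / (2 * r - 1) * ((2 : ℕ) : ℝ) + 1 / (2 * r - 1) = 1 by
        have : 2 * (r : ℝ) - 1 ≠ 0 := hd0.ne'
        push_cast
        rw [div_mul_eq_mul_div, ← add_div, div_eq_one_iff_eq this]
        ring,
      Real.rpow_one]
  have hypow : n * y ^ (2 * r - 1) = (n : ℝ) ^ r := by
    have h1 : y ^ (2 * r - 1) = (n : ℝ) ^ (r - 1) := by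
      rw [hydef, ← Real.rpow_natCast, ← Real.rpow_mul hn0.le, ← Real.rpow_natCast,
        Nat.cast_sub (by omega), Nat.cast_sub (by omega)]
      push_cast
      rw [← hd, div_mul_cancel₀ _ hd0.ne']
    rw [h1, ← pow_succ', Nat.sub_add_cancel (by omega)]
  have hypos : 0 < y := by positivity
  obtain ⟨s, hs⟩ : ∃ s, 2 * r = s + 1 := ⟨2 * r - 1, by omega⟩
  have hs' : 2 * r - 1 = s := by omega
  rw [hs'] at hypow
  set L : ℕ := ⌊y⌋₊ with hL
  have hLy : (L : ℝ) ≤ y := Nat.floor_le hypos.le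
  have hyL : y < L + 1 := Nat.lt_floor_add_one y
  have hL16 : 16 * r ≤ L := Nat.le_floor (by push_cast; linarith)
  have hLpos : 0 < L := by omega
  have hL0 : (0 : ℝ) < L := by exact_mod_cast hLpos
  have hmL : ((n / L : ℕ) : ℝ) * L ≤ n := by exact_mod_cast Nat.div_mul_le_self n L
  have hmL' : (n : ℝ) ≤ (((n / L : ℕ) : ℝ) + 1) * L := by
    have := (Nat.lt_div_mul_add (a := n) hLpos).le
    rw [← Nat.succ_mul] at this
    exact_mod_cast this
  have h8 : 8 * L ^ 2 ≤ n := by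
    have : (8 : ℝ) * (L : ℝ) ^ 2 ≤ (n : ℝ) := by
      calc (8 : ℝ) * (L : ℝ) ^ 2 ≤ z * y ^ 2 := by gcongr
        _ = (n : ℝ) := by rw [mul_comm, hyz]
    exact_mod_cast this
  have hm1 : (1 : ℝ) ≤ ((n / L : ℕ) : ℝ) := by
    have : 1 ≤ n / L := (Nat.le_div_iff_mul_le hLpos).2 (by nlinarith)
    exact_mod_cast this
  have hpow : ((L : ℝ) ^ 2) ^ r = L * L ^ s := by rw [← pow_mul, hs, pow_succ']
  refine ⟨L, hL16, h8, ?_, ?_, ?_⟩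
  · have h4 : (4 : ℝ) ^ r = 2 * 2 ^ s := by
      rw [← pow_succ', ← hs, pow_mul]; norm_num
    rw [hpow, h4, ← hypow]
    calc (n : ℝ) * y ^ s ≤ (2 * ((n / L : ℕ) : ℝ) * L) * (2 * L) ^ s := by
          gcongr
          · nlinarith
          · linarith
      _ = _ := by rw [mul_pow]; ring
  · rw [hpow, ← hypow, ← mul_assoc]
    gcongr
  · refine le_of_mul_le_mul_right ?_ hL0
    calc x * L ≤ x * y := by gcongr
      _ = n := hxy
      _ ≤ _ := hmL'

/-- Lower bound of Theorem 2: for every `r ≥ 2` there is `c > 0` such that the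
probability that a uniformly random permutation of `[n]` contains `r`-twins of
length at least `c · n^(r/(2r-1))` tends to `1` as `n → ∞`. -/
theorem random_twins_lower_bound (r : ℕ) (hr : 2 ≤ r) :
    ∃ c : ℝ, 0 < c ∧
      Filter.Tendsto
        (fun n : ℕ =>
          (Nat.card {π : Equiv.Perm (Fin n) //
              ∃ k : ℕ, c * (n : ℝ) ^ ((r : ℝ) / (2 * (r : ℝ) - 1)) ≤ (k : ℝ) ∧
                HasTwins r k n π} : ℝ) / (n.factorial : ℝ))
        Filter.atTop (nhds 1) := by
  classical
  obtain ⟨p, hp0, hp1, hp⟩ := exists_card_selectedRows_lt_le r (by omega)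
  set α : ℝ := (r : ℝ) / (2 * (r : ℝ) - 1) with hα
  have hr2 : (2 : ℝ) ≤ r := by exact_mod_cast hr
  have hα0 : 0 < α := div_pos (by linarith) (by linarith)
  set c : ℝ := p / 16 with hc
  have hc0 : 0 < c := by positivity
  refine ⟨c, hc0, ?_⟩
  have hx_lim : Filter.Tendsto (fun n : ℕ => (n : ℝ) ^ α) Filter.atTop Filter.atTop :=
    (tendsto_rpow_atTop hα0).comp tendsto_natCast_atTop_atTop
  have herr : Filter.Tendsto
      (fun n : ℕ => 1 - Real.exp (1 + p / 2) * Real.exp (-(p / 8 * (n : ℝ) ^ α)))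
      Filter.atTop (nhds 1) := by
    have h1 := Real.tendsto_exp_neg_atTop_nhds_zero.comp
      (hx_lim.const_mul_atTop (show 0 < p / 8 by positivity))
    simpa using (h1.const_mul (Real.exp (1 + p / 2))).const_sub 1
  refine tendsto_of_tendsto_of_tendsto_of_le_of_le' herr tendsto_const_nhds ?_ ?_
  · filter_upwards [eventually_exists_block_length r hr, hx_lim.eventually_ge_atTop 18]
      with n hblock hx18
    obtain ⟨L, hL, h8, hlow, hupp, hm⟩ := hblock
    set x : ℝ := (n : ℝ) ^ α
    set m : ℕ := n / L with hmdef
    set M : ℕ := m / 2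
    set k : ℕ := ⌈c * x⌉₊ with hk
    have hkx : (k : ℝ) < c * x + 1 := Nat.ceil_lt_add_one (by positivity)
    have hk1 : 1 ≤ k := Nat.ceil_pos.2 (by positivity)
    have hkm : 8 * k ≤ m := by
      have : (8 * k : ℝ) ≤ m := by
        have : c * x ≤ 1 / 16 * x := by gcongr; linarith
        linarith
      exact_mod_cast this
    have hML : 2 * (M * L) ≤ n := by
      calc 2 * (M * L) = (M * 2) * L := by ring
        _ ≤ m * L := Nat.mul_le_mul_right L (Nat.div_mul_le_self m 2)
        _ ≤ n := Nat.div_mul_le_self n L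
    have hM : x / 2 - 1 ≤ M := by
      have : m ≤ 2 * M + 1 := by omega
      have : (m : ℝ) ≤ 2 * M + 1 := by exact_mod_cast this
      linarith
    have hbad := hp n L k M hL h8 hlow hupp hML hkm hk1
    have herr_le : (2 : ℝ) ^ k * (1 - p / 2) ^ M
        ≤ Real.exp (1 + p / 2) * Real.exp (-(p / 8 * x)) := by
      calc (2 : ℝ) ^ k * (1 - p / 2) ^ M ≤ Real.exp 1 ^ k * Real.exp (-(p / 2)) ^ M := by
            have h2 := Real.add_one_le_exp (1 : ℝ)
            have h3 := Real.add_one_le_exp (-(p / 2))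
            have h4 : 0 ≤ 1 - p / 2 := by linarith
            gcongr <;> linarith
        _ = Real.exp (k - p / 2 * M) := by
            rw [← Real.exp_nat_mul, ← Real.exp_nat_mul, ← Real.exp_add]; congr 1; ring
        _ ≤ Real.exp (1 + p / 2 + -(p / 8 * x)) := by
            gcongr
            have : p / 2 * (x / 2 - 1) ≤ p / 2 * M := by gcongr
            have : 0 ≤ p * x := by positivity
            rw [hc] at hkx
            linarith
        _ = _ := Real.exp_add _ _
    have hF : (0 : ℝ) < n.factorial := by positivity
    rw [le_div_iff₀ hF, Nat.card_eq_fintype_card, Fintype.card_subtype]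
    have htotal : n.factorial ≤ #{π : Equiv.Perm (Fin n) | #(selectedRows r L M π) < k}
        + #{π : Equiv.Perm (Fin n) | ∃ k' : ℕ, c * x ≤ (k' : ℝ) ∧ HasTwins r k' n π} := by
      rw [← Fintype.card_fin n, ← Fintype.card_perm, ← card_univ, Fintype.card_fin]
      refine (card_le_card fun π _ => ?_).trans (card_union_le _ _)
      rw [mem_union, mem_filter, mem_filter]
      rcases Nat.lt_or_ge #(selectedRows r L M π) k with h | h
      · exact Or.inl ⟨mem_univ _, h⟩
      · exact Or.inr ⟨mem_univ _, _, (Nat.le_ceil _).trans (Nat.cast_le.2 h),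
          hasTwins_card_selectedRows r L M π⟩
    have htotal := (Nat.cast_le (α := ℝ)).2 htotal
    push_cast at htotal
    have := mul_le_mul_of_nonneg_right herr_le hF.le
    linarith
  · refine Filter.Eventually.of_forall fun n => ?_
    have hF : (0 : ℝ) < n.factorial := by positivity
    rw [div_le_one hF, Nat.card_eq_fintype_card]
    refine Nat.cast_le.2 ((Fintype.card_subtype_le _).trans ?_)
    rw [Fintype.card_perm, Fintype.card_fin]
end

section
/- For every integer r ≥ 2, setting R = C(2r−1, r), and for every m ≥ 1: among any 2r−1 permutations of [m] there exist r of them that share a common subsequence of length at least m^{1/R}; i.e., there is a sequence of length at least m^{1/R} that occurs as a subsequence of each of these r permutations. -/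
/-- A finite preorder has a strictly monotone rank function whose value at each point is
the number of steps of some chain. -/
theorem exists_strictMono_rank (α : Type*) [Preorder α] [Finite α] :
    ∃ f : α → ℕ, StrictMono f ∧ ∀ a, ∃ z : Fin (f a + 1) → α, StrictMono z := by
  have hfin (a : α) : Order.height a < ⊤ := by
    refine (Order.height_le fun p _ ↦ ?_).trans_lt (ENat.natCast_lt_top (Nat.card α))
    have h := Nat.card_le_card_of_injective p p.strictMono.injective
    rw [Nat.card_fin] at h
    exact_mod_cast (Nat.le_succ _).trans h
  refine ⟨fun a ↦ (Order.height a).toNat, fun a b hab ↦ ?_, fun a ↦ ?_⟩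
  · have h := Order.height_strictMono hab (hfin a)
    lift Order.height a to ℕ using (hfin a).ne with n
    lift Order.height b to ℕ using (hfin b).ne with k
    simpa using h
  · obtain ⟨p, -, hp⟩ := Order.exists_series_of_height_eq_coe a
      (ENat.natCast_toNat (hfin a).ne).symm
    exact ⟨p ∘ Fin.cast (by rw [hp]), p.strictMono.comp (Fin.cast_strictMono _)⟩

/-- The rank function for the order "`a` precedes `b` in every permutation indexed by `S`". -/
theorem exists_commonSubsequence_rank {ι : Type*} {m : ℕ} (perms : ι → Equiv.Perm (Fin m))
    (S : Finset ι) (hS : S.Nonempty) :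
    ∃ f : Fin m → ℕ,
      (∀ a b, (∀ j ∈ S, (perms j).symm a < (perms j).symm b) → f a < f b) ∧
      ∀ a, ∃ z : Fin (f a + 1) → Fin m,
        ∀ j ∈ S, ∃ p : Fin (f a + 1) → Fin m, StrictMono p ∧ ∀ i, perms j (p i) = z i := by
  obtain ⟨j₀, hj₀⟩ := hS
  let g : Fin m → S → Fin m := fun a j ↦ (perms j).symm a
  obtain ⟨f, hf, hz⟩ := @exists_strictMono_rank (Fin m) (Preorder.lift g) _
  refine ⟨f, fun a b hab ↦ ?_, fun a ↦ ?_⟩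
  · refine @hf a b (show g a < g b from ?_)
    exact Pi.lt_def.2 ⟨fun j ↦ (hab j j.2).le, ⟨j₀, hj₀⟩, hab j₀ hj₀⟩
  · obtain ⟨z, hz⟩ := hz a
    refine ⟨z, fun j hj ↦ ⟨fun i ↦ (perms j).symm (z i), fun i k hik ↦ ?_, fun i ↦ by simp⟩⟩
    have h : g (z i) < g (z k) := hz hik
    refine (h.le ⟨j, hj⟩).lt_of_ne fun he ↦ h.ne ?_
    rw [(perms j).symm.injective he]

/-- Any two elements occur in the same order in `r` out of `2 * r - 1` permutations. -/
theorem exists_finset_agreeing_order {r m : ℕ} (perms : Fin (2 * r - 1) → Equiv.Perm (Fin m))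
    {a b : Fin m} (hab : a ≠ b) :
    ∃ S : Finset (Fin (2 * r - 1)), S.card = r ∧
      ((∀ j ∈ S, (perms j).symm a < (perms j).symm b) ∨
        ∀ j ∈ S, (perms j).symm b < (perms j).symm a) := by
  have hcard := Finset.card_filter_add_card_filter_not (s := Finset.univ)
    (fun j ↦ (perms j).symm a < (perms j).symm b)
  rw [Finset.card_univ, Fintype.card_fin] at hcard
  by_cases h : r ≤ (Finset.univ.filter fun j ↦ (perms j).symm a < (perms j).symm b).card
  · obtain ⟨S, hS, hr⟩ := Finset.exists_subset_card_eq h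
    exact ⟨S, hr, Or.inl fun j hj ↦ (Finset.mem_filter.1 (hS hj)).2⟩
  · have h' : r ≤ (Finset.univ.filter fun j ↦
        ¬ (perms j).symm a < (perms j).symm b).card := by omega
    obtain ⟨S, hS, hr⟩ := Finset.exists_subset_card_eq h'
    refine ⟨S, hr, Or.inr fun j hj ↦ ?_⟩
    exact (not_lt.1 (Finset.mem_filter.1 (hS hj)).2).lt_of_ne
      fun he ↦ hab ((perms j).symm.injective he).symm


/-- Bukh–Zhou: for every `r ≥ 2`, with `R = C(2r-1, r)`, among any `2r-1` permutations
of `[m]` there are `r` of them sharing a common subsequence of length at least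
`m^(1/R)`. -/
theorem common_subsequence_among_permutations (r m : ℕ) (hr : 2 ≤ r) (hm : 1 ≤ m)
    (perms : Fin (2 * r - 1) → Equiv.Perm (Fin m)) :
    ∃ (S : Finset (Fin (2 * r - 1))) (k : ℕ) (z : Fin k → Fin m),
      S.card = r ∧
      (m : ℝ) ^ (1 / (((2 * r - 1).choose r : ℕ) : ℝ)) ≤ (k : ℝ) ∧
      ∀ j ∈ S, ∃ p : Fin k → Fin m, StrictMono p ∧ ∀ i, perms j (p i) = z i := by
  choose f hf hz using fun S : {S : Finset (Fin (2 * r - 1)) // S.card = r} ↦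
    exists_commonSubsequence_rank perms S.1 (Finset.card_pos.1 (by rw [S.2]; omega))
  obtain ⟨S₀, -, hS₀⟩ := Finset.exists_subset_card_eq
    (show r ≤ (Finset.univ : Finset (Fin (2 * r - 1))).card by
      rw [Finset.card_univ, Fintype.card_fin]; omega)
  have : Nonempty ({S : Finset (Fin (2 * r - 1)) // S.card = r} × Fin m) :=
    ⟨⟨S₀, hS₀⟩, ⟨0, hm⟩⟩
  obtain ⟨⟨S, a⟩, hmax⟩ := Finite.exists_max
    fun x : {S : Finset (Fin (2 * r - 1)) // S.card = r} × Fin m ↦ f x.1 x.2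
  obtain ⟨z, hz⟩ := hz S a
  refine ⟨S.1, f S a + 1, z, S.2, ?_, hz⟩
  let F : Fin m → {S : Finset (Fin (2 * r - 1)) // S.card = r} → Fin (f S a + 1) :=
    fun x T ↦ ⟨f T x, Nat.lt_succ_of_le (hmax (T, x))⟩
  have hF : Function.Injective F := fun x y hxy ↦ by
    by_contra hne
    obtain ⟨T, hT, h⟩ := exists_finset_agreeing_order perms hne
    have he : f ⟨T, hT⟩ x = f ⟨T, hT⟩ y := congrArg Fin.val (congrFun hxy ⟨T, hT⟩)
    rcases h with h | h
    · exact (hf ⟨T, hT⟩ _ _ h).ne he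
    · exact (hf ⟨T, hT⟩ _ _ h).ne he.symm
  have hle : m ≤ (f S a + 1) ^ (2 * r - 1).choose r := by
    simpa using Fintype.card_le_of_injective F hF
  have hR : (2 * r - 1).choose r ≠ 0 := (Nat.choose_pos (by omega)).ne'
  calc (m : ℝ) ^ (1 / (((2 * r - 1).choose r : ℕ) : ℝ))
      ≤ (((f S a + 1 : ℕ) : ℝ) ^ (2 * r - 1).choose r) ^
          (1 / (((2 * r - 1).choose r : ℕ) : ℝ)) :=
        Real.rpow_le_rpow (Nat.cast_nonneg _) (by exact_mod_cast hle) (by positivity)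
    _ = ((f S a + 1 : ℕ) : ℝ) := by
        rw [one_div, Real.pow_rpow_inv_natCast (Nat.cast_nonneg _) hR]
end

section
/- Let r ≥ 2, k ≥ 1 and n be integers with rk ≤ n, let Π be a uniformly random permutation of [n], and let X be the number of unordered families {A_1, …, A_r} of pairwise disjoint k-element subsets of [n] such that the subsequences of Π at positions A_1, …, A_r are pairwise similar (i.e., X counts the r-twins of length k in Π). Then E[X] = n(n−1)⋯(n−rk+1) / (r! · (k!)^{2r−1}). -/
/-- The subsequences of the permutation `π` read off (in increasing order of
positions) at the position sets `A` and `B` are similar, i.e., have the same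
relative order. -/
def SimilarAt {n : ℕ} (π : Equiv.Perm (Fin n)) (A B : Finset (Fin n)) : Prop :=
  ∃ h : A.card = B.card, ∀ i j : Fin A.card,
    (π (A.orderIsoOfFin rfl i) < π (A.orderIsoOfFin rfl j) ↔
      π (B.orderIsoOfFin rfl (Fin.cast h i)) < π (B.orderIsoOfFin rfl (Fin.cast h j)))

/-- `F` is an (unordered) family `{A_1, …, A_r}` of `r` pairwise disjoint
`k`-element position sets in `[n]` whose corresponding subsequences of `π` are
pairwise similar; i.e., `F` witnesses `r`-twins of length `k` in `π`. -/
def IsTwinFamily (r k n : ℕ) (π : Equiv.Perm (Fin n))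
    (F : Finset (Finset (Fin n))) : Prop :=
  F.card = r ∧ (∀ A ∈ F, A.card = k) ∧
  (F : Set (Finset (Fin n))).Pairwise Disjoint ∧
  (F : Set (Finset (Fin n))).Pairwise (SimilarAt π)

open Finset Function

/-- If a statistic `q` with values in a finite group is equivariant under a family of bijections
indexed by the group, then it is uniformly distributed. -/
theorem card_mul_card_filter_of_equivariant {G X : Type*} [Group G] [Fintype G] [Fintype X]
    (q : X → G) (φ : G → Equiv.Perm X) (hφ : ∀ g x, q (φ g x) = g * q x)
    (S : G → Prop) [DecidablePred S] :
    Fintype.card G * #{x | S (q x)} = #{g | S g} * Fintype.card X := by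
  have hcol (g : G) : #{x | S (q (φ g x))} = #{x | S (q x)} :=
    Finset.card_bij (fun x _ => φ g x) (by simp) (by simp) fun y hy =>
      ⟨(φ g).symm y, by simpa using hy, by simp⟩
  have hrow (x : X) : #{g | S (q (φ g x))} = #{g | S g} :=
    Finset.card_bij (fun g _ => g * q x) (by simp [hφ]) (by simp) fun g hg =>
      ⟨g * (q x)⁻¹, by simpa [hφ] using hg, by simp⟩
  have hcount := Finset.sum_card_bipartiteAbove_eq_sum_card_bipartiteBelow
    (s := (univ : Finset G)) (t := (univ : Finset X)) (fun g x => S (q (φ g x)))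
  simp only [Finset.bipartiteAbove, Finset.bipartiteBelow, hcol, hrow, sum_const, card_univ,
    smul_eq_mul] at hcount
  rw [hcount, mul_comm]

theorem Tuple.eq_sort_of_monotone {k : ℕ} {α : Type*} [LinearOrder α] {f : Fin k → α}
    (hf : Injective f) {σ : Equiv.Perm (Fin k)} (h : Monotone (f ∘ σ)) : σ = Tuple.sort f := by
  refine Tuple.eq_sort_iff.2 ⟨h, fun i j hij hfij => ?_⟩
  exact absurd (σ.injective (hf hfij)) hij.ne

theorem Tuple.sort_comp_perm_inv {k : ℕ} {α : Type*} [LinearOrder α] {f : Fin k → α}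
    (hf : Injective f) (g : Equiv.Perm (Fin k)) :
    Tuple.sort (f ∘ (g⁻¹ : Equiv.Perm (Fin k))) = g * Tuple.sort f := by
  refine (Tuple.eq_sort_of_monotone (hf.comp (g⁻¹ : Equiv.Perm (Fin k)).injective) ?_).symm
  convert Tuple.monotone_sort f using 1
  ext i
  simp

theorem Tuple.lt_iff_sort_symm_lt {k : ℕ} {α : Type*} [LinearOrder α] {f : Fin k → α}
    (hf : Injective f) (i j : Fin k) :
    f i < f j ↔ (Tuple.sort f).symm i < (Tuple.sort f).symm j := by
  have hmono : StrictMono (f ∘ Tuple.sort f) :=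
    (Tuple.monotone_sort f).strictMono_of_injective (hf.comp (Tuple.sort f).injective)
  simpa using hmono.lt_iff_lt (a := (Tuple.sort f).symm i) (b := (Tuple.sort f).symm j)

theorem Tuple.sort_eq_sort_iff {k : ℕ} {α β : Type*} [LinearOrder α] [LinearOrder β]
    {f : Fin k → α} {g : Fin k → β} (hf : Injective f) (hg : Injective g) :
    Tuple.sort f = Tuple.sort g ↔ ∀ i j, f i < f j ↔ g i < g j := by
  refine ⟨fun h i j => ?_, fun h => Tuple.eq_sort_of_monotone hg fun i j hij => ?_⟩
  · rw [Tuple.lt_iff_sort_symm_lt hf, Tuple.lt_iff_sort_symm_lt hg, h]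
  · have := Tuple.monotone_sort f hij
    rw [← not_lt] at this ⊢
    exact fun hlt => this ((h _ _).2 hlt)

theorem similarAt_iff_orderEmbOfFin {n k : ℕ} (π : Equiv.Perm (Fin n)) {A B : Finset (Fin n)}
    (hA : #A = k) (hB : #B = k) :
    SimilarAt π A B ↔ ∀ i j : Fin k,
      (π (A.orderEmbOfFin hA i) < π (A.orderEmbOfFin hA j) ↔
        π (B.orderEmbOfFin hB i) < π (B.orderEmbOfFin hB j)) := by
  subst hA
  have hcast (i : Fin #A) :
      B.orderEmbOfFin rfl (Fin.cast hB.symm i) = B.orderEmbOfFin hB i :=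
    orderEmbOfFin_eq_orderEmbOfFin_iff.2 rfl
  simp only [SimilarAt, coe_orderIsoOfFin_apply]
  constructor
  · rintro ⟨h, H⟩ i j
    simpa only [hcast] using H i j
  · intro H
    refine ⟨hB.symm, fun i j => ?_⟩
    simpa only [hcast] using H i j

section Rows

variable {r k n : ℕ}

/-- The `a`-th row of an array of distinct entries. -/
def arrayRow (e : Fin r × Fin k ↪ Fin n) (a : Fin r) : Fin k ↪ Fin n :=
  ⟨fun i => e (a, i), fun i j h => by simpa using h⟩

/-- The row-wise action of permutations of the columns. -/
def permuteRows (g : Fin r → Equiv.Perm (Fin k)) : Equiv.Perm (Fin r × Fin k) :=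
  Equiv.prodShear (Equiv.refl _) fun a => (g a)⁻¹

theorem card_mul_card_monotone_rows (r k n : ℕ) [DecidablePred fun e : Fin r × Fin k ↪ Fin n =>
    ∀ a, Monotone (arrayRow e a)] :
    k.factorial ^ r * #{e : Fin r × Fin k ↪ Fin n | ∀ a, Monotone (arrayRow e a)} =
      n.descFactorial (r * k) := by
  classical
  have h := card_mul_card_filter_of_equivariant
    (fun (e : Fin r × Fin k ↪ Fin n) a => Tuple.sort (arrayRow e a))
    (fun g => Equiv.embeddingCongr (permuteRows g).symm (Equiv.refl _))
    (fun g e => funext fun a => Tuple.sort_comp_perm_inv (arrayRow e a).injective (g a))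
    (fun g => g = 1)
  simp only [funext_iff, Pi.one_apply, Equiv.Perm.one_def, Tuple.sort_eq_refl_iff_monotone] at h
  simpa [Fintype.card_perm, Fintype.card_embedding_eq, ← funext_iff, Finset.filter_eq',
    ← Pi.one_def, ← Equiv.Perm.one_def] using h

theorem card_mul_card_sort_rows_eq (hr : r ≠ 0) (e : Fin r × Fin k ↪ Fin n) :
    k.factorial ^ r * #{π : Equiv.Perm (Fin n) | ∀ a b,
        Tuple.sort (π ∘ arrayRow e a) = Tuple.sort (π ∘ arrayRow e b)} =
      k.factorial * n.factorial := by
  have h := card_mul_card_filter_of_equivariant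
    (fun (π : Equiv.Perm (Fin n)) a => Tuple.sort (π ∘ arrayRow e a))
    (fun g => Equiv.mulRight ((permuteRows g).viaEmbedding e))
    (fun g π => funext fun a => by
      rw [Pi.mul_apply,
        ← Tuple.sort_comp_perm_inv (π.injective.comp (arrayRow e a).injective) (g a)]
      congr 1
      ext i
      have h : (permuteRows g).viaEmbedding e (e (a, i)) = e (a, (g a)⁻¹ i) :=
        Equiv.Perm.viaEmbedding_apply _ _ _
      exact congrArg (fun x => (π x : ℕ)) h)
    (fun g => ∀ a b, g a = g b)
  have hconst : #{g : Fin r → Equiv.Perm (Fin k) | ∀ a b, g a = g b} = k.factorial := by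
    have : NeZero r := ⟨hr⟩
    have hperm : #(univ : Finset (Equiv.Perm (Fin k))) = k.factorial := by
      simp [Fintype.card_perm]
    rw [← hperm]
    symm
    refine Finset.card_bij (fun σ _ _ => σ) (by simp) (fun σ _ τ _ h => congrFun h 0) fun g hg => ?_
    exact ⟨g 0, mem_univ _, funext fun a => (mem_filter.1 hg).2 0 a⟩
  simpa [Fintype.card_perm, hconst] using h

theorem similarAt_map_arrayRow_iff (π : Equiv.Perm (Fin n)) {e : Fin r × Fin k ↪ Fin n}
    (he : ∀ a, Monotone (arrayRow e a)) (a b : Fin r) :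
    SimilarAt π (univ.map (arrayRow e a)) (univ.map (arrayRow e b)) ↔
      Tuple.sort (π ∘ arrayRow e a) = Tuple.sort (π ∘ arrayRow e b) := by
  have hcard (c : Fin r) : #(univ.map (arrayRow e c)) = k := by simp
  have hrow (c : Fin r) : (arrayRow e c : Fin k → Fin n) =
      (univ.map (arrayRow e c)).orderEmbOfFin (hcard c) :=
    orderEmbOfFin_unique _ (by simp) ((he c).strictMono_of_injective (arrayRow e c).injective)
  rw [similarAt_iff_orderEmbOfFin π (hcard a) (hcard b), ← hrow, ← hrow,
    Tuple.sort_eq_sort_iff (π.injective.comp (arrayRow e a).injective)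
      (π.injective.comp (arrayRow e b).injective)]
  rfl

/-- `A` is an ordered family of pairwise disjoint `k`-sets at which `π` is pairwise similar. -/
def IsTwinTuple (k : ℕ) (π : Equiv.Perm (Fin n)) (A : Fin r → Finset (Fin n)) : Prop :=
  (∀ a, #(A a) = k) ∧ Pairwise (Disjoint on A) ∧ Pairwise (SimilarAt π on A)

open Classical in
theorem card_monotone_sort_rows_eq_card_twinTuple (π : Equiv.Perm (Fin n)) :
    #{e : Fin r × Fin k ↪ Fin n | (∀ a, Monotone (arrayRow e a)) ∧
        ∀ a b, Tuple.sort (π ∘ arrayRow e a) = Tuple.sort (π ∘ arrayRow e b)} =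
      #{A : Fin r → Finset (Fin n) | IsTwinTuple k π A} := by
  refine Finset.card_bij (fun e _ a => univ.map (arrayRow e a)) ?_ ?_ ?_
  · intro e he
    obtain ⟨hmono, hsort⟩ := (mem_filter.1 he).2
    refine mem_filter.2 ⟨mem_univ _, by simp, fun a b hab => ?_, fun a b _ => ?_⟩
    · simp only [onFun, disjoint_left, mem_map, mem_univ, true_and]
      rintro _ ⟨i, rfl⟩ ⟨j, hj⟩
      exact hab (congrArg Prod.fst (e.injective hj)).symm
    · exact (similarAt_map_arrayRow_iff π hmono a b).2 (hsort a b)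
  · intro e he e' he' h
    have hstrict (e : Fin r × Fin k ↪ Fin n) (he : ∀ a, Monotone (arrayRow e a)) (a) :=
      (he a).strictMono_of_injective (arrayRow e a).injective
    ext ⟨a, i⟩ : 1
    have hrange : Set.range (arrayRow e a) = Set.range (arrayRow e' a) := by
      simpa using congrArg (fun s : Finset (Fin n) => (s : Set (Fin n))) (congrFun h a)
    exact congrFun (((hstrict e (mem_filter.1 he).2.1 a).range_inj
      (hstrict e' (mem_filter.1 he').2.1 a)).1 hrange) i
  · intro A hA
    obtain ⟨hcard, hdisj, hsim⟩ := (mem_filter.1 hA).2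
    let e : Fin r × Fin k ↪ Fin n := ⟨fun p => (A p.1).orderEmbOfFin (hcard p.1) p.2, by
      rintro ⟨a, i⟩ ⟨b, j⟩ h
      obtain rfl : a = b := by
        by_contra hab
        exact disjoint_left.1 (hdisj hab) (orderEmbOfFin_mem _ (hcard a) i)
          (by simpa only [h] using orderEmbOfFin_mem _ (hcard b) j)
      simpa using h⟩
    have hmono (a : Fin r) : Monotone (arrayRow e a) := ((A a).orderEmbOfFin (hcard a)).monotone
    have himage (a : Fin r) : univ.map (arrayRow e a) = A a :=
      map_orderEmbOfFin_univ (A a) (hcard a)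
    refine ⟨e, mem_filter.2 ⟨mem_univ _, hmono, fun a b => ?_⟩, funext himage⟩
    obtain rfl | hab := eq_or_ne a b
    · rfl
    · rw [← similarAt_map_arrayRow_iff π hmono, himage, himage]
      exact hsim hab

theorem IsTwinTuple.injective (hk : k ≠ 0) {π : Equiv.Perm (Fin n)} {A : Fin r → Finset (Fin n)}
    (hA : IsTwinTuple k π A) : Injective A := by
  intro a b h
  by_contra hab
  have hdisj : Disjoint (A a) (A b) := hA.2.1 hab
  rw [← h, disjoint_self_iff_empty, ← card_eq_zero, hA.1 a] at hdisj
  exact hk hdisj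

theorem isTwinFamily_image_iff {π : Equiv.Perm (Fin n)}
    {A : Fin r → Finset (Fin n)} (hinj : Injective A) :
    IsTwinFamily r k n π (univ.image A) ↔ IsTwinTuple k π A := by
  simp only [IsTwinFamily, IsTwinTuple, card_image_of_injective _ hinj, card_univ,
    Fintype.card_fin, true_and, coe_image, coe_univ, mem_image, mem_univ,
    forall_exists_index, forall_apply_eq_imp_iff, hinj.injOn.pairwise_image,
    Set.pairwise_univ]

open Classical in
theorem card_image_eq_factorial {α : Type*} [Fintype α] [DecidableEq α] {F : Finset α} (hF : #F = r) :
    #{A : Fin r → α | univ.image A = F ∧ Injective A} = r.factorial := by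
  have hcard : Fintype.card (Fin r ≃ F) = r.factorial := by
    rw [Fintype.card_equiv (Fintype.equivOfCardEq (by simp [hF]))]
    simp
  rw [← hcard, ← card_univ]
  symm
  refine Finset.card_bij (fun σ _ a => (σ a : α)) ?_ ?_ ?_
  · intro σ _
    refine mem_filter.2 ⟨mem_univ _, ?_, Subtype.val_injective.comp σ.injective⟩
    ext x
    simp only [mem_image, mem_univ, true_and]
    refine ⟨?_, fun hx => ⟨σ.symm ⟨x, hx⟩, by simp⟩⟩
    rintro ⟨a, rfl⟩
    exact (σ a).2
  · intro σ _ τ _ h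
    ext a
    exact congrFun h a
  · intro A hA
    obtain ⟨rfl, hinj⟩ := (mem_filter.1 hA).2
    refine ⟨Equiv.ofBijective (fun a => ⟨A a, mem_image_of_mem A (mem_univ a)⟩) ⟨?_, ?_⟩,
      mem_univ _, rfl⟩
    · exact fun a b h => hinj (congrArg Subtype.val h)
    · rintro ⟨x, hx⟩
      obtain ⟨a, -, rfl⟩ := mem_image.1 hx
      exact ⟨a, rfl⟩

open Classical in
theorem card_twinTuple_eq (hk : k ≠ 0) (π : Equiv.Perm (Fin n)) :
    #{A : Fin r → Finset (Fin n) | IsTwinTuple k π A} =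
      Nat.card {F : Finset (Finset (Fin n)) // IsTwinFamily r k n π F} * r.factorial := by
  rw [Nat.card_eq_fintype_card, Fintype.card_subtype]
  rw [Finset.card_eq_sum_card_fiberwise (f := fun A => univ.image A)
    (t := ({F | IsTwinFamily r k n π F} : Finset (Finset (Finset (Fin n)))))]
  · refine Finset.sum_const_nat fun F hF => ?_
    have hF := (mem_filter.1 hF).2
    rw [← card_image_eq_factorial hF.1, filter_filter]
    congr 1
    ext A
    simp only [mem_filter, mem_univ, true_and]
    constructor
    · exact fun ⟨hA, h⟩ => ⟨h, hA.injective hk⟩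
    · rintro ⟨rfl, hinj⟩
      exact ⟨(isTwinFamily_image_iff hinj).1 hF, rfl⟩
  · intro A hA
    have hA : IsTwinTuple k π A := by simpa using hA
    simpa using (isTwinFamily_image_iff (hA.injective hk)).2 hA

open Classical in
theorem sum_card_twinFamily_mul (hr : r ≠ 0) (hk : k ≠ 0) :
    (∑ π : Equiv.Perm (Fin n),
        Nat.card {F : Finset (Finset (Fin n)) // IsTwinFamily r k n π F}) *
      (r.factorial * (k.factorial ^ r * k.factorial ^ r)) =
      n.descFactorial (r * k) * (k.factorial * n.factorial) := by
  have hcount : (∑ π : Equiv.Perm (Fin n),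
        Nat.card {F : Finset (Finset (Fin n)) // IsTwinFamily r k n π F}) * r.factorial =
      ∑ e ∈ {e : Fin r × Fin k ↪ Fin n | ∀ a, Monotone (arrayRow e a)},
        #{π : Equiv.Perm (Fin n) | ∀ a b,
          Tuple.sort (π ∘ arrayRow e a) = Tuple.sort (π ∘ arrayRow e b)} := by
    simp only [sum_mul, ← card_twinTuple_eq hk, ← card_monotone_sort_rows_eq_card_twinTuple,
      ← filter_filter]
    exact Finset.sum_card_bipartiteAbove_eq_sum_card_bipartiteBelow
      fun (π : Equiv.Perm (Fin n)) e =>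
        ∀ a b, Tuple.sort (π ∘ arrayRow e a) = Tuple.sort (π ∘ arrayRow e b)
  rw [← mul_assoc, hcount, mul_left_comm, ← mul_assoc, mul_comm _ (_ * _), mul_assoc,
    mul_comm _ (k.factorial ^ r), mul_sum, ← card_mul_card_monotone_rows]
  simp only [card_mul_card_sort_rows_eq hr, sum_const, smul_eq_mul]
  ring

end Rows

/-- The expected number of `r`-twins of length `k` (counted as unordered families of
`r` pairwise disjoint `k`-element position sets with pairwise similar subsequences)
in a uniformly random permutation of `[n]` equals
`n(n-1)⋯(n-rk+1) / (r!·(k!)^(2r-1))`. -/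
theorem expected_number_of_twins (r k n : ℕ) (hr : 2 ≤ r) (hk : 1 ≤ k)
    (hkn : r * k ≤ n) :
    (∑ π : Equiv.Perm (Fin n),
        (Nat.card {F : Finset (Finset (Fin n)) // IsTwinFamily r k n π F} : ℝ)) /
        (n.factorial : ℝ)
      = (n.descFactorial (r * k) : ℝ) /
          ((r.factorial : ℝ) * (k.factorial : ℝ) ^ (2 * r - 1)) := by
  have h := sum_card_twinFamily_mul (r := r) (k := k) (n := n) (by omega) (by omega)
  have hpow : (k.factorial : ℝ) ^ r * (k.factorial : ℝ) ^ r =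
      (k.factorial : ℝ) ^ (2 * r - 1) * k.factorial := by
    rw [← pow_add, ← pow_succ]
    congr 1
    omega
  have h' := congrArg (Nat.cast : ℕ → ℝ) h
  push_cast at h'
  rw [hpow] at h'
  have hkf : (k.factorial : ℝ) ≠ 0 := by positivity
  rw [div_eq_div_iff (by positivity) (by positivity)]
  apply mul_right_cancel₀ hkf
  linear_combination h'
end

section
/- Let r ≥ 2, k ≥ 1 and n be integers with rk ≤ n, let Π be a uniformly random permutation of [n], and let X be the number of r-twins of length k in Π (counted as unordered families of r pairwise disjoint k-element position sets with pairwise similar subsequences). Then E[X] < (n^r · e^{2r−1} / k^{2r−1})^k. -/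
/-- Two injective sequences with the same relative order that are rearranged into the same sequence
are rearranged by the same permutation. -/
theorem eq_of_comp_perm_of_lt_iff_lt {α β : Type*} [Finite α] [LinearOrder β] {g g' : α → β}
    (hg' : Function.Injective g') (h : ∀ a b, g a < g b ↔ g' a < g' b) {σ τ : Equiv.Perm α}
    (hστ : ∀ a, g (σ a) = g' (τ a)) : σ = τ := by
  let _ : LinearOrder α := LinearOrder.lift' g' hg'
  have hlt (a b : α) : a < b ↔ g' a < g' b := Iff.rfl
  let r (a b : α) : Prop := τ a < τ b
  let σ' : r ≃r ((· < ·) : α → α → Prop) :=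
    ⟨σ, fun {a b} => by rw [hlt, ← h, hστ, hστ, ← hlt]⟩
  let τ' : r ≃r ((· < ·) : α → α → Prop) := ⟨τ, Iff.rfl⟩
  exact Equiv.ext (InitialSeg.eq σ'.toInitialSeg τ'.toInitialSeg)

theorem card_perm_mul_factorial_pow_le {n k s : ℕ} (e : Fin (s + 1) × Fin k ↪ Fin n) :
    Nat.card {π : Equiv.Perm (Fin n) // ∀ i a b,
      π (e (0, a)) < π (e (0, b)) ↔ π (e (i, a)) < π (e (i, b))} * k.factorial ^ s
      ≤ n.factorial := by
  let blockPerm (σ : Fin s → Equiv.Perm (Fin k)) : Equiv.Perm (Fin n) :=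
    Equiv.Perm.viaEmbedding (Equiv.prodCongrRight (Fin.cons 1 σ : Fin (s + 1) → _)) e
  have hblock (σ i a) : blockPerm σ (e (i, a)) =
      e (i, (Fin.cons 1 σ : Fin (s + 1) → Equiv.Perm (Fin k)) i a) :=
    Equiv.Perm.viaEmbedding_apply _ _ _
  have hinj : Function.Injective (fun p : {π : Equiv.Perm (Fin n) // ∀ i a b,
      π (e (0, a)) < π (e (0, b)) ↔ π (e (i, a)) < π (e (i, b))} × (Fin s → Equiv.Perm (Fin k)) =>
      p.1.1 * blockPerm p.2) := by
    rintro ⟨⟨π, hπ⟩, σ⟩ ⟨⟨ρ, hρ⟩, τ⟩ h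
    simp only at h
    have hpt (i a) : π (e (i, (Fin.cons 1 σ : Fin (s + 1) → Equiv.Perm (Fin k)) i a)) =
        ρ (e (i, (Fin.cons 1 τ : Fin (s + 1) → Equiv.Perm (Fin k)) i a)) := by
      simpa [hblock] using congrArg (fun f => f (e (i, a))) h
    have hzero (a) : π (e (0, a)) = ρ (e (0, a)) := by simpa using hpt 0 a
    have hστ : σ = τ := by
      funext i
      refine eq_of_comp_perm_of_lt_iff_lt (g := fun a => π (e (i.succ, a)))
        (g' := fun a => ρ (e (i.succ, a))) ?_ ?_ ?_
      · intro a b hab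
        simpa using hab
      · intro a b
        rw [← hπ, ← hρ, hzero, hzero]
      · intro a
        simpa using hpt i.succ a
    subst hστ
    simpa using h
  simpa [Fintype.card_perm] using Nat.card_le_card_of_injective _ hinj

theorem SimilarAt.lt_iff_lt {n k : ℕ} {π : Equiv.Perm (Fin n)} {A B : Finset (Fin n)}
    (h : SimilarAt π A B) (hA : A.card = k) (hB : B.card = k) (i j : Fin k) :
    π (A.orderEmbOfFin hA i) < π (A.orderEmbOfFin hA j) ↔
      π (B.orderEmbOfFin hB i) < π (B.orderEmbOfFin hB j) := by
  subst hA
  obtain ⟨_, h⟩ := h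
  exact h i j

theorem card_perm_twins_mul_factorial_pow_le {n k s : ℕ}
    (t : Fin (s + 1) → {A : Finset (Fin n) // A.card = k}) :
    Nat.card {π : Equiv.Perm (Fin n) // (Pairwise fun i j => Disjoint (t i).1 (t j).1) ∧
      Pairwise fun i j => SimilarAt π (t i) (t j)} * k.factorial ^ s ≤ n.factorial := by
  by_cases hd : Pairwise fun i j => Disjoint (t i).1 (t j).1
  · let e : Fin (s + 1) × Fin k ↪ Fin n := by
      refine ⟨fun p => (t p.1).1.orderEmbOfFin (t p.1).2 p.2, ?_⟩
      rintro ⟨i, a⟩ ⟨j, b⟩ h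
      by_cases hij : i = j
      · subst hij
        simpa using h
      · refine absurd h (Finset.disjoint_iff_ne.1 (hd hij) _ ?_ _ ?_) <;>
        exact Finset.orderEmbOfFin_mem _ _ _
    refine le_trans (Nat.mul_le_mul_right _ ?_) (card_perm_mul_factorial_pow_le e)
    refine Nat.card_le_card_of_injective (Subtype.map id ?_)
      (Subtype.map_injective _ Function.injective_id)
    intro π hπ i a b
    by_cases hi : 0 = i
    · subst hi
      rfl
    · exact (hπ.2 hi).lt_iff_lt (t 0).2 (t i).2 a b
  · simp [hd]

theorem card_twinFamily_le (r k n : ℕ) (π : Equiv.Perm (Fin n)) :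
    Nat.card {F : Finset (Finset (Fin n)) // IsTwinFamily r k n π F} ≤
      Nat.card {t : Fin r → {A : Finset (Fin n) // A.card = k} //
        (Pairwise fun i j => Disjoint (t i).1 (t j).1) ∧
        Pairwise fun i j => SimilarAt π (t i) (t j)} := by
  let enum (F : {F : Finset (Finset (Fin n)) // IsTwinFamily r k n π F}) : Fin r ≃ F.1 :=
    (F.1.equivFinOfCardEq F.2.1).symm
  refine Nat.card_le_card_of_injective (fun F => ⟨fun i => ⟨enum F i, F.2.2.1 _ (enum F i).2⟩,
    fun i j hij => F.2.2.2.1 (enum F i).2 (enum F j).2 ?_,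
    fun i j hij => F.2.2.2.2 (enum F i).2 (enum F j).2 ?_⟩) ?_
  · simpa [Subtype.ext_iff] using hij
  · simpa [Subtype.ext_iff] using hij
  · intro F G h
    have hval (i) : (enum F i).1 = (enum G i).1 := by
      have := congrFun (congrArg Subtype.val h) i
      simpa using this
    have hmem (H : {F : Finset (Finset (Fin n)) // IsTwinFamily r k n π F}) (A) :
        A ∈ H.1 ↔ ∃ i, (enum H i).1 = A :=
      ⟨fun hA => ⟨(enum H).symm ⟨A, hA⟩, by simp⟩, by rintro ⟨i, rfl⟩; exact (enum H i).2⟩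
    ext A
    simp only [hmem, hval]

theorem sum_card_twinFamily_mul_le (s k n : ℕ) :
    (∑ π : Equiv.Perm (Fin n),
      Nat.card {F : Finset (Finset (Fin n)) // IsTwinFamily (s + 1) k n π F}) * k.factorial ^ s ≤
      n.choose k ^ (s + 1) * n.factorial := by
  classical
  let T := Fin (s + 1) → {A : Finset (Fin n) // A.card = k}
  let P (π : Equiv.Perm (Fin n)) (t : T) : Prop :=
    (Pairwise fun i j => Disjoint (t i).1 (t j).1) ∧ Pairwise fun i j => SimilarAt π (t i) (t j)
  calc
    _ ≤ (∑ π, Nat.card {t // P π t}) * k.factorial ^ s :=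
      Nat.mul_le_mul_right _ (Finset.sum_le_sum fun π _ => card_twinFamily_le _ _ _ π)
    _ = (∑ t, Nat.card {π // P π t}) * k.factorial ^ s := by
      congr 1
      simp only [Nat.card_eq_fintype_card, Fintype.card_subtype]
      exact Finset.sum_card_bipartiteAbove_eq_sum_card_bipartiteBelow P
    _ ≤ ∑ _t : T, n.factorial := by
      rw [Finset.sum_mul]
      exact Finset.sum_le_sum fun t _ => card_perm_twins_mul_factorial_pow_le t
    _ = _ := by simp [T]

theorem pow_self_lt_factorial_mul_exp_pow {k : ℕ} (hk : 1 ≤ k) :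
    (k : ℝ) ^ k < k.factorial * Real.exp 1 ^ k := by
  have hexp := Real.sum_le_exp_of_nonneg (Nat.cast_nonneg (α := ℝ) k) (k + 1)
  rw [Finset.sum_range_succ] at hexp
  have hpos : 0 < ∑ i ∈ Finset.range k, (k : ℝ) ^ i / i.factorial :=
    Finset.sum_pos (fun i _ => by positivity) (Finset.nonempty_range_iff.2 (by omega))
  rw [← Real.exp_nat_mul, mul_one, mul_comm, ← div_lt_iff₀ (by positivity)]
  linarith

/-- The expected number of `r`-twins of length `k` in a uniformly random permutation
of `[n]` is less than `(n^r · e^(2r-1) / k^(2r-1))^k`. -/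
theorem expected_number_of_twins_upper (r k n : ℕ) (hr : 2 ≤ r) (hk : 1 ≤ k)
    (hkn : r * k ≤ n) :
    (∑ π : Equiv.Perm (Fin n),
        (Nat.card {F : Finset (Finset (Fin n)) // IsTwinFamily r k n π F} : ℝ)) /
        (n.factorial : ℝ)
      < ((n : ℝ) ^ r * Real.exp 1 ^ (2 * r - 1) / (k : ℝ) ^ (2 * r - 1)) ^ k := by
  obtain ⟨s, rfl⟩ : ∃ s, r = s + 1 := ⟨r - 1, by omega⟩
  have hn : 0 < n := by nlinarith
  have hsum := sum_card_twinFamily_mul_le s k n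
  set X := ∑ π : Equiv.Perm (Fin n),
    Nat.card {F : Finset (Finset (Fin n)) // IsTwinFamily (s + 1) k n π F} with hX
  have hexp : 2 * (s + 1) - 1 = s + (s + 1) := by omega
  have hchoose : n.choose k * k.factorial ≤ n ^ k := by
    rw [mul_comm, ← Nat.descFactorial_eq_factorial_mul_choose]
    exact Nat.descFactorial_le_pow n k
  have hcount : X * k.factorial ^ (s + (s + 1)) ≤ n ^ (k * (s + 1)) * n.factorial :=
    calc
      _ = X * k.factorial ^ s * k.factorial ^ (s + 1) := by ring
      _ ≤ n.choose k ^ (s + 1) * n.factorial * k.factorial ^ (s + 1) := by gcongr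
      _ = (n.choose k * k.factorial) ^ (s + 1) * n.factorial := by ring
      _ ≤ _ := by
        rw [pow_mul]
        gcongr
  have hcount' : (X : ℝ) * k.factorial ^ (s + (s + 1)) ≤ n ^ (k * (s + 1)) * n.factorial := by
    exact_mod_cast hcount
  have hkpos : (0 : ℝ) < k := by exact_mod_cast hk
  have hnpos : (0 : ℝ) < n := by exact_mod_cast hn
  have hfac : (0 : ℝ) < n.factorial := by exact_mod_cast n.factorial_pos
  have hkfac : (0 : ℝ) < k.factorial := by exact_mod_cast k.factorial_pos
  rw [hexp, ← Nat.cast_sum, ← hX]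
  calc
    (X : ℝ) / n.factorial ≤ n ^ (k * (s + 1)) / k.factorial ^ (s + (s + 1)) := by
      rwa [div_le_div_iff₀ hfac (by positivity)]
    _ < n ^ (k * (s + 1)) * (Real.exp 1 ^ k / k ^ k) ^ (s + (s + 1)) := by
      rw [div_eq_mul_inv, ← inv_pow]
      gcongr
      rw [inv_lt_comm₀ hkfac (by positivity), inv_div, div_lt_iff₀ (by positivity)]
      exact pow_self_lt_factorial_mul_exp_pow hk
    _ = _ := by
      simp only [div_pow, mul_pow, ← pow_mul]
      ring
end

section
/- Let r ≥ 2 and n be integers, and let k be an integer with k ≥ 2e · n^{r/(2r−1)} and rk ≤ n. Then the probability that a uniformly random permutation Π_n of [n] contains r-twins of length k is at most 2^{−(2r−1)k}. -/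
/-- Two similar injective sequences with the same set of values are equal. -/
theorem eq_of_similar_of_range_eq {k n : ℕ} {f g : Fin k → Fin n} (hf : Function.Injective f)
    (hfg : ∀ i i', f i < f i' ↔ g i < g i') (hrange : Set.range f = Set.range g) : f = g := by
  have hfs : StrictMono (f ∘ Tuple.sort f) :=
    (Tuple.monotone_sort f).strictMono_of_injective (hf.comp (Tuple.sort f).injective)
  have hgs : StrictMono (g ∘ Tuple.sort f) := fun i i' h => (hfg _ _).1 (hfs h)
  have h : f ∘ Tuple.sort f = g ∘ Tuple.sort f := by
    rw [← StrictMono.range_inj hfs hgs, (Tuple.sort f).surjective.range_comp,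
      (Tuple.sort f).surjective.range_comp, hrange]
  exact (Tuple.sort f).surjective.injective_comp_right h

/-- The permutation acting as `σ j` on the `j`-th block of positions `e (j, ·)`, where the block
`j = 0` and all positions outside the blocks are fixed. -/
noncomputable def blockPerm {m k n : ℕ} (e : Fin (m + 1) × Fin k ↪ Fin n)
    (σ : Fin m → Equiv.Perm (Fin k)) : Equiv.Perm (Fin n) :=
  Equiv.Perm.viaEmbedding
    (Equiv.prodShear (Equiv.refl _) (Fin.cons 1 σ : Fin (m + 1) → Equiv.Perm (Fin k))) e

theorem blockPerm_zero {m k n : ℕ} (e : Fin (m + 1) × Fin k ↪ Fin n)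
    (σ : Fin m → Equiv.Perm (Fin k)) (i : Fin k) : blockPerm e σ (e (0, i)) = e (0, i) := by
  simp [blockPerm, Equiv.Perm.viaEmbedding_apply]

theorem blockPerm_succ {m k n : ℕ} (e : Fin (m + 1) × Fin k ↪ Fin n)
    (σ : Fin m → Equiv.Perm (Fin k)) (j : Fin m) (i : Fin k) :
    blockPerm e σ (e (j.succ, i)) = e (j.succ, σ j i) := by
  simp [blockPerm, Equiv.Perm.viaEmbedding_apply]

/-- For fixed disjoint blocks of positions, at most a `1 / k! ^ m` fraction of all permutations is
pairwise similar on these `m + 1` blocks. -/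
theorem card_similar_mul_le {m k n : ℕ} (e : Fin (m + 1) × Fin k ↪ Fin n) :
    Nat.card {π : Equiv.Perm (Fin n) // ∀ j j' i i',
      π (e (j, i)) < π (e (j, i')) ↔ π (e (j', i)) < π (e (j', i'))} * k.factorial ^ m
      ≤ n.factorial := by
  have hcard : Nat.card (Fin m → Equiv.Perm (Fin k)) = k.factorial ^ m := by
    simp [Fintype.card_perm]
  have hcard' : Nat.card (Equiv.Perm (Fin n)) = n.factorial := by
    simp [Fintype.card_perm]
  rw [← hcard, ← hcard', ← Nat.card_prod]
  refine Nat.card_le_card_of_injective (fun x => x.1.1 * blockPerm e x.2) ?_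
  rintro ⟨⟨π, hπ⟩, σ⟩ ⟨⟨π', hπ'⟩, σ'⟩ h
  have happly (x : Fin n) : π (blockPerm e σ x) = π' (blockPerm e σ' x) := DFunLike.congr_fun h x
  have hzero (i : Fin k) : π (e (0, i)) = π' (e (0, i)) := by
    simpa only [blockPerm_zero] using happly (e (0, i))
  have hsucc (j : Fin m) (i : Fin k) :
      π (e (j.succ, σ j i)) = π' (e (j.succ, σ' j i)) := by
    simpa only [blockPerm_succ] using happly (e (j.succ, i))
  have hinj (ρ : Equiv.Perm (Fin n)) (j : Fin (m + 1)) :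
      Function.Injective fun i => ρ (e (j, i)) := fun i i' hi => by
    simpa using hi
  have hblock (j : Fin m) :
      (fun i => π (e (j.succ, i))) = fun i => π' (e (j.succ, i)) := by
    refine eq_of_similar_of_range_eq (hinj π _) (fun i i' => ?_) ?_
    · rw [hπ j.succ 0, hzero, hzero, hπ' 0 j.succ]
    · rw [← (σ j).surjective.range_comp,
        ← (σ' j).surjective.range_comp fun i => π' (e (j.succ, i))]
      exact congrArg Set.range (funext (hsucc j))
  have hσ : σ = σ' := by
    funext j
    ext1 i
    refine hinj π' j.succ ?_
    exact (congrFun (hblock j) (σ j i)).symm.trans (hsucc j i)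
  subst hσ
  have hππ' : π = π' := mul_right_cancel h
  subst hππ'
  rfl

theorem card_orderEmbedding_le_choose (k n : ℕ) : Nat.card (Fin k ↪o Fin n) ≤ n.choose k := by
  have hcard : Nat.card (Set.powersetCard (Fin n) k) = n.choose k := by
    rw [Set.powersetCard.card, Nat.card_fin]
  exact (Nat.card_congr Set.powersetCard.ofFinEmbEquiv).trans_le hcard.le

/-- The union bound over all choices of the positions of the twins. -/
theorem card_hasTwins_mul_le (m k n : ℕ) :
    Nat.card {π : Equiv.Perm (Fin n) // HasTwins (m + 1) k n π} * k.factorial ^ m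
      ≤ n.choose k ^ (m + 1) * n.factorial := by
  classical
  let S (p : Fin (m + 1) → Fin k ↪o Fin n) : Finset (Equiv.Perm (Fin n)) :=
    {π | (∀ j j', j ≠ j' → ∀ i i', p j i ≠ p j' i') ∧
      ∀ j j' i i', π (p j i) < π (p j i') ↔ π (p j' i) < π (p j' i')}
  have hS (p) : (S p).card * k.factorial ^ m ≤ n.factorial := by
    by_cases hp : ∀ j j', j ≠ j' → ∀ i i', p j i ≠ p j' i'
    · have hinj : Function.Injective fun x : Fin (m + 1) × Fin k => p x.1 x.2 := by
        rintro ⟨j, i⟩ ⟨j', i'⟩ h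
        obtain rfl : j = j' := by
          by_contra hj
          exact hp j j' hj i i' h
        exact Prod.ext rfl ((p j).injective h)
      refine le_of_eq_of_le ?_ (card_similar_mul_le ⟨_, hinj⟩)
      rw [Nat.card_eq_fintype_card, Fintype.card_subtype]
      congr 2
      ext π
      simpa [S] using fun _ => hp
    · simp [S, hp]
  have hcover : ({π | HasTwins (m + 1) k n π} : Finset (Equiv.Perm (Fin n)))
      ⊆ Finset.univ.biUnion S := by
    intro π hπ
    obtain ⟨p, hmono, hdisj, hsim⟩ := (Finset.mem_filter.1 hπ).2
    exact Finset.mem_biUnion.2 ⟨fun j => OrderEmbedding.ofStrictMono (p j) (hmono j),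
      Finset.mem_univ _, Finset.mem_filter.2 ⟨Finset.mem_univ _, hdisj, hsim⟩⟩
  have hfamilies : Fintype.card (Fin (m + 1) → Fin k ↪o Fin n) ≤ n.choose k ^ (m + 1) := by
    rw [Fintype.card_fun, Fintype.card_fin, ← Nat.card_eq_fintype_card]
    exact Nat.pow_le_pow_left (card_orderEmbedding_le_choose k n) _
  rw [Nat.card_eq_fintype_card, Fintype.card_subtype]
  calc _ ≤ (∑ p, (S p).card) * k.factorial ^ m :=
        Nat.mul_le_mul_right _ ((Finset.card_le_card hcover).trans Finset.card_biUnion_le)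
    _ = ∑ p, (S p).card * k.factorial ^ m := Finset.sum_mul _ _ _
    _ ≤ ∑ _p : Fin (m + 1) → Fin k ↪o Fin n, n.factorial := Finset.sum_le_sum fun p _ => hS p
    _ = Fintype.card (Fin (m + 1) → Fin k ↪o Fin n) * n.factorial := by simp
    _ ≤ _ := Nat.mul_le_mul_right _ hfamilies

theorem pow_le_factorial_of_exp_mul_le {k : ℕ} {x : ℝ} (hx : 0 ≤ x) (h : Real.exp 1 * x ≤ k) :
    x ^ k ≤ k.factorial := by
  have hexp : (k : ℝ) ^ k / k.factorial ≤ Real.exp 1 ^ k := by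
    rw [← Real.exp_nat_mul, mul_one]
    exact Real.pow_div_factorial_le_exp k k.cast_nonneg k
  have hpow : (Real.exp 1 * x) ^ k ≤ (k : ℝ) ^ k := by gcongr
  rw [div_le_iff₀ (by positivity)] at hexp
  rw [mul_pow] at hpow
  exact le_of_mul_le_mul_left (hpow.trans hexp) (by positivity)

theorem two_pow_mul_pow_le_factorial_pow {m k n : ℕ}
    (hk : 2 * Real.exp 1 * (n : ℝ) ^ (((m : ℝ) + 1) / (2 * m + 1)) ≤ k) :
    (2 : ℝ) ^ ((2 * m + 1) * k) * ((n : ℝ) ^ k) ^ (m + 1) ≤ (k.factorial : ℝ) ^ (2 * m + 1) := by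
  set y : ℝ := (n : ℝ) ^ (((m : ℝ) + 1) / (2 * m + 1)) with hy
  have hypow : y ^ (2 * m + 1) = (n : ℝ) ^ (m + 1) := by
    rw [hy, ← Real.rpow_mul_natCast n.cast_nonneg, ← Real.rpow_natCast]
    congr 1
    push_cast
    field_simp
  have hfac : (2 * y) ^ k ≤ k.factorial :=
    pow_le_factorial_of_exp_mul_le (by positivity) (by linarith)
  calc _ = ((2 * y) ^ k) ^ (2 * m + 1) := by
        rw [← pow_mul (2 * y), mul_comm k, mul_pow, pow_mul y, hypow, ← pow_mul, ← pow_mul,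
          mul_comm k]
    _ ≤ _ := by gcongr

/-- If `k ≥ 2e · n^(r/(2r-1))` and `rk ≤ n`, then the probability that a uniformly
random permutation of `[n]` contains `r`-twins of length `k` is at most
`2^(-(2r-1)k)`. -/
theorem prob_twins_le (r k n : ℕ) (hr : 2 ≤ r) (hkn : r * k ≤ n)
    (hk : 2 * Real.exp 1 * (n : ℝ) ^ ((r : ℝ) / (2 * (r : ℝ) - 1)) ≤ (k : ℝ)) :
    (Nat.card {π : Equiv.Perm (Fin n) // HasTwins r k n π} : ℝ) / (n.factorial : ℝ)
      ≤ 1 / (2 : ℝ) ^ ((2 * r - 1) * k) := by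
  obtain ⟨m, rfl⟩ : ∃ m, r = m + 1 := ⟨r - 1, by omega⟩
  have hexponent : ((m + 1 : ℕ) : ℝ) / (2 * ((m + 1 : ℕ) : ℝ) - 1) =
      ((m : ℝ) + 1) / (2 * m + 1) := by
    push_cast
    congr 1
    ring
  rw [hexponent] at hk
  have hpow := two_pow_mul_pow_le_factorial_pow hk
  have hcount : (Nat.card {π : Equiv.Perm (Fin n) // HasTwins (m + 1) k n π} : ℝ)
      * (k.factorial : ℝ) ^ m ≤ (n.choose k : ℝ) ^ (m + 1) * n.factorial := by
    exact_mod_cast card_hasTwins_mul_le m k n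
  have hchoose : (n.choose k : ℝ) * k.factorial ≤ (n : ℝ) ^ k :=
    (le_div_iff₀ (by positivity)).1 (Nat.choose_le_pow_div k n)
  rw [show 2 * (m + 1) - 1 = 2 * m + 1 by omega, div_le_div_iff₀ (by positivity) (by positivity),
    one_mul]
  set N : ℝ := (Nat.card {π : Equiv.Perm (Fin n) // HasTwins (m + 1) k n π} : ℝ)
  set P : ℝ := (2 : ℝ) ^ ((2 * m + 1) * k)
  set F : ℝ := (k.factorial : ℝ)
  have hF : 0 < F ^ (2 * m + 1) := by positivity
  refine le_of_mul_le_mul_right ?_ hF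
  calc N * P * F ^ (2 * m + 1) = N * F ^ m * (P * F ^ (m + 1)) := by ring
    _ ≤ (n.choose k : ℝ) ^ (m + 1) * n.factorial * (P * F ^ (m + 1)) := by gcongr
    _ = n.factorial * (P * ((n.choose k : ℝ) * F) ^ (m + 1)) := by ring
    _ ≤ n.factorial * (P * ((n : ℝ) ^ k) ^ (m + 1)) := by gcongr
    _ ≤ n.factorial * F ^ (2 * m + 1) := by gcongr
end

section
/- Let n ≥ 1, let h be a real-valued function on permutations of [n], and let c > 0 be a constant such that |h(π_1) − h(π_2)| ≤ c whenever the permutation π_2 is obtained from π_1 by swapping two of its elements (i.e., π_2 = π_1 ∘ τ for a transposition τ). Then for a uniformly random permutation Π_n of [n] and every η > 0, P(|h(Π_n) − E[h(Π_n)]| ≥ η) ≤ 2 exp(−η²/(2c²n)). -/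
open Equiv Finset

/-- The moment generating function of a centred family of reals bounded by `c`. -/
theorem sum_exp_mul_le_of_sum_eq_zero {ι : Type*} [Fintype ι] (x : ι → ℝ) {c : ℝ} (hc : 0 < c)
    (hx : ∀ i, |x i| ≤ c) (hsum : ∑ i, x i = 0) (t : ℝ) :
    ∑ i, Real.exp (t * x i) ≤ Fintype.card ι * Real.exp (t ^ 2 * c ^ 2 / 2) := by
  have hpt (i : ι) :
      Real.exp (t * x i) ≤ Real.cosh (t * c) + x i * (Real.sinh (t * c) / c) := by
    have hle : |x i / c| ≤ 1 := by
      rw [abs_div, abs_of_pos hc, div_le_one hc]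
      exact hx i
    have h := Real.exp_mul_le_cosh_add_mul_sinh hle (t * c)
    calc
      Real.exp (t * x i) = Real.exp (x i / c * (t * c)) := by congr 1; field_simp
      _ ≤ Real.cosh (t * c) + x i / c * Real.sinh (t * c) := h
      _ = _ := by ring
  calc
    ∑ i, Real.exp (t * x i)
      ≤ ∑ i, (Real.cosh (t * c) + x i * (Real.sinh (t * c) / c)) := sum_le_sum fun i _ => hpt i
    _ = Fintype.card ι * Real.cosh (t * c) := by
      rw [sum_add_distrib, ← sum_mul, hsum]
      simp
    _ ≤ Fintype.card ι * Real.exp (t ^ 2 * c ^ 2 / 2) := by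
      gcongr
      rw [← mul_pow]
      exact Real.cosh_le_exp_half_sq _

theorem decomposeFin_symm_mul_swap {n : ℕ} (p : Fin (n + 1)) (e : Perm (Fin n)) (i j : Fin n) :
    Perm.decomposeFin.symm (p, e * swap i j) =
      Perm.decomposeFin.symm (p, e) * swap i.succ j.succ := by
  ext x
  refine Fin.cases ?_ (fun k => ?_) x
  · rw [Perm.mul_apply, swap_apply_of_ne_of_ne (Fin.succ_ne_zero i).symm (Fin.succ_ne_zero j).symm]
    simp
  · rw [Perm.mul_apply, (Fin.succ_injective n).swap_apply]
    simp

/-- The permutations mapping `0` to `p` are those whose first `decomposeFin` component is `p`. -/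
theorem sum_decomposeFin_symm_eq_sum_ite {n : ℕ} (h : Perm (Fin (n + 1)) → ℝ) (p : Fin (n + 1)) :
    ∑ e, h (Perm.decomposeFin.symm (p, e)) = ∑ σ, if σ 0 = p then h σ else 0 := by
  rw [← Equiv.sum_comp Perm.decomposeFin.symm, Fintype.sum_prod_type, Fintype.sum_eq_single p]
  · simp
  · intro q hq
    simp [hq]

/-- Fixing the image of `0` to be `p` or `q` changes the sum by at most `c` per permutation. -/
theorem abs_sum_decomposeFin_symm_sub_le {n : ℕ} (h : Perm (Fin (n + 1)) → ℝ) {c : ℝ}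
    (hswap : ∀ π i j, |h π - h (π * swap i j)| ≤ c) (p q : Fin (n + 1)) :
    |∑ e, h (Perm.decomposeFin.symm (p, e)) - ∑ e, h (Perm.decomposeFin.symm (q, e))| ≤
      n.factorial * c := by
  have hq : ∑ e, h (Perm.decomposeFin.symm (q, e)) =
      ∑ e, h (swap p q * Perm.decomposeFin.symm (p, e)) := by
    rw [sum_decomposeFin_symm_eq_sum_ite h q,
      sum_decomposeFin_symm_eq_sum_ite (fun σ => h (swap p q * σ)) p,
      ← Equiv.sum_comp (Equiv.mulLeft (swap p q))]
    refine sum_congr rfl fun σ _ => ?_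
    have : swap p q (σ 0) = q ↔ σ 0 = p := by
      rw [Equiv.swap_apply_eq_iff, swap_apply_right]
    simp [this]
  rw [hq, ← sum_sub_distrib]
  refine (abs_sum_le_sum_abs _ _).trans ((sum_le_card_nsmul _ _ c fun e _ => ?_).trans_eq ?_)
  · rw [swap_mul_eq_mul_swap]
    exact hswap _ _ _
  · simp [Fintype.card_perm]

theorem sum_exp_perm_le {c : ℝ} (hc : 0 < c) (t : ℝ) (n : ℕ) (h : Perm (Fin n) → ℝ)
    (hswap : ∀ π i j, |h π - h (π * swap i j)| ≤ c) :
    ∑ π, Real.exp (t * (h π - (∑ σ, h σ) / n.factorial)) ≤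
      n.factorial * Real.exp (t ^ 2 * c ^ 2 * n / 2) := by
  induction n with
  | zero => simp
  | succ n ih =>
    have hfac : (0 : ℝ) < n.factorial := by positivity
    set m : Fin (n + 1) → ℝ := fun p =>
      (∑ e, h (Perm.decomposeFin.symm (p, e))) / n.factorial with hm
    set M : ℝ := (∑ σ, h σ) / (n + 1).factorial with hM
    have hmM : ∑ p, m p = (n + 1) * M := by
      rw [hm, hM, ← sum_div, ← Fintype.sum_prod_type (f := fun x => h (Perm.decomposeFin.symm x)),
        Equiv.sum_comp Perm.decomposeFin.symm h, Nat.factorial_succ]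
      push_cast
      field_simp
    have hmm (p q : Fin (n + 1)) : |m p - m q| ≤ c := by
      rw [hm]
      simp only
      rw [← sub_div, abs_div, abs_of_pos hfac, div_le_iff₀' hfac]
      exact abs_sum_decomposeFin_symm_sub_le h hswap p q
    have hdev (p : Fin (n + 1)) : |m p - M| ≤ c := by
      have heq : (n + 1) * (m p - M) = ∑ q, (m p - m q) := by
        rw [sum_sub_distrib, hmM]
        simp
        ring
      have hn : (0 : ℝ) < n + 1 := by positivity
      have hle : |(n + 1) * (m p - M)| ≤ (n + 1) * c := by
        rw [heq]
        refine (abs_sum_le_sum_abs _ _).trans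
          ((sum_le_card_nsmul _ _ c fun q _ => hmm p q).trans_eq ?_)
        simp
      rw [abs_mul, abs_of_pos hn] at hle
      exact le_of_mul_le_mul_left hle hn
    have hzero : ∑ p, (m p - M) = 0 := by
      rw [sum_sub_distrib, hmM]
      simp
    have hinner (p : Fin (n + 1)) :
        ∑ e, Real.exp (t * (h (Perm.decomposeFin.symm (p, e)) - m p)) ≤
          n.factorial * Real.exp (t ^ 2 * c ^ 2 * n / 2) := by
      refine ih (fun e => h (Perm.decomposeFin.symm (p, e))) fun π i j => ?_
      rw [decomposeFin_symm_mul_swap]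
      exact hswap _ _ _
    calc
      ∑ π, Real.exp (t * (h π - M))
        = ∑ p, Real.exp (t * (m p - M)) *
            ∑ e, Real.exp (t * (h (Perm.decomposeFin.symm (p, e)) - m p)) := by
          rw [← Equiv.sum_comp Perm.decomposeFin.symm, Fintype.sum_prod_type]
          refine sum_congr rfl fun p _ => ?_
          rw [mul_sum]
          refine sum_congr rfl fun e _ => ?_
          rw [← Real.exp_add]
          ring_nf
      _ ≤ ∑ p, Real.exp (t * (m p - M)) *
            (n.factorial * Real.exp (t ^ 2 * c ^ 2 * n / 2)) :=
          sum_le_sum fun p _ => mul_le_mul_of_nonneg_left (hinner p) (Real.exp_pos _).le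
      _ ≤ ((n + 1 : ℕ) * Real.exp (t ^ 2 * c ^ 2 / 2)) *
            (n.factorial * Real.exp (t ^ 2 * c ^ 2 * n / 2)) := by
          rw [← sum_mul]
          refine mul_le_mul_of_nonneg_right ?_ (by positivity)
          simpa using sum_exp_mul_le_of_sum_eq_zero (fun p => m p - M) hc hdev hzero t
      _ = (n + 1).factorial * Real.exp (t ^ 2 * c ^ 2 * (n + 1 : ℕ) / 2) := by
          rw [mul_mul_mul_comm, ← Real.exp_add, Nat.factorial_succ]
          push_cast
          ring_nf


/-- Azuma–Hoeffding inequality for random permutations: if `h` is a real function on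
permutations of `[n]` changing by at most `c` when two elements of the permutation
are swapped, then for a uniformly random permutation `Π` of `[n]` and every `η > 0`,
`P(|h(Π) - E[h(Π)]| ≥ η) ≤ 2·exp(-η²/(2c²n))`. -/
theorem azuma_hoeffding_permutations (n : ℕ) (hn : 1 ≤ n)
    (h : Equiv.Perm (Fin n) → ℝ) (c : ℝ) (hc : 0 < c)
    (hswap : ∀ (π : Equiv.Perm (Fin n)) (i j : Fin n),
      |h π - h (π * Equiv.swap i j)| ≤ c)
    (η : ℝ) (hη : 0 < η) :
    (Nat.card {π : Equiv.Perm (Fin n) //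
        η ≤ |h π - (∑ σ : Equiv.Perm (Fin n), h σ) / (n.factorial : ℝ)|} : ℝ) /
        (n.factorial : ℝ)
      ≤ 2 * Real.exp (-η ^ 2 / (2 * c ^ 2 * n)) := by
  classical
  set M : ℝ := (∑ σ, h σ) / n.factorial with hM
  have hn' : (0 : ℝ) < n := by exact_mod_cast hn
  have hfac : (0 : ℝ) < n.factorial := by positivity
  set t : ℝ := η / (c ^ 2 * n) with ht
  have ht0 : 0 ≤ t := by positivity
  have hexp : -(t * η) + t ^ 2 * c ^ 2 * n / 2 = -η ^ 2 / (2 * c ^ 2 * n) := by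
    rw [ht]
    field_simp
    ring
  have hmarkov (π : Equiv.Perm (Fin n)) : (if η ≤ |h π - M| then (1 : ℝ) else 0) ≤
      Real.exp (-(t * η)) * (Real.exp (t * (h π - M)) + Real.exp (-t * (h π - M))) := by
    split_ifs with hπ
    · rw [mul_add, ← Real.exp_add, ← Real.exp_add]
      rcases le_abs.mp hπ with hle | hle
      · have h1 : 1 ≤ Real.exp (-(t * η) + t * (h π - M)) :=
          Real.one_le_exp (by nlinarith)
        linarith [Real.exp_pos (-(t * η) + -t * (h π - M))]
      · have h1 : 1 ≤ Real.exp (-(t * η) + -t * (h π - M)) :=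
          Real.one_le_exp (by nlinarith)
        linarith [Real.exp_pos (-(t * η) + t * (h π - M))]
    · positivity
  have hcard : (Nat.card {π : Equiv.Perm (Fin n) // η ≤ |h π - M|} : ℝ) =
      ∑ π, if η ≤ |h π - M| then (1 : ℝ) else 0 := by
    rw [Nat.card_eq_fintype_card, Fintype.card_subtype, sum_boole]
  rw [hcard, div_le_iff₀ hfac]
  have hpos := sum_exp_perm_le hc t n h hswap
  have hneg := sum_exp_perm_le hc (-t) n h hswap
  rw [neg_sq] at hneg
  calc
    ∑ π, (if η ≤ |h π - M| then (1 : ℝ) else 0)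
      ≤ ∑ π, Real.exp (-(t * η)) *
          (Real.exp (t * (h π - M)) + Real.exp (-t * (h π - M))) :=
        sum_le_sum fun π _ => hmarkov π
    _ = Real.exp (-(t * η)) * (∑ π, Real.exp (t * (h π - M)) +
          ∑ π, Real.exp (-t * (h π - M))) := by
        rw [← mul_sum, sum_add_distrib]
    _ ≤ Real.exp (-(t * η)) * (n.factorial * Real.exp (t ^ 2 * c ^ 2 * n / 2) +
          n.factorial * Real.exp (t ^ 2 * c ^ 2 * n / 2)) :=
        mul_le_mul_of_nonneg_left (add_le_add hpos hneg) (Real.exp_pos _).le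
    _ = 2 * Real.exp (-η ^ 2 / (2 * c ^ 2 * n)) * n.factorial := by
        rw [← hexp, Real.exp_add]
        ring
end

section
/- Let r ≥ 2, let n = a·q for positive integers a, q, and partition [n] into consecutive blocks A_i = {(i−1)a + 1, …, ia} for i = 1, …, q. Let π be a permutation of [n]. Suppose there exist indices i_1 < i_2 < ⋯ < i_m in [q] and pairwise distinct indices j_1, …, j_m in [q] such that for each t ∈ {1,…,m}, the set {s ∈ A_{i_t} : π(s) ∈ A_{j_t}} has at least r elements. Then π contains r-twins of length m. -/
/-- Partition `[n]`, `n = a·q`, into `q` consecutive blocks of size `a` (position `s`,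
zero-based, lies in block `s/a`). If there are block indices `i_1 < ⋯ < i_m` and
pairwise distinct block indices `j_1, …, j_m` such that for each `t` at least `r`
positions of block `i_t` are mapped by `π` into block `j_t`, then `π` contains
`r`-twins of length `m`. -/
theorem matching_gives_twins (r a q m : ℕ) (hr : 2 ≤ r) (ha : 0 < a) (hq : 0 < q)
    (π : Equiv.Perm (Fin (a * q))) (ii jj : Fin m → Fin q)
    (hii : StrictMono ii) (hjj : Function.Injective jj)
    (hcount : ∀ t, r ≤ (Finset.univ.filter fun s : Fin (a * q) =>
        (s : ℕ) / a = (ii t : ℕ) ∧ ((π s : ℕ)) / a = (jj t : ℕ)).card) :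
    HasTwins r m (a * q) π := by
  have fin_lt_of_div_lt : ∀ x y : Fin (a * q), (x : ℕ) / a < (y : ℕ) / a → x < y :=
    fun x y h => Fin.lt_def.2 (lt_of_not_ge fun hxy => (Nat.div_le_div_right hxy).not_gt h)
  let e := fun t => Finset.orderEmbOfCardLe _ (hcount t)
  have he : ∀ t j, (e t j : ℕ) / a = (ii t : ℕ) ∧ (π (e t j) : ℕ) / a = (jj t : ℕ) :=
    fun t j => (Finset.mem_filter.1 (Finset.orderEmbOfCardLe_mem _ (hcount t) j)).2
  have value_lt : ∀ j t t', jj t < jj t' → π (e t j) < π (e t' j) := by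
    intro j t t' h
    apply fin_lt_of_div_lt
    rw [(he t j).2, (he t' j).2]
    exact h
  have value_lt_iff : ∀ j t t', π (e t j) < π (e t' j) ↔ jj t < jj t' := by
    refine fun j t t' => ⟨fun h => ?_, value_lt j t t'⟩
    rcases lt_trichotomy (jj t) (jj t') with h' | h' | h'
    · exact h'
    · rw [hjj h'] at h
      exact absurd h (lt_irrefl _)
    · exact absurd h (value_lt j t' t h').asymm
  refine ⟨fun j t => e t j, fun j t t' h => ?_, fun j j' hj t t' h => ?_, fun j j' t t' => ?_⟩
  · apply fin_lt_of_div_lt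
    rw [(he t j).1, (he t' j).1]
    exact hii h
  · have h : e t j = e t' j' := h
    have ht : t = t' := by
      apply hii.injective
      apply Fin.ext
      rw [← (he t j).1, ← (he t' j').1, h]
    subst ht
    exact hj ((e t).injective h)
  · exact (value_lt_iff j t t').trans (value_lt_iff j' t t').symm
end

section
/- Let r ≥ 2, set R = C(2r−1, r), and let n and N be positive integers. Let A ⊆ [n] be a set of size (2r−1)N and let π be any arrangement (permutation) of the elements of A. Then π contains (2n/N)-narrow r-twins of length at least (N/2)^{1/R}; that is, there exist r pairwise disjoint, pairwise similar subsequences (x^{(j)}_1,…,x^{(j)}_k), j = 1,…,r, of π with k ≥ (N/2)^{1/R} such that for every i ∈ {1,…,k}, the set {x^{(j)}_i : 1 ≤ j ≤ r} has width (maximum minus minimum) at most 2n/N. -/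
/-- If finitely many transitive irreflexive relations on a nonempty finite type make any two distinct
elements comparable in at least one of them, then one of the relations has a chain whose length
raised to the number of relations is at least the size of the type. -/
theorem exists_chain_card_le_pow {κ β : Type*} [Fintype κ] [Nonempty κ] [Fintype β] [Nonempty β]
    (lt : κ → β → β → Prop) (hirr : ∀ k a, ¬ lt k a a)
    (htrans : ∀ k a b c, lt k a b → lt k b c → lt k a c)
    (hcomp : ∀ a b, a ≠ b → ∃ k, lt k a b ∨ lt k b a) :
    ∃ (k : κ) (l : ℕ) (c : Fin l → β), (∀ i j, i < j → lt k (c i) (c j)) ∧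
      Fintype.card β ≤ l ^ Fintype.card κ := by
  classical
  let Ch : κ → β → ℕ → Prop := fun k b l =>
    ∃ c : Fin (l + 1) → β, (∀ i j, i < j → lt k (c i) (c j)) ∧ c (Fin.last l) = b
  have ch_zero : ∀ k b, Ch k b 0 := fun k b =>
    ⟨fun _ => b, fun i j hij => by omega, rfl⟩
  have ch_succ : ∀ k a b l, Ch k a l → lt k a b → Ch k b (l + 1) := by
    rintro k a b l ⟨c, hc, rfl⟩ hab
    refine ⟨Fin.snoc c b, fun i j hij => ?_, by simp⟩
    induction i using Fin.lastCases with
    | last => exact absurd hij (not_lt.2 (Fin.le_last j))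
    | cast i =>
      induction j using Fin.lastCases with
      | last =>
        simp only [Fin.snoc_castSucc, Fin.snoc_last]
        rcases (Fin.le_last i).eq_or_lt with h | h
        · rwa [h]
        · exact htrans _ _ _ _ (hc _ _ h) hab
      | cast j =>
        simp only [Fin.snoc_castSucc]
        exact hc _ _ (by simpa using hij)
  have ch_le : ∀ k b l, Ch k b l → l ≤ Fintype.card β := by
    rintro k b l ⟨c, hc, -⟩
    have hinj : Function.Injective c := fun i j hij => by
      rcases lt_trichotomy i j with h | h | h
      · exact absurd (hij ▸ hc _ _ h) (hirr k _)
      · exact h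
      · exact absurd (hij ▸ hc _ _ h) (hirr k _)
    have := Fintype.card_le_of_injective c hinj
    simp only [Fintype.card_fin] at this
    omega
  let h : κ → β → ℕ := fun k b => Nat.findGreatest (Ch k b) (Fintype.card β)
  have h_spec : ∀ k b, Ch k b (h k b) := fun k b =>
    Nat.findGreatest_spec (P := Ch k b) (Nat.zero_le _) (ch_zero k b)
  have h_lt : ∀ k a b, lt k a b → h k a < h k b := fun k a b hab => by
    have := ch_succ k a b _ (h_spec k a) hab
    exact Nat.le_findGreatest (ch_le _ _ _ this) this
  obtain ⟨⟨k, b⟩, hmax⟩ := Finite.exists_max (fun x : κ × β => h x.1 x.2)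
  obtain ⟨c, hc, -⟩ := h_spec k b
  refine ⟨k, h k b + 1, c, hc, ?_⟩
  let F : β → κ → Fin (h k b + 1) := fun b' k' => ⟨h k' b', Nat.lt_succ_of_le (hmax (k', b'))⟩
  have hF : Function.Injective F := fun x y hxy => by
    by_contra hne
    obtain ⟨k', hk'⟩ := hcomp x y hne
    have heq : h k' x = h k' y := congrArg Fin.val (congrFun hxy k')
    rcases hk' with hk' | hk'
    · exact (h_lt _ _ _ hk').ne heq
    · exact (h_lt _ _ _ hk').ne' heq
  simpa using Fintype.card_le_of_injective F hF

/-- The positions of a sequence of `m * N` distinct values split into `N` blocks of size `m`, each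
listed in increasing order, such that the values in earlier blocks are below those in later ones. -/
theorem exists_blocks (m N : ℕ) (f : Fin (m * N) → ℕ) (hinj : Function.Injective f) :
    ∃ u : Fin N → Fin m → Fin (m * N), (∀ b, StrictMono (u b)) ∧
      ∀ b b' s s', b < b' → f (u b s) < f (u b' s') := by
  classical
  have hsort : StrictMono (f ∘ Tuple.sort f) :=
    (Tuple.monotone_sort f).strictMono_of_injective (hinj.comp (Tuple.sort f).injective)
  have hlt : ∀ (b : Fin N) (t : Fin m), m * b.1 + t.1 < m * N := fun b t =>
    calc m * b.1 + t.1 < m * b.1 + m := by omega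
      _ = m * (b.1 + 1) := by ring
      _ ≤ m * N := Nat.mul_le_mul_left _ b.2
  let q : Fin N → Fin m → Fin (m * N) := fun b t => Tuple.sort f ⟨m * b.1 + t.1, hlt b t⟩
  have hq : ∀ b, Function.Injective (q b) := fun b t t' h => by
    have := congrArg Fin.val ((Tuple.sort f).injective h)
    simp only at this
    omega
  have hcard : ∀ b, (Finset.univ.image (q b)).card = m := fun b => by
    rw [Finset.card_image_of_injective _ (hq b), Finset.card_fin]
  refine ⟨fun b => (Finset.univ.image (q b)).orderEmbOfFin (hcard b),
    fun b => OrderEmbedding.strictMono _, fun b b' s s' hbb => ?_⟩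
  obtain ⟨t, -, ht⟩ := Finset.mem_image.1 (Finset.orderEmbOfFin_mem _ (hcard b) s)
  obtain ⟨t', -, ht'⟩ := Finset.mem_image.1 (Finset.orderEmbOfFin_mem _ (hcard b') s')
  beta_reduce
  rw [← ht, ← ht']
  apply hsort
  rw [Fin.mk_lt_mk]
  calc m * b.1 + t.1 < m * b.1 + m := by omega
    _ = m * (b.1 + 1) := by ring
    _ ≤ m * b'.1 := Nat.mul_le_mul_left _ hbb
    _ ≤ m * b'.1 + t'.1 := Nat.le_add_right _ _

/-- Among `N` blocks of numbers in `[1, n]`, with values of earlier blocks below those of later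
ones, at least half have all differences at most `2 * n / N`. -/
theorem half_le_card_narrow {ι : Type*} (n N : ℕ) (hn : 1 ≤ n) (hN : 1 ≤ N)
    (v : Fin N → ι → ℕ) (hv : ∀ b s, v b s ∈ Finset.Icc 1 n)
    (hlt : ∀ b b' s s', b < b' → v b s < v b' s') :
    (N : ℝ) / 2 ≤
      Nat.card {b : Fin N // ∀ s s', (v b s : ℝ) ≤ (v b s' : ℝ) + 2 * (n : ℝ) / (N : ℝ)} := by
  classical
  let P : Fin N → Prop := fun b => ∀ s s', (v b s : ℝ) ≤ (v b s' : ℝ) + 2 * (n : ℝ) / (N : ℝ)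
  let W : Finset (Fin N) := Finset.univ.filter fun b => ¬ P b
  have hW : ∀ b : Fin N, ∃ I : Finset ℕ, b ∈ W →
      (∃ s s', I = Finset.Ico (v b s') (v b s)) ∧ 2 * (n : ℝ) / N ≤ I.card := by
    intro b
    by_cases hb : b ∈ W
    · obtain ⟨s, s', hs⟩ : ∃ s s', (v b s' : ℝ) + 2 * (n : ℝ) / (N : ℝ) < (v b s : ℝ) := by
        simpa [W, P] using hb
      refine ⟨Finset.Ico (v b s') (v b s), fun _ => ⟨⟨s, s', rfl⟩, ?_⟩⟩
      have hpos : 0 ≤ 2 * (n : ℝ) / N := by positivity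
      have hle : v b s' ≤ v b s := by
        have : (v b s' : ℝ) ≤ v b s := by linarith
        exact_mod_cast this
      rw [Nat.card_Ico, Nat.cast_sub hle]
      linarith
    · exact ⟨∅, fun h => absurd h hb⟩
  choose I hI using hW
  have hmem : ∀ b ∈ W, ∀ x ∈ I b, ∃ s s', v b s' ≤ x ∧ x < v b s := by
    intro b hb x hx
    obtain ⟨⟨s, s', h⟩, -⟩ := hI b hb
    rw [h, Finset.mem_Ico] at hx
    exact ⟨s, s', hx⟩
  have hdisj : (W : Set (Fin N)).PairwiseDisjoint I := by
    intro b hb b' hb' hne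
    refine Finset.disjoint_left.2 fun x hx hx' => ?_
    obtain ⟨s, s', h1, h2⟩ := hmem b hb x hx
    obtain ⟨t, t', h3, h4⟩ := hmem b' hb' x hx'
    rcases lt_or_gt_of_ne hne with h | h
    · have := hlt b b' s t' h
      omega
    · have := hlt b' b t s' h
      omega
  have hsub : W.biUnion I ⊆ Finset.Icc 1 n := by
    intro x hx
    obtain ⟨b, hb, hxb⟩ := Finset.mem_biUnion.1 hx
    obtain ⟨s, s', h1, h2⟩ := hmem b hb x hxb
    have h3 := Finset.mem_Icc.1 (hv b s)
    have h4 := Finset.mem_Icc.1 (hv b s')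
    exact Finset.mem_Icc.2 ⟨by omega, by omega⟩
  have hsum : (∑ b ∈ W, ((I b).card : ℝ)) ≤ n := by
    have := Finset.card_le_card hsub
    rw [Finset.card_biUnion hdisj, Nat.card_Icc, Nat.add_sub_cancel] at this
    exact_mod_cast this
  have hlow : (W.card : ℝ) * (2 * (n : ℝ) / N) ≤ n := by
    refine le_trans ?_ hsum
    rw [← nsmul_eq_mul]
    exact Finset.card_nsmul_le_sum _ _ _ fun b hb => (hI b hb).2
  have hn' : (0 : ℝ) < n := by exact_mod_cast hn
  have hN' : (0 : ℝ) < N := by exact_mod_cast hN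
  have hWle : (W.card : ℝ) ≤ N / 2 := by
    rw [← mul_div_assoc, div_le_iff₀ hN'] at hlow
    have : (n : ℝ) * (W.card * 2) ≤ n * N := by linarith
    have := le_of_mul_le_mul_left this hn'
    linarith
  have hsplit : (Finset.univ.filter P).card + W.card = N := by
    simpa using Finset.card_filter_add_card_filter_not (s := (Finset.univ : Finset (Fin N))) P
  have hsplit' : ((Finset.univ.filter P).card : ℝ) + W.card = N := by exact_mod_cast hsplit
  rw [Nat.card_eq_fintype_card, Fintype.card_subtype]
  change (N : ℝ) / 2 ≤ ((Finset.univ.filter P).card : ℝ)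
  linarith


/-- Narrow twins: let `r ≥ 2`, `R = C(2r-1, r)`, and `A ⊆ [n]` with `|A| = (2r-1)·N`.
Any arrangement `f` of the elements of `A` contains `(2n/N)`-narrow `r`-twins of
length at least `(N/2)^(1/R)`: there are `k ≥ (N/2)^(1/R)` and strictly increasing,
pairwise disjoint position maps `p j : Fin k → Fin ((2r-1)·N)`, `j = 1, …, r`, whose
value sequences `i ↦ f (p j i)` are pairwise similar and such that for every `i` the
set `{f (p j i) : j}` has width at most `2n/N`. -/
theorem narrow_twins_exist (r n N : ℕ) (hr : 2 ≤ r) (hn : 1 ≤ n) (hN : 1 ≤ N)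
    (A : Finset ℕ) (hAsub : A ⊆ Finset.Icc 1 n) (hAcard : A.card = (2 * r - 1) * N)
    (f : Fin ((2 * r - 1) * N) → ℕ) (hinj : Function.Injective f)
    (hmem : ∀ i, f i ∈ A) :
    ∃ (k : ℕ) (p : Fin r → Fin k → Fin ((2 * r - 1) * N)),
      ((N : ℝ) / 2) ^ (1 / (((2 * r - 1).choose r : ℕ) : ℝ)) ≤ (k : ℝ) ∧
      (∀ j, StrictMono (p j)) ∧
      (∀ j j', j ≠ j' → ∀ i i', p j i ≠ p j' i') ∧
      (∀ j j' i i', f (p j i) < f (p j i') ↔ f (p j' i) < f (p j' i')) ∧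
      (∀ i j j', (f (p j i) : ℝ) ≤ (f (p j' i) : ℝ) + 2 * (n : ℝ) / (N : ℝ)) := by
  classical
  obtain ⟨u, hu, hlt⟩ := exists_blocks (2 * r - 1) N f hinj
  have hhalf := half_le_card_narrow n N hn hN (fun b s => f (u b s))
    (fun b s => hAsub (hmem _)) hlt
  let β := {b : Fin N // ∀ s s', (f (u b s) : ℝ) ≤ (f (u b s') : ℝ) + 2 * (n : ℝ) / (N : ℝ)}
  let κ := {S : Finset (Fin (2 * r - 1)) // S ∈ Finset.univ.powersetCard r}
  have hκ : Fintype.card κ = (2 * r - 1).choose r := by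
    simp [κ]
  have hκpos : 0 < Fintype.card κ := hκ ▸ Nat.choose_pos (by omega)
  have : Nonempty κ := Fintype.card_pos_iff.1 hκpos
  have : Nonempty β := by
    have hN' : (0 : ℝ) < N := by exact_mod_cast hN
    have hpos : (0 : ℝ) < Nat.card β := lt_of_lt_of_le (by positivity) hhalf
    exact (Nat.card_pos_iff.1 (by exact_mod_cast hpos)).1
  have hne : ∀ b b' s s', b ≠ b' → u b s ≠ u b' s' := by
    intro b b' s s' h heq
    rcases lt_or_gt_of_ne h with h | h
    · exact (hlt b b' s s' h).ne (congrArg f heq)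
    · exact (hlt b' b s' s h).ne' (congrArg f heq)
  obtain ⟨⟨S, hS⟩, k, c, hc, hcard⟩ := exists_chain_card_le_pow
    (fun (S : κ) (a b : β) => ∀ s ∈ S.1, u a.1 s < u b.1 s)
    (by
      rintro ⟨S, hS⟩ a h
      have hSr := (Finset.mem_powersetCard.1 hS).2
      obtain ⟨s, hs⟩ : S.Nonempty := Finset.card_pos.1 (by omega)
      exact lt_irrefl _ (h s hs))
    (fun S a b c hab hbc s hs => (hab s hs).trans (hbc s hs))
    (by
      intro a b hab
      have hsplit := Finset.card_filter_add_card_filter_not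
        (s := (Finset.univ : Finset (Fin (2 * r - 1)))) fun s => u a.1 s < u b.1 s
      rw [Finset.card_fin] at hsplit
      rcases le_or_gt r (Finset.univ.filter fun s => u a.1 s < u b.1 s).card with h | h
      · obtain ⟨S, hS, hSr⟩ := Finset.exists_subset_card_eq h
        exact ⟨⟨S, Finset.mem_powersetCard.2 ⟨Finset.subset_univ _, hSr⟩⟩,
          Or.inl fun s hs => (Finset.mem_filter.1 (hS hs)).2⟩
      · obtain ⟨S, hS, hSr⟩ := Finset.exists_subset_card_eq
          (show r ≤ (Finset.univ.filter fun s => ¬ u a.1 s < u b.1 s).card by omega)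
        exact ⟨⟨S, Finset.mem_powersetCard.2 ⟨Finset.subset_univ _, hSr⟩⟩,
          Or.inr fun s hs => lt_of_le_of_ne (not_lt.1 (Finset.mem_filter.1 (hS hs)).2)
            (hne _ _ _ _ fun h => hab (Subtype.ext h.symm))⟩)
  have hSr := (Finset.mem_powersetCard.1 hS).2
  have hcinj : ∀ i i', i ≠ i' → (c i).1 ≠ (c i').1 := by
    intro i i' h heq
    obtain ⟨s, hs⟩ : S.Nonempty := Finset.card_pos.1 (by omega)
    rcases lt_or_gt_of_ne h with h | h
    · exact (hc _ _ h s hs).ne (congrArg (u · s) heq)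
    · exact (hc _ _ h s hs).ne' (congrArg (u · s) heq)
  have hval : ∀ i i' s s', f (u (c i).1 s) < f (u (c i').1 s) →
      f (u (c i).1 s') < f (u (c i').1 s') := by
    intro i i' s s' h
    rcases lt_trichotomy (c i).1 (c i').1 with h' | h' | h'
    · exact hlt _ _ _ _ h'
    · exact absurd h (by rw [h']; exact lt_irrefl _)
    · exact absurd h (hlt _ _ _ _ h').le.not_gt
  refine ⟨k, fun j i => u (c i).1 (S.orderEmbOfFin hSr j), ?_, ?_, ?_, ?_, ?_⟩
  · rw [Nat.card_eq_fintype_card] at hhalf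
    have hle : (N : ℝ) / 2 ≤ (k : ℝ) ^ (2 * r - 1).choose r := by
      refine hhalf.trans ?_
      rw [← hκ, ← Nat.cast_pow]
      exact Nat.cast_le.2 hcard
    calc ((N : ℝ) / 2) ^ (1 / (((2 * r - 1).choose r : ℕ) : ℝ))
        ≤ ((k : ℝ) ^ (2 * r - 1).choose r) ^ (1 / (((2 * r - 1).choose r : ℕ) : ℝ)) :=
          Real.rpow_le_rpow (by positivity) hle (by positivity)
      _ = k := by
          rw [one_div]
          exact Real.pow_rpow_inv_natCast (by positivity) (hκ ▸ hκpos.ne')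
  · exact fun j i i' h => hc i i' h _ (Finset.orderEmbOfFin_mem _ _ _)
  · intro j j' hj i i'
    by_cases hi : i = i'
    · subst hi
      exact fun h => hj ((S.orderEmbOfFin hSr).injective ((hu _).injective h))
    · exact hne _ _ _ _ (hcinj i i' hi)
  · exact fun j j' i i' => ⟨hval _ _ _ _, hval _ _ _ _⟩
  · exact fun i j j' => (c i).2 _ _
end

section
/- Let r ≥ 2, let n = a·q for positive integers a, q, and partition [n] into consecutive blocks A_i = {(i−1)a + 1, …, ia}, i = 1, …, q. For a permutation π of [n], define the bipartite graph B(π) with vertex classes U = V = {1,…,q} and an edge ij (i ∈ U, j ∈ V) whenever |{s ∈ A_i : π(s) ∈ A_j}| ≥ r, and let ν(B(π)) denote the maximum size of a matching in B(π). If the permutation π_2 is obtained from π_1 by swapping two of its elements, then |ν(B(π_1)) − ν(B(π_2))| ≤ 2. -/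
/-- The maximum size of a matching in the auxiliary bipartite graph `B(π)`
associated with a permutation `π` of `[n]`, `n = a·q`: its vertex classes are two
copies of the `q` block indices (blocks of size `a`; position `s`, zero-based, lies
in block `s/a`), and `ij` is an edge iff at least `r` positions of block `i` are
mapped by `π` into block `j`. A matching of size `m` is given by injections
`f, g : Fin m → Fin q` with every `(f t, g t)` an edge. -/
noncomputable def matchingNumber (r a q : ℕ) (π : Equiv.Perm (Fin (a * q))) : ℕ :=
  sSup {m : ℕ | ∃ f g : Fin m → Fin q, Function.Injective f ∧ Function.Injective g ∧
    ∀ t, r ≤ (Finset.univ.filter fun s : Fin (a * q) =>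
      (s : ℕ) / a = (f t : ℕ) ∧ ((π s : ℕ)) / a = (g t : ℕ)).card}

/-- A matching of the auxiliary bipartite graph has at most `q` edges, so the set of sizes
of matchings is bounded. -/
theorem bddAbove_matching_sizes (q : ℕ) (P : ℕ → ℕ → Prop) :
    BddAbove {m : ℕ | ∃ f g : Fin m → Fin q, Function.Injective f ∧ Function.Injective g ∧
      ∀ t, P (f t) (g t)} := by
  refine ⟨q, ?_⟩
  rintro m ⟨f, -, hf, -⟩
  simpa using Fintype.card_le_of_injective f hf

/-- Swapping two positions lowers the matching number by at most `2`: only the matching edges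
at the blocks containing these two positions have to be discarded. -/
theorem matchingNumber_le_mul_swap_add_two (r a q : ℕ) (π : Equiv.Perm (Fin (a * q)))
    (i j : Fin (a * q)) :
    matchingNumber r a q π ≤ matchingNumber r a q (π * Equiv.swap i j) + 2 := by
  refine csSup_le' ?_
  rintro m ⟨f, g, hf, hg, h⟩
  set bad : ℕ → Finset (Fin m) := fun b => Finset.univ.filter fun t => (f t : ℕ) = b with hbad
  have hcard : ∀ b, (bad b).card ≤ 1 := fun b => Finset.card_le_one.2 fun x hx y hy => by
    simp only [hbad, Finset.mem_filter, Finset.mem_univ, true_and] at hx hy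
    exact hf (Fin.ext (hx.trans hy.symm))
  set S := (bad ((i : ℕ) / a) ∪ bad ((j : ℕ) / a))ᶜ with hS
  have hScard : m ≤ S.card + 2 := by
    have h1 := Finset.card_union_le (bad ((i : ℕ) / a)) (bad ((j : ℕ) / a))
    have h2 := Finset.card_add_card_compl (bad ((i : ℕ) / a) ∪ bad ((j : ℕ) / a))
    have h3 := hcard ((i : ℕ) / a)
    have h4 := hcard ((j : ℕ) / a)
    rw [Fintype.card_fin, ← hS] at h2
    omega
  refine hScard.trans (Nat.add_le_add_right (le_csSup (bddAbove_matching_sizes q fun x y =>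
    r ≤ (Finset.univ.filter fun s : Fin (a * q) =>
      (s : ℕ) / a = x ∧ (((π * Equiv.swap i j) s : ℕ)) / a = y).card) ?_) 2)
  have he := (S.orderEmbOfFin rfl).injective
  refine ⟨f ∘ S.orderEmbOfFin rfl, g ∘ S.orderEmbOfFin rfl, hf.comp he, hg.comp he, fun t => ?_⟩
  have ht := S.orderEmbOfFin_mem rfl t
  simp only [Function.comp_apply]
  generalize S.orderEmbOfFin rfl t = u at ht ⊢
  simp only [hS, hbad, Finset.mem_compl, Finset.mem_union, Finset.mem_filter, Finset.mem_univ,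
    true_and, not_or] at ht
  refine (h u).trans (Finset.card_le_card fun s hs => ?_)
  simp only [Finset.mem_filter, Finset.mem_univ, true_and] at hs ⊢
  have hsi : s ≠ i := by
    rintro rfl
    exact ht.1 hs.1.symm
  have hsj : s ≠ j := by
    rintro rfl
    exact ht.2 hs.1.symm
  rwa [Equiv.Perm.mul_apply, Equiv.swap_apply_of_ne_of_ne hsi hsj]

/-- Swapping two elements of the permutation changes the matching number of the
auxiliary bipartite graph by at most `2`. -/
theorem matchingNumber_swap_diff (r a q : ℕ) (hr : 2 ≤ r) (ha : 0 < a) (hq : 0 < q)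
    (π₁ : Equiv.Perm (Fin (a * q))) (i j : Fin (a * q)) :
    |(matchingNumber r a q π₁ : ℤ) -
        (matchingNumber r a q (π₁ * Equiv.swap i j) : ℤ)| ≤ 2 := by
  have h1 := matchingNumber_le_mul_swap_add_two r a q π₁ i j
  have h2 := matchingNumber_le_mul_swap_add_two r a q (π₁ * Equiv.swap i j) i j
  rw [mul_assoc, Equiv.swap_mul_self, mul_one] at h2
  rw [abs_le]
  constructor <;> omega
end

section
/- There exists a constant c > 0 such that for every n ≥ 1, every permutation of [n] contains an r-square for some integer r ≥ c·√n; that is, s(n) ≥ c·√n, where an r-square is a family of r pairwise disjoint, pairwise similar subsequences each of length r. -/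
open Finset in
/-- The Erdős–Szekeres theorem for an injective map restricted to a finite set. -/
theorem exists_strictMonoOn_or_strictAntiOn {α β : Type*} [LinearOrder α] [LinearOrder β]
    {f : α → β} (hf : Function.Injective f) (a b : ℕ) (S : Finset α) (hS : a * b < #S) :
    (∃ T ⊆ S, #T = a + 1 ∧ StrictMonoOn f T) ∨ (∃ T ⊆ S, #T = b + 1 ∧ StrictAntiOn f T) := by
  induction a generalizing S with
  | zero =>
    obtain ⟨x, hx⟩ : S.Nonempty := card_pos.1 (by omega)
    exact Or.inl ⟨{x}, by simpa using hx, by simp, by simp⟩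
  | succ a ih =>
    set M := {x ∈ S | ∀ y ∈ S, y < x → f x < f y}
    by_cases hM : b + 1 ≤ #M
    · obtain ⟨T, hTM, hT⟩ := exists_subset_card_eq hM
      refine Or.inr ⟨T, hTM.trans (filter_subset _ _), hT, fun x hx y hy hxy => ?_⟩
      exact (mem_filter.1 (hTM hy)).2 x (mem_filter.1 (hTM hx)).1 hxy
    · have hcard : #(S \ M) = #S - #M := card_sdiff_of_subset (filter_subset _ _)
      rcases ih (S \ M) (by rw [hcard]; rw [add_mul] at hS; omega) with
        ⟨T, hTS, hT, hmono⟩ | ⟨T, hTS, hT⟩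
      · have hne : T.Nonempty := card_pos.1 (by omega)
        set x := T.min' hne
        have hxT : x ∈ T := T.min'_mem hne
        have hx := mem_sdiff.1 (hTS hxT)
        obtain ⟨y, hyS, hyx, hfyx⟩ : ∃ y ∈ S, y < x ∧ f y < f x := by
          have h := hx.2
          simp only [M, mem_filter, hx.1, true_and, not_forall, not_lt] at h
          obtain ⟨y, hyS, hyx, hle⟩ := h
          exact ⟨y, hyS, hyx, hle.lt_of_ne (hf.ne hyx.ne)⟩
        have hlt : ∀ z ∈ T, y < z ∧ f y < f z := fun z hz =>
          ⟨hyx.trans_le (T.min'_le z hz),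
            hfyx.trans_le (hmono.monotoneOn hxT hz (T.min'_le z hz))⟩
        refine Or.inl ⟨insert y T, insert_subset hyS (hTS.trans sdiff_subset), ?_, ?_⟩
        · rw [card_insert_of_notMem fun h => (hlt y h).1.false, hT]
        · rw [coe_insert, strictMonoOn_insert_iff]
          exact ⟨fun z hz hzy => absurd (hlt z hz).1 hzy.asymm, fun z hz _ => (hlt z hz).2, hmono⟩
      · exact Or.inr ⟨T, hTS.trans sdiff_subset, hT⟩

open Finset in
/-- Greedy extraction: if every finite set with more than `N` elements contains an `r`-element
subset satisfying `P`, then a set with at least `N + m * r` elements contains `m` disjoint ones. -/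
theorem exists_pairwiseDisjoint_of_forall_exists_subset {α : Type*} [DecidableEq α] {r N : ℕ}
    (hr : 0 < r) {P : Finset α → Prop} (hP : ∀ S : Finset α, N < #S → ∃ T ⊆ S, #T = r ∧ P T)
    (m : ℕ) (S : Finset α) (hS : N + m * r ≤ #S) :
    ∃ F : Finset (Finset α), #F = m ∧ (∀ T ∈ F, T ⊆ S ∧ #T = r ∧ P T) ∧
      (F : Set (Finset α)).PairwiseDisjoint id := by
  induction m generalizing S with
  | zero => exact ⟨∅, by simp⟩
  | succ m ih =>
    rw [add_mul, one_mul] at hS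
    obtain ⟨T, hTS, hT, hPT⟩ := hP S (by omega)
    obtain ⟨F, hF, hFP, hdisj⟩ := ih (S \ T) (by rw [card_sdiff_of_subset hTS]; omega)
    have hTF : ∀ U ∈ F, Disjoint T U := fun U hU =>
      disjoint_sdiff.mono_right (hFP U hU).1
    have hnot : T ∉ F := fun h => by
      have := disjoint_self.1 (hTF T h)
      simp_all
    refine ⟨insert T F, by rw [card_insert_of_notMem hnot, hF], ?_, ?_⟩
    · rintro U hU
      rcases mem_insert.1 hU with rfl | hU
      · exact ⟨hTS, hT, hPT⟩
      · exact ⟨(hFP U hU).1.trans sdiff_subset, (hFP U hU).2⟩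
    · rw [coe_insert, Set.pairwiseDisjoint_insert]
      exact ⟨hdisj, fun U hU _ => hTF U hU⟩

open Finset in
/-- Disjoint subsets of size `k` on all of which `π` has the same order type form twins. -/
theorem hasTwins_of_pairwiseDisjoint {r k n : ℕ} {π : Equiv.Perm (Fin n)}
    {F : Finset (Finset (Fin n))} (hF : r ≤ #F) (hk : ∀ T ∈ F, #T = k)
    (hdisj : (F : Set (Finset (Fin n))).PairwiseDisjoint id)
    (hπ : (∀ T ∈ F, StrictMonoOn π T) ∨ (∀ T ∈ F, StrictAntiOn π T)) :
    HasTwins r k n π := by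
  let e : Fin r → F := fun j => F.equivFin.symm (j.castLE hF)
  have he : Function.Injective e := F.equivFin.symm.injective.comp (Fin.castLE_injective hF)
  let p : ∀ j, Fin k ↪o Fin n := fun j => (e j).1.orderEmbOfFin (hk _ (e j).2)
  have hp : ∀ j i, p j i ∈ (e j).1 := fun j i => orderEmbOfFin_mem _ _ i
  refine ⟨fun j => p j, fun j => (p j).strictMono, fun j j' hjj i i' h => ?_, fun j j' i i' => ?_⟩
  · have hd : Disjoint (e j).1 (e j').1 :=
      hdisj (e j).2 (e j').2 fun h => hjj (he (Subtype.ext h))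
    exact disjoint_left.1 hd (hp j i) ((show p j i = p j' i' from h) ▸ hp j' i')
  · rcases hπ with h | h
    · rw [(h _ (e j).2).lt_iff_lt (hp _ _) (hp _ _), (h _ (e j').2).lt_iff_lt (hp _ _) (hp _ _),
        (p j).lt_iff_lt, (p j').lt_iff_lt]
    · rw [(h _ (e j).2).lt_iff_gt (hp _ _) (hp _ _), (h _ (e j').2).lt_iff_gt (hp _ _) (hp _ _),
        (p j).lt_iff_lt, (p j').lt_iff_lt]

open Finset in
theorem hasTwins_succ_of_sq_le {b n : ℕ} (hn : (2 * b + 1) ^ 2 ≤ n) (π : Equiv.Perm (Fin n)) :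
    HasTwins (b + 1) (b + 1) n π := by
  classical
  obtain ⟨F, hF, hFP, hdisj⟩ := exists_pairwiseDisjoint_of_forall_exists_subset
    (r := b + 1) (N := b * b)
    (P := fun T : Finset (Fin n) => StrictMonoOn π T ∨ StrictAntiOn π T)
    b.succ_pos
    (fun S hS => by
      rcases exists_strictMonoOn_or_strictAntiOn π.injective b b S hS with
        ⟨T, hTS, hT, h⟩ | ⟨T, hTS, hT, h⟩
      · exact ⟨T, hTS, hT, Or.inl h⟩
      · exact ⟨T, hTS, hT, Or.inr h⟩)
    (2 * b + 1) univ (by rw [card_univ, Fintype.card_fin]; nlinarith)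
  have hsum := card_filter_add_card_filter_not (s := F) fun T : Finset (Fin n) => StrictMonoOn π T
  by_cases h : b + 1 ≤ #(F.filter fun T : Finset (Fin n) => StrictMonoOn π T)
  · exact hasTwins_of_pairwiseDisjoint h (fun T hT => (hFP T (mem_filter.1 hT).1).2.1)
      (hdisj.subset (coe_subset.2 (filter_subset _ _))) (Or.inl fun T hT => (mem_filter.1 hT).2)
  · exact hasTwins_of_pairwiseDisjoint
      (F := F.filter fun T : Finset (Fin n) => ¬ StrictMonoOn π T) (by omega)
      (fun T hT => (hFP T (mem_filter.1 hT).1).2.1) (hdisj.subset (coe_subset.2 (filter_subset _ _)))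
      (Or.inr fun T hT => (hFP T (mem_filter.1 hT).1).2.2.resolve_left (mem_filter.1 hT).2)

/-- An `r`-square in a permutation is `r`-twins of length `r`. There is a constant
`c > 0` such that for every `n ≥ 1`, every permutation of `[n]` contains an
`r`-square for some integer `r ≥ c·√n`. -/
theorem square_lower_bound :
    ∃ c : ℝ, 0 < c ∧ ∀ n : ℕ, 1 ≤ n → ∀ π : Equiv.Perm (Fin n),
      ∃ r : ℕ, c * Real.sqrt n ≤ (r : ℝ) ∧ HasTwins r r n π := by
  refine ⟨1 / 3, by norm_num, fun n hn π => ?_⟩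
  have hpos : 0 < n.sqrt := Nat.sqrt_pos.2 hn
  set b := (n.sqrt - 1) / 2
  refine ⟨b + 1, ?_, hasTwins_succ_of_sq_le ?_ π⟩
  · have hle : n ≤ (3 * (b + 1)) ^ 2 :=
      (Nat.lt_succ_sqrt' n).le.trans (Nat.pow_le_pow_left (by omega) 2)
    have : Real.sqrt n ≤ 3 * (b + 1) := Real.sqrt_le_iff.2 ⟨by positivity, by exact_mod_cast hle⟩
    push_cast
    linarith
  · exact (Nat.pow_le_pow_left (by omega) 2).trans (Nat.sqrt_le' n)
end
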